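/- For every ε > 0, there exists δ₀ > 0 such that the following holds for all δ ∈ (0,δ₀]: let δ ≤ t ≤ 1, and let W, B ⊂ 𝐃 be a (δ,ε)-almost t-bipartite pair of sets. Let Σ := √(δ/t), and let 𝓡 be a family of pairwise 100-incomparable (δ,Σ)-rectangles each of type (≥m, ≥n)_ε relative to (W,B), where 1 ≤ m ≤ |W| and 1 ≤ n ≤ |B|. Then |𝓡| ≤ δ^{−Cε} ( (|W||B|/(mn))^{3/4} + |W|/m + |B|/n ), where C > 0 is an absolute constant. -/

import Mathlib

open Metric Set

noncomputable section

/-- The plane `ℝ²`. -/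
abbrev Plane := EuclideanSpace ℝ (Fin 2)

/-- The parameter space `ℝ² × ℝ` of circles: a pair `(x, r)` of a centre and a radius. -/
abbrev Param := (EuclideanSpace ℝ (Fin 2)) × ℝ

/-- The point of `ℝ²` with coordinates `a`, `b`. -/
def mk2 (a b : ℝ) : Plane := (WithLp.equiv 2 (Fin 2 → ℝ)).symm ![a, b]

/-- The Euclidean distance on `ℝ² × ℝ`, viewed as `ℝ³`. -/
def pdist (p q : Param) : ℝ := Real.sqrt (dist p.1 q.1 ^ 2 + (p.2 - q.2) ^ 2)

/-- The tangency parameter `Δ(p,q) = ||x - x'| - |r - r'||`. -/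
def tang (p q : Param) : ℝ := abs (dist p.1 q.1 - |p.2 - q.2|)

/-- The domain `𝐃 = {(x,r) : |x| ≤ 1/4, r ∈ [1/2, 1]}`. -/
def domD : Set Param := {p | ‖p.1‖ ≤ 1 / 4 ∧ p.2 ∈ Set.Icc (1 / 2 : ℝ) 1}

/-- The circle `S(p)` with centre `p.1` and radius `p.2`. -/
def circ (p : Param) : Set Plane := Metric.sphere p.1 p.2

/-- The closed `δ`-annulus `S^δ(p)` around the circle `S(p)`. -/
def annulus (δ : ℝ) (p : Param) : Set Plane := {w | Metric.infDist w (circ p) ≤ δ}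

/-- The `(δ,σ)`-rectangle `R^δ_σ(p,v) = S^δ(p) ∩ B(v,σ)`. -/
def rect (δ σ : ℝ) (p : Param) (v : Plane) : Set Plane :=
  annulus δ p ∩ Metric.closedBall v σ

/-- Admissible data `(p, v)` for a rectangle: `p ∈ 𝐃` and `v ∈ S(p)`. -/
def IsRectData (r : Param × Plane) : Prop := r.1 ∈ domD ∧ r.2 ∈ circ r.1

/-- `C`-comparability of two rectangles (given by their data): there is a third
`(δ,σ)`-rectangle `R` with `R₁ ∪ R₂ ⊆ C·R`. -/
def Comp (δ σ C : ℝ) (r₁ r₂ : Param × Plane) : Prop :=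
  ∃ r : Param × Plane, IsRectData r ∧
    rect δ σ r₁.1 r₁.2 ∪ rect δ σ r₂.1 r₂.2 ⊆ rect (C * δ) (C * σ) r.1 r.2

/-- The index of the dyadic `δ`-cube of `ℝ²` containing a point. -/
def idx2 (δ : ℝ) (v : Plane) : ℤ × ℤ := (⌊v 0 / δ⌋, ⌊v 1 / δ⌋)

/-- The index of the dyadic `δ`-cube of `ℝ³ = ℝ² × ℝ` containing a point. -/
def idx3 (δ : ℝ) (p : Param) : (ℤ × ℤ) × ℤ := (idx2 δ p.1, ⌊p.2 / δ⌋)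

/-- `|E|_δ`: the number of dyadic `δ`-cubes intersecting `E ⊆ ℝ²`. -/
def count2 (δ : ℝ) (E : Set Plane) : ℕ := Nat.card (idx2 δ '' E)

/-- `|P|_δ`: the number of dyadic `δ`-cubes intersecting `P ⊆ ℝ³`. -/
def count3 (δ : ℝ) (P : Set Param) : ℕ := Nat.card (idx3 δ '' P)

/-- `|Ω|_δ`: the number of dyadic `δ`-cubes of `ℝ⁵ = ℝ³ × ℝ²` intersecting `Ω`. -/
def count5 (δ : ℝ) (Ω : Set (Param × Plane)) : ℕ :=
  Nat.card ((fun ω => (idx3 δ ω.1, idx2 δ ω.2)) '' Ω)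

/-- A `(δ,s,C)`-set in the plane. -/
def IsDSet2 (δ s C : ℝ) (E : Set Plane) : Prop :=
  Bornology.IsBounded E ∧ ∀ (x : Plane) (r : ℝ), δ ≤ r →
    (count2 δ (E ∩ Metric.closedBall x r) : ℝ) ≤ C * r ^ s * (count2 δ E : ℝ)

/-- A `(δ,s,C)`-set in `ℝ³ = ℝ² × ℝ`. -/
def IsDSet3 (δ s C : ℝ) (P : Set Param) : Prop :=
  Bornology.IsBounded P ∧ ∀ (x : Param) (r : ℝ), δ ≤ r →
    (count3 δ (P ∩ {q | pdist q x ≤ r}) : ℝ) ≤ C * r ^ s * (count3 δ P : ℝ)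

/-- `x ∈ 2^{-ℕ}`. -/
def IsDyadic (x : ℝ) : Prop := ∃ n : ℕ, x = (2 : ℝ) ^ (-(n : ℤ))

/-- The smallest dyadic rational `2^{-n} ≥ σ` (for `σ ∈ (0,1]`). -/
def dyadicCeil (σ : ℝ) : ℝ := (2 : ℝ) ^ (-⌊Real.logb 2 σ⁻¹⌋)

/-- Indices of dyadic cubes in `ℝ³ = ℝ² × ℝ`. -/
abbrev CubeIdx := (ℤ × ℤ) × ℤ

/-- The dyadic cube of side length `δ` with index `k`. -/
def cubeSet (δ : ℝ) (k : CubeIdx) : Set Param :=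
  {p | (k.1.1 : ℝ) * δ ≤ p.1 0 ∧ p.1 0 < ((k.1.1 : ℝ) + 1) * δ ∧
       (k.1.2 : ℝ) * δ ≤ p.1 1 ∧ p.1 1 < ((k.1.2 : ℝ) + 1) * δ ∧
       (k.2 : ℝ) * δ ≤ p.2 ∧ p.2 < ((k.2 : ℝ) + 1) * δ}

/-- The centre of the dyadic cube of side length `δ` with index `k`. -/
def cubeCtr (δ : ℝ) (k : CubeIdx) : Param :=
  (mk2 (((k.1.1 : ℝ) + 1 / 2) * δ) (((k.1.2 : ℝ) + 1 / 2) * δ), ((k.2 : ℝ) + 1 / 2) * δ)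

/-- The unit vector with angle `θ`. -/
def dir (θ : ℝ) : Plane := mk2 (Real.cos θ) (Real.sin θ)

/-- The `j`-th (half-open) arc of the partition `𝒮_σ(p)` of the circle `S(p)`
into arcs of length `2πrσ`. -/
def arcSet (p : Param) (σ : ℝ) (j : ℤ) : Set Plane :=
  {w | ∃ θ : ℝ, (j : ℝ) * (2 * Real.pi * σ) ≤ θ ∧ θ < ((j : ℝ) + 1) * (2 * Real.pi * σ) ∧
    w = p.1 + p.2 • dir θ}

/-- The centre of the `j`-th arc of `𝒮_σ(p)`. -/
def arcCenterAt (p : Param) (σ : ℝ) (j : ℤ) : Plane :=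
  p.1 + p.2 • dir (((j : ℝ) + 1 / 2) * (2 * Real.pi * σ))

/-- Valid indices for the arcs of `𝒮_σ(p)`. -/
def validArc (σ : ℝ) (j : ℤ) : Prop := 0 ≤ j ∧ (j : ℝ) < σ⁻¹

/-- The (one-sided) cone `V(p, I)` centred at the centre of `p` and spanned by `I`. -/
def cone (p : Param) (I : Set Plane) : Set Plane :=
  {x | ∃ e ∈ I, ∃ t : ℝ, 0 ≤ t ∧ x = p.1 + t • (e - p.1)}

/-- A pair: (index of a dyadic cube in `ℝ³`, index of an arc). -/
abbrev DPair := CubeIdx × ℤ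

/-- The relation `(p,v) ≺ (𝐩,𝐯)` between pairs at scales `(δ,σ)` and `(Δ,Σ)`. -/
def prec (δ σ Δ Sg : ℝ) (ω W : DPair) : Prop :=
  cubeSet δ ω.1 ⊆ cubeSet Δ W.1 ∧
  arcCenterAt (cubeCtr δ ω.1) σ ω.2 ∈ cone (cubeCtr Δ W.1) (arcSet (cubeCtr Δ W.1) Sg W.2)

/-- The `(Δ,Σ)`-skeleton `Ω^Δ_Σ` of a set of pairs at scales `(δ,σ)`. -/
def skeleton (δ σ Δ Sg : ℝ) (Ω : Set DPair) : Set DPair :=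
  {W | cubeSet Δ W.1 ⊆ domD ∧ validArc Sg W.2 ∧ ∃ ω ∈ Ω, prec δ σ Δ Sg ω W}

/-- The cube family `P` of a configuration. -/
def configP (Ω : Set DPair) : Set CubeIdx := Prod.fst '' Ω

/-- The arc family `E_σ(p)` of a configuration. -/
def configE (Ω : Set DPair) (k : CubeIdx) : Set ℤ := {j | (k, j) ∈ Ω}

/-- A (dyadic) `(δ,σ,s,C,M)`-configuration. -/
def IsConfigD (δ σ s C : ℝ) (M : ℕ) (Ω : Set DPair) : Prop :=
  (configP Ω).Nonempty ∧
  (∀ k ∈ configP Ω, cubeSet δ k ⊆ domD) ∧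
  IsDSet3 δ s C (⋃ k ∈ configP Ω, cubeSet δ k) ∧
  ∀ k ∈ configP Ω,
    (∀ j ∈ configE Ω k, validArc σ j) ∧
    IsDSet2 σ s C (⋃ j ∈ configE Ω k, arcSet (cubeCtr δ k) σ j) ∧
    Nat.card (configE Ω k) = M

/-- The partial multiplicity function `m^{ρ_λ,ρ_t,C}_{Δ,λ,t}(ω ∣ G)`, counting pairs in the
`(Δ, σa)`-skeleton of `G`; the geometric data of `ω` is given by the circle parameter `pω`
(the centre of the cube of `ω`) and the arc centre `vω`. -/
def pMult (baseδ baseσ Δ σa lam t ρl ρt C : ℝ) (G : Set DPair) (pω : Param) (vω : Plane) : ℕ :=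
  Nat.card {ω' : DPair | ω' ∈ skeleton baseδ baseσ Δ σa G ∧
    (lam ≤ ρl * Δ ∨ lam / ρl ≤ tang pω (cubeCtr Δ ω'.1)) ∧
    tang pω (cubeCtr Δ ω'.1) ≤ ρl * lam ∧
    t / ρt ≤ pdist pω (cubeCtr Δ ω'.1) ∧
    pdist pω (cubeCtr Δ ω'.1) ≤ ρt * t ∧
    (rect (C * Δ) (C * σa) pω vω ∩
      rect (C * Δ) (C * σa) (cubeCtr Δ ω'.1) (arcCenterAt (cubeCtr Δ ω'.1) σa ω'.2)).Nonempty}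

/-- A `δ`-separated set in `ℝ³ = ℝ² × ℝ`. -/
def sep3 (δ : ℝ) (A : Set Param) : Prop := ∀ p ∈ A, ∀ q ∈ A, p ≠ q → δ ≤ pdist p q

/-- A `(δ,ε)`-almost `t`-bipartite pair. -/
def AlmostBipartite (δ ε t : ℝ) (W B : Set Param) : Prop :=
  sep3 δ W ∧ sep3 δ B ∧ (∀ p ∈ W, ∀ q ∈ B, δ ^ ε * t ≤ pdist p q) ∧
    ∀ p ∈ W ∪ B, ∀ q ∈ W ∪ B, pdist p q ≤ δ ^ (-ε) * t

/-- A `t`-bipartite pair (relative to the scale `δ`). -/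
def Bipartite (δ t : ℝ) (W B : Set Param) : Prop :=
  sep3 δ W ∧ sep3 δ B ∧
  (∀ p ∈ W, ∀ q ∈ W, pdist p q ≤ t) ∧ (∀ p ∈ B, ∀ q ∈ B, pdist p q ≤ t) ∧
  (∀ p ∈ B, ∀ q ∈ W, t ≤ pdist p q) ∧
  ∀ p ∈ W ∪ B, ∀ q ∈ W ∪ B, pdist p q ≤ 100 * t

/-- The number of points `p` of `W` such that the rectangle with data `r` is contained in
the annulus `S^ρ(p)`. -/
def typeCount (δ σ ρ : ℝ) (W : Set Param) (r : Param × Plane) : ℕ :=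
  Nat.card {p : Param | p ∈ W ∧ rect δ σ r.1 r.2 ⊆ annulus ρ p}

section Helpers
set_option linter.all false
open Finset (card_biUnion_le card_eq_sum_card_fiberwise card_eq_sum_ones card_filter card_filter_add_card_filter_not card_image_of_injOn card_le_card_of_injOn card_pos card_product card_range card_sigma card_union_of_disjoint exists_le_of_sum_le filter_subset mem_filter mem_product mem_sigma mul_sum sum_add_distrib sum_comm sum_congr sum_const sum_filter sum_le_card_nsmul sum_le_sum sum_le_sum_of_subset_of_nonneg sum_mul_sum sum_nonneg sum_product sum_product' sum_sub_distrib sum_subset)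
@[ext] structure Quad where
  c0 : ℝ
  c1 : ℝ
  c2 : ℝ
namespace Quad
def ev (q : Quad) (x : ℝ) : ℝ := q.c0 + q.c1 * x + q.c2 * x ^ 2
def der (q : Quad) (x : ℝ) : ℝ := q.c1 + 2 * q.c2 * x
def refl (q : Quad) : Quad := ⟨q.c0, -q.c1, q.c2⟩
lemma refl_ev (q : Quad) (x : ℝ) : q.refl.ev x = q.ev (-x) := by
  simp only [ev, refl]; ring
lemma refl_der (q : Quad) (x : ℝ) : q.refl.der x = - q.der (-x) := by
  simp only [der, refl]; ring
lemma three (p q : Quad) (x y z : ℝ) :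
    (p.ev y - q.ev y) * (z - x) = (p.ev x - q.ev x) * (z - y) + (p.ev z - q.ev z) * (y - x)
      - (p.c2 - q.c2) * ((y - x) * (z - y) * (z - x)) := by
  simp only [ev]; ring
lemma forbid (p q : Quad) {x1 x2 x3 x4 : ℝ} (h12 : x1 < x2) (h23 : x2 < x3) (h34 : x3 < x4)
    (h1 : q.ev x1 < p.ev x1) (h2 : p.ev x2 ≤ q.ev x2) (h3 : q.ev x3 < p.ev x3)
    (h4 : p.ev x4 ≤ q.ev x4) : False := by
  have e1 := three p q x1 x2 x3
  have e2 := three p q x2 x3 x4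
  have a1 : 0 < (x2 - x1) * (x3 - x2) * (x3 - x1) := by
    apply mul_pos (mul_pos _ _) <;> linarith
  have a2 : 0 < (x3 - x2) * (x4 - x3) * (x4 - x2) := by
    apply mul_pos (mul_pos _ _) <;> linarith
  have b1 : 0 < (p.ev x1 - q.ev x1) * (x3 - x2) := mul_pos (by linarith) (by linarith)
  have b2 : 0 < (p.ev x3 - q.ev x3) * (x2 - x1) := mul_pos (by linarith) (by linarith)
  have b3 : (p.ev x2 - q.ev x2) * (x3 - x1) ≤ 0 :=
    mul_nonpos_of_nonpos_of_nonneg (by linarith) (by linarith)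
  have c1 : 0 < p.c2 - q.c2 := by
    by_contra hc
    push Not at hc
    have := mul_nonpos_of_nonpos_of_nonneg hc a1.le
    linarith
  have d1 : (p.ev x2 - q.ev x2) * (x4 - x3) ≤ 0 :=
    mul_nonpos_of_nonpos_of_nonneg (by linarith) (by linarith)
  have d2 : (p.ev x4 - q.ev x4) * (x3 - x2) ≤ 0 :=
    mul_nonpos_of_nonpos_of_nonneg (by linarith) (by linarith)
  have d3 : 0 < (p.ev x3 - q.ev x3) * (x4 - x2) := mul_pos (by linarith) (by linarith)
  have := mul_pos c1 a2
  linarith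
lemma forbid' (p q : Quad) {x1 x2 x3 x4 : ℝ} (h12 : x1 < x2) (h23 : x2 < x3) (h34 : x3 < x4)
    (h1 : p.ev x1 ≤ q.ev x1) (h2 : q.ev x2 < p.ev x2) (h3 : p.ev x3 ≤ q.ev x3)
    (h4 : q.ev x4 < p.ev x4) : False := by
  refine forbid p.refl q.refl (x1 := -x4) (x2 := -x3) (x3 := -x2) (x4 := -x1) (by linarith)
    (by linarith) (by linarith) ?_ ?_ ?_ ?_ <;> simpa [refl_ev]
end Quad
open Quad
def Tan (ρ : ℝ) (f m : Quad) (a : ℝ) : Prop :=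
  ∃ τ κ : ℝ, 0 < τ ∧ 16 * τ ≤ ρ ^ 2 ∧ 1 ≤ κ ∧ κ ≤ 2 ∧
    m = ⟨f.c0 - τ + κ * a ^ 2, f.c1 - 2 * κ * a, f.c2 + κ⟩
section tan
variable {ρ a x : ℝ} {f m : Quad}
lemma Tan.lt (h : Tan ρ f m a) : m.ev a < f.ev a := by
  obtain ⟨τ, κ, h1, h2, h3, h4, rfl⟩ := h
  simp only [ev]; nlinarith
lemma sq_ge_of_abs {c x : ℝ} (hc : 0 ≤ c) (h : c ≤ |x|) : c ^ 2 ≤ x ^ 2 := by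
  rw [← sq_abs x]; exact pow_le_pow_left₀ hc h 2
lemma Tan.le (h : Tan ρ f m a) (hρ : 0 ≤ ρ) (hx : ρ / 4 ≤ |x - a|) : f.ev x ≤ m.ev x := by
  obtain ⟨τ, κ, h1, h2, h3, h4, rfl⟩ := h
  have := sq_ge_of_abs (by linarith) hx
  simp only [ev]; nlinarith [sq_nonneg (x - a)]
lemma Tan.le_add (h : Tan ρ f m a) (hρ : 0 ≤ ρ) (hx : ρ ≤ |x - a|) :
    f.ev x + ρ ^ 2 * (15 / 16) ≤ m.ev x := by
  obtain ⟨τ, κ, h1, h2, h3, h4, rfl⟩ := h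
  have := sq_ge_of_abs (by linarith) hx
  simp only [ev]; nlinarith [sq_nonneg (x - a)]
lemma Tan.refl (h : Tan ρ f m a) : Tan ρ f.refl m.refl (-a) := by
  obtain ⟨τ, κ, h1, h2, h3, h4, rfl⟩ := h
  refine ⟨τ, κ, h1, h2, h3, h4, ?_⟩
  ext <;> simp [Quad.refl] <;> ring
end tan
lemma nested {ρ : ℝ} (hρ : 0 < ρ) {f1 f2 g g' : Quad} {a b a' b' : ℝ}
    (t1 : Tan ρ f1 g a) (t2 : Tan ρ f2 g b) (t1' : Tan ρ f1 g' a') (t2' : Tan ρ f2 g' b')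
    (hab : ρ ≤ |a - b|) (hab' : ρ ≤ |a' - b'|) (haa : ρ ≤ |a - a'|) (hbb : ρ ≤ |b - b'|)
    (l : a < b) (l' : a' < b') (h : a < a') : b' < b := by
  by_contra hb
  push Not at hb
  have hne : b ≠ b' := by rintro rfl; simp at hbb; linarith
  have hb : b < b' := lt_of_le_of_ne hb hne
  have q {x : ℝ} (h : ρ ≤ |x|) : ρ / 4 ≤ |x| := by linarith
  have s {x y : ℝ} (h : ρ ≤ |x - y|) : ρ ≤ |y - x| := by rwa [abs_sub_comm]
  have ha1 : f2.ev a < f1.ev a := lt_of_le_of_lt (t2.le hρ.le (q hab)) t1.lt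
  have ha2 : f2.ev a' < f1.ev a' := lt_of_le_of_lt (t2'.le hρ.le (q hab')) t1'.lt
  have hb1 : f1.ev b < f2.ev b := lt_of_le_of_lt (t1.le hρ.le (q (s hab))) t2.lt
  have hb2 : f1.ev b' < f2.ev b' := lt_of_le_of_lt (t1'.le hρ.le (q (s hab'))) t2'.lt
  rcases lt_trichotomy b a' with hc | hc | hc
  · exact forbid f1 f2 l hc l' ha1 hb1.le ha2 hb2.le
  · subst hc; linarith
  · refine forbid g' g h hc hb ?_ ?_ ?_ ?_
    · exact lt_of_lt_of_le t1.lt (t1'.le hρ.le (q haa))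
    · exact (lt_of_lt_of_le t1'.lt (t1.le hρ.le (q (s haa)))).le
    · exact lt_of_lt_of_le t2.lt (t2'.le hρ.le (q hbb))
    · exact (lt_of_lt_of_le t2'.lt (t2.le hρ.le (q (s hbb)))).le
def Nb (ρ : ℝ) (f : Quad) (u : ℝ) (s : Quad) : Prop :=
  |s.ev u - f.ev u| ≤ 3 * ρ ^ 2 ∧ |s.der u - f.der u| ≤ 10 * ρ
lemma Tan.der_eq {ρ a : ℝ} {f m : Quad} (h : Tan ρ f m a) : m.der a = f.der a := by
  obtain ⟨τ, κ, h1, h2, h3, h4, rfl⟩ := h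
  simp only [der]; ring
lemma Tan.ev_ge {ρ a : ℝ} {f m : Quad} (h : Tan ρ f m a) : f.ev a - ρ ^ 2 / 16 ≤ m.ev a := by
  obtain ⟨τ, κ, h1, h2, h3, h4, rfl⟩ := h
  simp only [ev]; nlinarith
lemma taylor (q : Quad) (u x : ℝ) :
    q.ev x = q.ev u + q.der u * (x - u) + q.c2 * (x - u) ^ 2 := by
  simp only [ev, der]; ring
lemma nondeg_aux {ρ D0 D1 l y : ℝ} (hρ : 0 < ρ) (hl : 1 / 2 ≤ l) (hl' : l ≤ 3)
    (hx2 : D0 + D1 * y + l * y ^ 2 < 0) (hxu : |y| < ρ / 4)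
    (hp2 : 0 ≤ D0 + D1 * (ρ / 4) + l * (ρ / 4) ^ 2)
    (hm2 : 0 ≤ D0 - D1 * (ρ / 4) + l * (ρ / 4) ^ 2) :
    |D1| ≤ 3 / 2 * ρ ∧ -(3 / 16 * ρ ^ 2) ≤ D0 ∧ D0 ≤ 3 / 8 * ρ ^ 2 := by
  obtain ⟨y1, y2⟩ := abs_lt.1 hxu
  have A : D1 < 2 * l * (ρ / 4) := by
    by_contra hc
    push Not at hc
    have h1 : 0 ≤ (D1 - 2 * l * (ρ / 4)) * (y + ρ / 4) := mul_nonneg (by linarith) (by linarith)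
    nlinarith [mul_nonneg (by linarith : 0 ≤ l) (sq_nonneg (y + ρ / 4))]
  have A' : -(2 * l * (ρ / 4)) < D1 := by
    by_contra hc
    push Not at hc
    have h1 : 0 ≤ (-D1 - 2 * l * (ρ / 4)) * (ρ / 4 - y) := mul_nonneg (by linarith) (by linarith)
    nlinarith [mul_nonneg (by linarith : 0 ≤ l) (sq_nonneg (y - ρ / 4))]
  have A1 : D1 ≤ 3 / 2 * ρ := by nlinarith
  have A2 : -(3 / 2 * ρ) ≤ D1 := by nlinarith
  have B1 : - (3 * (ρ / 4) ^ 2) ≤ D0 := by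
    have := mul_le_mul_of_nonneg_right hl' (sq_nonneg (ρ / 4))
    linarith
  have B2 : D0 ≤ 3 / 2 * ρ * (ρ / 4) := by
    nlinarith
  exact ⟨abs_le.2 ⟨A2, A1⟩, by linarith, by linarith⟩
lemma nondeg_near {ρ : ℝ} (hρ : 0 < ρ) {s f g : Quad} {u x : ℝ}
    (t : Tan ρ f g u) (hl : 1 / 2 ≤ g.c2 - s.c2) (hl' : g.c2 - s.c2 ≤ 3)
    (hx : g.ev x < s.ev x) (hxu : |x - u| < ρ / 4)
    (hp : s.ev (u + ρ / 4) ≤ g.ev (u + ρ / 4)) (hm : s.ev (u - ρ / 4) ≤ g.ev (u - ρ / 4)) :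
    Nb ρ f u s := by
  have e1 := t.der_eq
  have e2 := t.ev_ge
  have e3 := t.lt
  rw [taylor s u, taylor g u] at hp hm hx
  rw [show u + ρ / 4 - u = ρ / 4 by ring] at hp
  rw [show u - ρ / 4 - u = -(ρ / 4) by ring] at hm
  obtain ⟨h1, h2, h3⟩ := nondeg_aux (D0 := g.ev u - s.ev u) (D1 := g.der u - s.der u)
    hρ hl hl' (by linarith) hxu (by linarith) (by linarith)
  constructor
  · rw [abs_le]; constructor <;> linarith
  · rw [← e1, abs_sub_comm]; linarith
lemma real_nondeg {ρ : ℝ} (hρ : 0 < ρ) {s f1 f2 g : Quad} {u1 u2 : ℝ}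
    (t1 : Tan ρ f1 g u1) (t2 : Tan ρ f2 g u2) (hu : ρ ≤ |u1 - u2|)
    (hl : 1 / 2 ≤ g.c2 - s.c2) (hl' : g.c2 - s.c2 ≤ 3)
    (hx : ∃ x, g.ev x < s.ev x) (n1 : ¬ Nb ρ f1 u1 s) (n2 : ¬ Nb ρ f2 u2 s) :
    ∃ v, g.ev v < s.ev v ∧ f1.ev v ≤ g.ev v ∧ f2.ev v ≤ g.ev v := by
  by_contra hno
  push Not at hno
  have key : ∀ v, ρ / 4 ≤ |v - u1| → ρ / 4 ≤ |v - u2| → s.ev v ≤ g.ev v := by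
    intro v h1 h2
    by_contra hv
    push Not at hv
    exact absurd (t2.le hρ.le h2) (not_le.2 (hno v hv (t1.le hρ.le h1)))
  obtain ⟨x, hx⟩ := hx
  have tri : ∀ a b c : ℝ, |a - c| ≤ |b - a| + |b - c| := fun a b c => by
    rw [abs_sub_comm b a]; exact abs_sub_le a b c
  by_cases c1 : |x - u1| < ρ / 4
  · apply n1
    refine nondeg_near hρ t1 hl hl' hx c1 (key _ ?_ ?_) (key _ ?_ ?_)
    · simp; exact le_abs_self _
    · grind
    · grind
    grind
  by_cases c2 : |x - u2| < ρ / 4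
  · apply n2
    rw [abs_sub_comm] at hu
    refine nondeg_near hρ t2 hl hl' hx c2 (key _ ?_ ?_) (key _ ?_ ?_)
    · grind
    · simp; exact le_abs_self _
    · grind
    grind
  grind
def addq (w : Quad) (θ u : ℝ) : Quad := ⟨w.c0 + θ * u ^ 2, w.c1 - 2 * θ * u, w.c2 + θ⟩
lemma addq_ev (w : Quad) (θ u x : ℝ) : (addq w θ u).ev x = w.ev x + θ * (x - u) ^ 2 := by
  simp only [ev, addq]; ring
def pz (w : Quad) (u : ℝ) (s : Quad) : ℝ := s.ev u - w.ev u
def po (w : Quad) (u : ℝ) (s : Quad) : ℝ := s.der u - w.der u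
def th (w : Quad) (u : ℝ) (s : Quad) : ℝ := (s.c2 - w.c2) - (po w u s) ^ 2 / (4 * pz w u s)
def vt (w : Quad) (u : ℝ) (s : Quad) : ℝ := u - 2 * pz w u s / po w u s
lemma G_ev (w s : Quad) (u x : ℝ) (h0 : pz w u s < 0) (h1 : po w u s ≠ 0) :
    (addq w (th w u s) u).ev x
      = s.ev x + (po w u s) ^ 2 / (-4 * pz w u s) * (x - vt w u s) ^ 2 := by
  have e : s.ev x = w.ev x + pz w u s + po w u s * (x - u) + (s.c2 - w.c2) * (x - u) ^ 2 := by
    rw [taylor s u, taylor w u x]; simp only [pz, po]; ring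
  rw [addq_ev, e]
  have h0' := h0.ne
  simp only [vt, th]
  grind
def Zset (sg : ℝ) (f w : Quad) (u : ℝ) (s : Quad) : Prop :=
  pz w u s < 0 ∧ 0 < sg * po w u s ∧ 1 ≤ (w.c2 - f.c2) + th w u s ∧ (w.c2 - f.c2) + th w u s ≤ 9
lemma Zset.po_ne {sg u : ℝ} {f w s : Quad} (h : Zset sg f w u s) : po w u s ≠ 0 := by
  intro h0; have := h.2.1; rw [h0] at this; simp at this
lemma Zset.coef_pos {sg u : ℝ} {f w s : Quad} (h : Zset sg f w u s) :
    0 < (po w u s) ^ 2 / (-4 * pz w u s) := by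
  have := h.1
  have h2 := h.po_ne
  apply div_pos (by positivity) (by linarith)
lemma Zset.le_G {sg u : ℝ} {f w s : Quad} (h : Zset sg f w u s) (x : ℝ) :
    s.ev x ≤ (addq w (th w u s) u).ev x := by
  rw [G_ev w s u x h.1 h.po_ne]
  nlinarith [mul_nonneg h.coef_pos.le (sq_nonneg (x - vt w u s))]
lemma Zset.eq_G {sg u : ℝ} {f w s : Quad} (h : Zset sg f w u s) :
    (addq w (th w u s) u).ev (vt w u s) = s.ev (vt w u s) := by
  rw [G_ev w s u _ h.1 h.po_ne]; simp
lemma Zset.nondeg {ρ sg u : ℝ} (hρ : 0 < ρ) {f w s : Quad}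
    (h : Zset sg f w u s) (t : Tan ρ f w u) (hn : ¬ Nb ρ f u s) (hfs : |f.c2 - s.c2| ≤ 1 / 2) :
    ρ / 2 ≤ |vt w u s - u| := by
  by_contra hd
  push Not at hd
  apply hn
  have hc : (po w u s) ^ 2 / (-4 * pz w u s) ≤ 19 / 2 := by
    have h3 := h.2.2.2
    have : th w u s = (s.c2 - w.c2) + (po w u s) ^ 2 / (-4 * pz w u s) := by
      simp only [th]
      rw [sub_eq_add_neg, ← div_neg]; ring_nf
    grind
  have p0 := h.1
  have p1 := h.po_ne
  have e := t.der_eq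
  have e2 := t.ev_ge
  have e3 := t.lt
  have hd' : |vt w u s - u| = 2 * (-pz w u s) / |po w u s| := by
    simp only [vt]
    rw [show u - 2 * pz w u s / po w u s - u = (2 * (-pz w u s)) / po w u s by ring, abs_div,
      abs_of_pos (by linarith : 0 < 2 * (-pz w u s))]
  rw [hd'] at hd
  have pp : 0 < |po w u s| := abs_pos.2 p1
  rw [div_lt_iff₀ pp] at hd
  rw [div_le_iff₀ (by linarith)] at hc
  rw [← sq_abs] at hc
  have k1 : |po w u s| ≤ 19 / 2 * ρ := by
    have : |po w u s| * |po w u s| ≤ (19 / 2 * ρ) * |po w u s| := by nlinarith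
    exact le_of_mul_le_mul_right this pp
  have k2 : -pz w u s ≤ 19 / 8 * ρ ^ 2 := by nlinarith
  constructor
  · have : s.ev u - f.ev u = pz w u s + (w.ev u - f.ev u) := by simp only [pz]; ring
    rw [this, abs_le]; constructor <;> nlinarith [sq_nonneg ρ]
  · rw [← e]; show |po w u s| ≤ _; linarith
lemma addq_ge {ρ u θ x : ℝ} {f w : Quad} (hρ : 0 ≤ ρ) (t : Tan ρ f w u)
    (h : 1 ≤ (w.c2 - f.c2) + θ) (hx : ρ / 4 ≤ |x - u|) : f.ev x ≤ (addq w θ u).ev x := by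
  obtain ⟨τ, κ, h1, h2, h3, h4, rfl⟩ := t
  have := sq_ge_of_abs (by linarith) hx
  rw [addq_ev]
  simp only [ev] at *
  nlinarith [sq_nonneg (x - u)]
lemma addq_ge' {ρ u θ x : ℝ} {f w : Quad} (t : Tan ρ f w u)
    (h : 0 ≤ (w.c2 - f.c2) + θ) : f.ev x - ρ ^ 2 / 16 ≤ (addq w θ u).ev x := by
  obtain ⟨τ, κ, h1, h2, h3, h4, rfl⟩ := t
  rw [addq_ev]
  simp only [ev] at *
  nlinarith [mul_nonneg h (sq_nonneg (x - u))]
lemma addq_lt {ρ u θ : ℝ} {f w : Quad} (t : Tan ρ f w u) : (addq w θ u).ev u < f.ev u := by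
  rw [addq_ev]; have := t.lt; simp; exact this
lemma Tan.lead {ρ u : ℝ} {f w : Quad} (t : Tan ρ f w u) : 1 ≤ w.c2 - f.c2 ∧ w.c2 - f.c2 ≤ 2 := by
  obtain ⟨τ, κ, h1, h2, h3, h4, rfl⟩ := t
  grind
lemma Tan.ev_form {ρ u : ℝ} {f w : Quad} (t : Tan ρ f w u) (x : ℝ) :
    w.ev x = f.ev x - (f.ev u - w.ev u) + (w.c2 - f.c2) * (x - u) ^ 2 := by
  obtain ⟨τ, κ, h1, h2, h3, h4, rfl⟩ := t
  simp only [ev]; ring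
lemma VL {ρ : ℝ} (hρ : 0 < ρ) {f1 f2 w g0 g1 : Quad} {u a0 b0 a1 b1 : ℝ}
    (tw : Tan ρ f1 w u) (t01 : Tan ρ f1 g0 a0) (t02 : Tan ρ f2 g0 b0)
    (t11 : Tan ρ f1 g1 a1) (t12 : Tan ρ f2 g1 b1)
    (h1 : a0 + ρ ≤ u) (h2 : u + ρ ≤ a1) (h3 : a1 + ρ ≤ b1) (h4 : b1 + ρ ≤ b0)
    (hff : |f1.c2 - f2.c2| ≤ 1 / 2) :
    Zset 1 f1 w u f2 ∧ u < vt w u f2 ∧ b1 - ρ / 4 < vt w u f2 ∧ vt w u f2 < b0 + ρ / 4 := by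
  have hr : 0 < ρ ^ 2 := by positivity
  have far {x y : ℝ} (h : x + ρ / 4 ≤ y) : ρ / 4 ≤ |x - y| := by
    grind
  have far' {x y : ℝ} (h : x + ρ / 4 ≤ y) : ρ / 4 ≤ |y - x| :=
    le_trans (by linarith) (le_abs_self _)
  have far1 {x y : ℝ} (h : x + ρ ≤ y) : ρ ≤ |x - y| := by
    grind
  have ha0 : f2.ev a0 + ρ ^ 2 / 16 < f1.ev a0 := by
    have := t02.le_add hρ.le (x := a0) (far1 (by linarith)); have := t01.lt; linarith
  have ha1 : f2.ev a1 + ρ ^ 2 / 16 < f1.ev a1 := by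
    have := t12.le_add hρ.le (x := a1) (far1 (by linarith)); have := t11.lt; linarith
  have hb1 : f1.ev b1 < f2.ev b1 := lt_of_le_of_lt (t11.le hρ.le (far' (by linarith))) t12.lt
  let f2' : Quad := ⟨f2.c0 + ρ ^ 2 / 16, f2.c1, f2.c2⟩
  have f2e : ∀ x, f2'.ev x = f2.ev x + ρ ^ 2 / 16 := fun x => by simp only [ev, f2']; ring
  have hu : f2.ev u + ρ ^ 2 / 16 < f1.ev u := by
    by_contra hc
    push Not at hc
    refine forbid f1 f2' (x1 := a0) (x2 := u) (x3 := a1) (x4 := b1) (by linarith) (by linarith)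
      (by linarith) ?_ ?_ ?_ ?_ <;> rw [f2e] <;> linarith
  have p0 : pz w u f2 < 0 := by
    have := tw.ev_ge
    simp only [pz]; linarith
  have p1 : 0 < po w u f2 := by
    simp only [po]
    rw [tw.der_eq]
    obtain ⟨τ, κ, q1, q2, q3, q4, e⟩ := t01
    obtain ⟨τ', κ', q1', q2', q3', q4', e'⟩ := t02
    rw [e] at e'
    simp only [Quad.mk.injEq] at e'
    obtain ⟨z0, z1, z2⟩ := e'
    have z3 : f2.c2 = f1.c2 + κ - κ' := by linarith
    have z4 : f2.c1 = f1.c1 - 2 * κ * a0 + 2 * κ' * b0 := by linarith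
    simp only [der]
    rw [z3, z4]
    linarith only [mul_pos (by linarith : 0 < κ) (by linarith : 0 < u - a0),
      mul_pos (by linarith : 0 < κ') (by linarith : 0 < b0 - u)]
  have p1' := p1.ne'
  have hvu : u < vt w u f2 := by
    simp only [vt]
    have : 2 * pz w u f2 / po w u f2 < 0 := div_neg_of_neg_of_pos (by linarith) p1
    linarith
  set v := vt w u f2 with hv
  set G := addq w (th w u f2) u with hG
  set l := (po w u f2) ^ 2 / (-4 * pz w u f2) with hl
  have hlpos : 0 < l := div_pos (by positivity) (by linarith)
  have Ge : ∀ x, G.ev x = f2.ev x + l * (x - v) ^ 2 := fun x => G_ev w f2 u x p0 p1'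
  have Gge : ∀ x, f2.ev x ≤ G.ev x := fun x => by
    rw [Ge]; linarith only [mul_nonneg hlpos.le (sq_nonneg (x - v))]
  have Gv : G.ev v = f2.ev v := by rw [Ge]; simp
  have Gw : ∀ x, G.ev x = f1.ev x - (f1.ev u - w.ev u) + ((w.c2 - f1.c2) + th w u f2) * (x - u) ^ 2 :=
    fun x => by rw [hG, addq_ev, tw.ev_form x]; ring
  have tw1 := tw.lt
  have tw2 := tw.ev_ge
  have kG : 1 ≤ (w.c2 - f1.c2) + th w u f2 := by
    by_contra hc
    push Not at hc
    have k1 : g0.ev b0 < G.ev b0 := lt_of_lt_of_le t02.lt (Gge _)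
    rw [Gw, t01.ev_form] at k1
    have k2 := t01.lead.1
    have k3 := t01.ev_ge
    have k4 : 0 < b0 - u := by linarith
    have k5 : (b0 - u + ρ) ^ 2 ≤ (b0 - a0) ^ 2 := by
      apply pow_le_pow_left₀ <;> linarith
    have k6 : (w.c2 - f1.c2 + th w u f2) * (b0 - u) ^ 2 ≤ 1 * (b0 - u) ^ 2 :=
      mul_le_mul_of_nonneg_right hc.le (sq_nonneg _)
    have k7 : 1 * (b0 - a0) ^ 2 ≤ (g0.c2 - f1.c2) * (b0 - a0) ^ 2 :=
      mul_le_mul_of_nonneg_right k2 (sq_nonneg _)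
    have k8 : (b0 - u) ^ 2 + ρ ^ 2 ≤ (b0 - u + ρ) ^ 2 := by linarith only [mul_nonneg k4.le hρ.le]
    linarith
  have Gf1 : ∀ x, ρ / 4 ≤ |x - u| → f1.ev x ≤ G.ev x := fun x hx => addq_ge hρ.le tw kG hx
  have Gu : G.ev u < f1.ev u := addq_lt tw
  have hva1 : a1 < v := by
    have k1 : f1.ev v ≤ f2.ev v + ρ ^ 2 / 16 := by
      have := addq_ge' (x := v) tw (by linarith : 0 ≤ (w.c2 - f1.c2) + th w u f2)
      rw [← Gv]; linarith
    rcases lt_trichotomy v a1 with hc | hc | hc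
    · exfalso
      refine forbid f1 f2' (x1 := u) (x2 := v) (x3 := a1) (x4 := b1) hvu hc
        (by linarith) ?_ ?_ ?_ ?_ <;> rw [f2e] <;> linarith
    · rw [hc] at k1; linarith
    · exact hc
  have hv0 : v < b0 + ρ / 4 := by
    by_contra hc
    push Not at hc
    refine forbid G g0 (x1 := a0) (x2 := u) (x3 := b0) (x4 := v) (by linarith) (by linarith)
      (by linarith) ?_ ?_ ?_ ?_
    · exact lt_of_lt_of_le t01.lt (Gf1 _ (far (by linarith)))
    · exact Gu.le.trans (t01.le hρ.le (far' (by linarith)))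
    · exact lt_of_lt_of_le t02.lt (Gge _)
    · rw [Gv]; exact t02.le hρ.le (far' (by linarith))
  have hv1 : b1 - ρ / 4 < v := by
    by_contra hc
    push Not at hc
    refine forbid' G g1 (x1 := u) (x2 := a1) (x3 := v) (x4 := b1) (by linarith) (by linarith)
      (by linarith) ?_ ?_ ?_ ?_
    · exact Gu.le.trans (t11.le hρ.le (far (by linarith)))
    · exact lt_of_lt_of_le t11.lt (Gf1 _ (far' (by linarith)))
    · rw [Gv]; exact t12.le hρ.le (far (by linarith))
    · exact lt_of_lt_of_le t12.lt (Gge _)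
  have hl8 : l ≤ 8 := by
    have k1 : G.ev u ≤ g1.ev u := Gu.le.trans (t11.le hρ.le (far (by linarith)))
    rw [Ge, t12.ev_form] at k1
    have k2 := t12.lt
    have k3 := t12.lead.2
    have k4 : (u - b1) ^ 2 ≤ 4 * (u - v) ^ 2 := by
      linarith only [pow_le_pow_left₀ (show 0 ≤ b1 - u by linarith) (show b1 - u ≤ 2 * (v - u) by linarith) 2]
    have k5 : (g1.c2 - f2.c2) * (u - b1) ^ 2 ≤ 2 * (u - b1) ^ 2 :=
      mul_le_mul_of_nonneg_right k3 (sq_nonneg _)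
    have k6 : 0 < (u - v) ^ 2 := by
      have : u - v ≠ 0 := by intro h; linarith
      positivity
    by_contra hc
    push Not at hc
    have k7 : 8 * (u - v) ^ 2 < l * (u - v) ^ 2 := mul_lt_mul_of_pos_right hc k6
    linarith
  have hth : th w u f2 = (f2.c2 - w.c2) + l := by
    simp only [th, hl]
    rw [sub_eq_add_neg, ← div_neg]; ring_nf
  have := abs_le.1 hff
  refine ⟨⟨p0, by simpa using p1, kG, by rw [hth]; linarith⟩, hvu, hv1, hv0⟩
lemma refl_pz (w s : Quad) (u : ℝ) : pz w.refl (-u) s.refl = pz w u s := by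
  simp [pz, refl_ev]
lemma refl_po (w s : Quad) (u : ℝ) : po w.refl (-u) s.refl = - po w u s := by
  simp [po, refl_der]; ring
lemma refl_th (w s : Quad) (u : ℝ) : th w.refl (-u) s.refl = th w u s := by
  simp only [th, refl_pz, refl_po]; simp [Quad.refl]
lemma refl_vt (w s : Quad) (u : ℝ) : vt w.refl (-u) s.refl = - vt w u s := by
  simp only [vt, refl_pz, refl_po]; linarith
lemma refl_Zset {f w s : Quad} {u : ℝ} (h : Zset 1 f.refl w.refl (-u) s.refl) :
    Zset (-1) f w u s := by
  obtain ⟨h1, h2, h3, h4⟩ := h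
  rw [refl_pz] at h1; rw [refl_po] at h2; rw [refl_th] at h3 h4
  exact ⟨h1, by linarith, h3, h4⟩
lemma VLm {ρ : ℝ} (hρ : 0 < ρ) {f1 f2 w g0 g1 : Quad} {u a0 b0 a1 b1 : ℝ}
    (tw : Tan ρ f2 w u) (t01 : Tan ρ f1 g0 a0) (t02 : Tan ρ f2 g0 b0)
    (t11 : Tan ρ f1 g1 a1) (t12 : Tan ρ f2 g1 b1)
    (h1 : a0 + ρ ≤ a1) (h2 : a1 + ρ ≤ b1) (h3 : b1 + ρ ≤ u) (h4 : u + ρ ≤ b0)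
    (hff : |f1.c2 - f2.c2| ≤ 1 / 2) :
    Zset (-1) f2 w u f1 ∧ vt w u f1 < u ∧ a0 - ρ / 4 < vt w u f1 ∧ vt w u f1 < a1 + ρ / 4 := by
  have := VL hρ tw.refl t02.refl t01.refl t12.refl t11.refl (by linarith) (by linarith)
    (by linarith) (by linarith) (by rw [abs_sub_comm]; exact hff)
  obtain ⟨k1, k2, k3, k4⟩ := this
  rw [refl_vt] at k2 k3 k4
  exact ⟨refl_Zset k1, by linarith, by linarith, by linarith⟩
open scoped Classical
structure Cfg where
  W : Finset Quad
  B : Finset Quad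
  H : Finset (Quad × Quad)
  u : Quad → Quad → ℝ
  ρ : ℝ
  hρ : 0 < ρ
  sub : ∀ f g, (f, g) ∈ H → f ∈ W ∧ g ∈ B
  tan : ∀ f g, (f, g) ∈ H → Tan ρ f g (u f g)
  sepf : ∀ f g g', (f, g) ∈ H → (f, g') ∈ H → g ≠ g' → ρ ≤ |u f g - u f g'|
  sepg : ∀ f f' g, (f, g) ∈ H → (f', g) ∈ H → f ≠ f' → ρ ≤ |u f g - u f' g|
  rng : ∀ f g, (f, g) ∈ H → |u f g| ≤ 2
  lW : ∀ f ∈ W, ∀ f' ∈ W, |f.c2 - f'.c2| ≤ 1 / 2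
namespace Cfg
variable (C : Cfg)
def LC (f1 f2 : Quad) : Finset Quad :=
  C.B.filter (fun g => (f1, g) ∈ C.H ∧ (f2, g) ∈ C.H ∧ C.u f1 g < C.u f2 g)
variable {C}
variable {f1 f2 g m g0 g1 n s : Quad} {a b : ℝ}
lemma mem_LC : g ∈ C.LC f1 f2 ↔ (f1, g) ∈ C.H ∧ (f2, g) ∈ C.H ∧ C.u f1 g < C.u f2 g := by
  simp only [LC, mem_filter, and_iff_right_iff_imp]
  intro h; exact (C.sub _ _ h.1).2
lemma LC_ne (h : g ∈ C.LC f1 f2) : f1 ≠ f2 := by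
  rintro rfl; have := (mem_LC.1 h).2.2; exact lt_irrefl _ this
lemma LC_gap (h : g ∈ C.LC f1 f2) : C.u f1 g + C.ρ ≤ C.u f2 g := by
  have h' := mem_LC.1 h
  have := C.sepg _ _ _ h'.1 h'.2.1 (LC_ne h)
  grind
lemma sep_add {f g g' : Quad} (h : (f, g) ∈ C.H) (h' : (f, g') ∈ C.H) (hl : C.u f g < C.u f g') :
    C.u f g + C.ρ ≤ C.u f g' := by
  have := C.sepf f g g' h h' (by grind)
  grind
lemma u_inj {f g g' : Quad} (h : (f, g) ∈ C.H) (h' : (f, g') ∈ C.H) (hl : C.u f g = C.u f g') :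
    g = g' := by
  by_contra hne
  have := C.sepf f g g' h h' hne
  rw [hl] at this; simp at this; linarith [C.hρ]
lemma LC_nest (h : g ∈ C.LC f1 f2) (h' : m ∈ C.LC f1 f2) (hl : C.u f1 g < C.u f1 m) :
    C.u f2 m + C.ρ ≤ C.u f2 g := by
  have k := mem_LC.1 h
  have k' := mem_LC.1 h'
  have hne : g ≠ m := by grind
  have : C.u f2 m < C.u f2 g := nested C.hρ (C.tan _ _ k.1) (C.tan _ _ k.2.1) (C.tan _ _ k'.1)
    (C.tan _ _ k'.2.1) (C.sepg _ _ _ k.1 k.2.1 (LC_ne h)) (C.sepg _ _ _ k'.1 k'.2.1 (LC_ne h))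
    (C.sepf _ _ _ k.1 k'.1 hne) (C.sepf _ _ _ k.2.1 k'.2.1 hne) k.2.2 k'.2.2 hl
  exact sep_add k'.2.1 k.2.1 this
def Rel (C : Cfg) (f1 f2 n m : Quad) (a b : ℝ) : Prop :=
  m.ev (C.u f1 m) < n.ev (C.u f1 m) ∧ m.ev (C.u f2 m) < n.ev (C.u f2 m) ∧
    n.ev a ≤ m.ev a ∧ n.ev b ≤ m.ev b
structure Loc (C : Cfg) (f1 f2 g0 g1 n : Quad) (a b : ℝ) : Prop where
  hab : a < b
  na : n.ev a ≤ f1.ev a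
  nb : n.ev b ≤ f2.ev b
  lo : ∀ m ∈ C.LC f1 f2, C.u f1 m < C.u f1 g0 →
    C.u f1 m < a ∧ b < C.u f2 m ∧ Rel C f1 f2 n m a b
  hi : ∀ m ∈ C.LC f1 f2, C.u f1 g1 < C.u f1 m →
    a < C.u f1 m ∧ C.u f2 m < b ∧ Rel C f1 f2 n m a b
def Pred (C : Cfg) (f1 f2 g0 g1 : Quad) : Prop :=
  g0 ∈ C.LC f1 f2 ∧ g1 ∈ C.LC f1 f2 ∧ C.u f1 g0 < C.u f1 g1 ∧
    ∀ m ∈ C.LC f1 f2, C.u f1 m ≤ C.u f1 g0 ∨ C.u f1 g1 ≤ C.u f1 m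
def TypeA (C : Cfg) (f1 f2 s g0 g1 : Quad) : Prop :=
  (∃ e, (e = g0 ∨ e = g1) ∧ ∀ x, s.ev x ≤ e.ev x) ∧
  ∃ n a b v, Loc C f1 f2 g0 g1 n a b ∧ n.ev v ≤ s.ev v ∧ f1.ev v ≤ n.ev v ∧ f2.ev v ≤ n.ev v
def TypeB (C : Cfg) (f1 f2 s g0 g1 : Quad) : Prop :=
  (∃ n a b, Loc C f1 f2 g0 g1 n a b ∧ ∀ x, s.ev x ≤ n.ev x) ∧
  ∃ e, (e = g0 ∨ e = g1) ∧ ∃ v, e.ev v < s.ev v ∧ f1.ev v ≤ e.ev v ∧ f2.ev v ≤ e.ev v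
lemma far4 {ρ x y : ℝ} (hρ : 0 < ρ) (h : x + ρ / 4 ≤ y) : ρ / 4 ≤ |x - y| ∧ ρ / 4 ≤ |y - x| := by
  grind
lemma rel_real {e : Quad} (he : e ∈ C.LC f1 f2) (hm : m ∈ C.LC f1 f2) (hne : e ≠ m) :
    Rel C f1 f2 e m (C.u f1 e) (C.u f2 e) := by
  have k := mem_LC.1 he
  have k' := mem_LC.1 hm
  have hρ := C.hρ
  have s1 := C.sepf _ _ _ k.1 k'.1 hne
  have s2 := C.sepf _ _ _ k.2.1 k'.2.1 hne
  have t1 := C.tan _ _ k.1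
  have t2 := C.tan _ _ k.2.1
  have t1' := C.tan _ _ k'.1
  have t2' := C.tan _ _ k'.2.1
  refine ⟨lt_of_lt_of_le t1'.lt (t1.le hρ.le ?_), lt_of_lt_of_le t2'.lt (t2.le hρ.le ?_),
    t1.lt.le.trans (t1'.le hρ.le ?_), t2.lt.le.trans (t2'.le hρ.le ?_)⟩
  · rw [abs_sub_comm]; linarith
  · rw [abs_sub_comm]; linarith
  · linarith
  · linarith
lemma loc_real (hp : Pred C f1 f2 g0 g1) {e : Quad} (he : e = g0 ∨ e = g1) :
    Loc C f1 f2 g0 g1 e (C.u f1 e) (C.u f2 e) := by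
  have heL : e ∈ C.LC f1 f2 := by rcases he with rfl | rfl; exacts [hp.1, hp.2.1]
  have k := mem_LC.1 heL
  have h0 : C.u f1 g0 ≤ C.u f1 e ∧ C.u f1 e ≤ C.u f1 g1 := by
    have := hp.2.2.1
    grind
  refine ⟨k.2.2, (C.tan _ _ k.1).lt.le, (C.tan _ _ k.2.1).lt.le, fun m hm hl => ?_, fun m hm hl => ?_⟩
  · have hl' : C.u f1 m < C.u f1 e := by linarith
    refine ⟨hl', ?_, rel_real heL hm (by grind)⟩
    have := LC_nest hm heL hl'; linarith [C.hρ]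
  · have hl' : C.u f1 e < C.u f1 m := by linarith
    refine ⟨hl', ?_, rel_real heL hm (by grind)⟩
    have := LC_nest heL hm hl'; linarith [C.hρ]
lemma loc_virt (hp : Pred C f1 f2 g0 g1) {w : Quad} (hw : (f1, w) ∈ C.H)
    (h0 : C.u f1 g0 < C.u f1 w) (h1 : C.u f1 w < C.u f1 g1) :
    Zset 1 f1 w (C.u f1 w) f2 ∧
    Loc C f1 f2 g0 g1 (addq w (th w (C.u f1 w) f2) (C.u f1 w)) (C.u f1 w) (vt w (C.u f1 w) f2) := by
  obtain ⟨p0, p1, p2, p3⟩ := hp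
  have k0 := mem_LC.1 p0
  have k1 := mem_LC.1 p1
  have hρ := C.hρ
  have tw := C.tan _ _ hw
  have s0 := sep_add k0.1 hw h0
  have s1 := sep_add hw k1.1 h1
  obtain ⟨z, z1, z2, z3⟩ := VL hρ tw (C.tan _ _ k0.1) (C.tan _ _ k0.2.1) (C.tan _ _ k1.1)
    (C.tan _ _ k1.2.1) s0 s1 (LC_gap p1) (LC_nest p0 p1 p2)
    (C.lW _ (C.sub _ _ k0.1).1 _ (C.sub _ _ k0.2.1).1)
  have Gf := fun x hx => addq_ge (x := x) hρ.le tw z.2.2.1 hx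
  refine ⟨z, z1, (addq_lt tw).le, z.eq_G.le, fun m hm hl => ?_, fun m hm hl => ?_⟩
  · have km := mem_LC.1 hm
    have s2 := sep_add km.1 k0.1 hl
    have s3 := LC_nest hm p0 hl
    refine ⟨by linarith, by linarith, ?_, ?_, ?_, ?_⟩
    · exact lt_of_lt_of_le (C.tan _ _ km.1).lt (Gf _ (far4 hρ (by linarith)).1)
    · exact lt_of_lt_of_le (C.tan _ _ km.2.1).lt (z.le_G _)
    · exact (addq_lt tw).le.trans ((C.tan _ _ km.1).le hρ.le (far4 hρ (by linarith)).2)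
    · rw [z.eq_G]; exact (C.tan _ _ km.2.1).le hρ.le (far4 hρ (by linarith)).1
  · have km := mem_LC.1 hm
    have s2 := sep_add k1.1 km.1 hl
    have s3 := LC_nest p1 hm hl
    refine ⟨by linarith, by linarith, ?_, ?_, ?_, ?_⟩
    · exact lt_of_lt_of_le (C.tan _ _ km.1).lt (Gf _ (far4 hρ (by linarith)).2)
    · exact lt_of_lt_of_le (C.tan _ _ km.2.1).lt (z.le_G _)
    · exact (addq_lt tw).le.trans ((C.tan _ _ km.1).le hρ.le (far4 hρ (by linarith)).1)
    · rw [z.eq_G]; exact (C.tan _ _ km.2.1).le hρ.le (far4 hρ (by linarith)).2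
lemma loc_virt' (hp : Pred C f1 f2 g0 g1) {w : Quad} (hw : (f2, w) ∈ C.H)
    (h0 : C.u f2 w < C.u f2 g0) (h1 : C.u f2 g1 < C.u f2 w) :
    Zset (-1) f2 w (C.u f2 w) f1 ∧
    Loc C f1 f2 g0 g1 (addq w (th w (C.u f2 w) f1) (C.u f2 w)) (vt w (C.u f2 w) f1) (C.u f2 w) := by
  obtain ⟨p0, p1, p2, p3⟩ := hp
  have k0 := mem_LC.1 p0
  have k1 := mem_LC.1 p1
  have hρ := C.hρ
  have tw := C.tan _ _ hw
  have s0 := sep_add hw k0.2.1 h0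
  have s1 := sep_add k1.2.1 hw h1
  obtain ⟨z, z1, z2, z3⟩ := VLm hρ tw (C.tan _ _ k0.1) (C.tan _ _ k0.2.1) (C.tan _ _ k1.1)
    (C.tan _ _ k1.2.1) (sep_add k0.1 k1.1 p2) (LC_gap p1) s1 s0
    (C.lW _ (C.sub _ _ k0.1).1 _ (C.sub _ _ k0.2.1).1)
  have Gf := fun x hx => addq_ge (x := x) hρ.le tw z.2.2.1 hx
  refine ⟨z, z1, z.eq_G.le, (addq_lt tw).le, fun m hm hl => ?_, fun m hm hl => ?_⟩
  · have km := mem_LC.1 hm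
    have s2 := sep_add km.1 k0.1 hl
    have s3 := LC_nest hm p0 hl
    refine ⟨by linarith, by linarith, ?_, ?_, ?_, ?_⟩
    · exact lt_of_lt_of_le (C.tan _ _ km.1).lt (z.le_G _)
    · exact lt_of_lt_of_le (C.tan _ _ km.2.1).lt (Gf _ (far4 hρ (by linarith)).2)
    · rw [z.eq_G]; exact (C.tan _ _ km.1).le hρ.le (far4 hρ (by linarith)).2
    · exact (addq_lt tw).le.trans ((C.tan _ _ km.2.1).le hρ.le (far4 hρ (by linarith)).1)
  · have km := mem_LC.1 hm
    have s2 := sep_add k1.1 km.1 hl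
    have s3 := LC_nest p1 hm hl
    refine ⟨by linarith, by linarith, ?_, ?_, ?_, ?_⟩
    · exact lt_of_lt_of_le (C.tan _ _ km.1).lt (z.le_G _)
    · exact lt_of_lt_of_le (C.tan _ _ km.2.1).lt (Gf _ (far4 hρ (by linarith)).1)
    · rw [z.eq_G]; exact (C.tan _ _ km.1).le hρ.le (far4 hρ (by linarith)).1
    · exact (addq_lt tw).le.trans ((C.tan _ _ km.2.1).le hρ.le (far4 hρ (by linarith)).2)
lemma locA {g0 g1 e e' : Quad} {v : ℝ} (L : Loc C f1 f2 g0 g1 n a b)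
    (he : e ∈ C.LC f1 f2) (he' : e' ∈ C.LC f1 f2) (h : C.u f1 e < C.u f1 g0)
    (h' : C.u f1 g1 < C.u f1 e') (hv : n.ev v ≤ e.ev v) (hv' : n.ev v ≤ e'.ev v) :
    (C.u f1 e < v ∧ v < C.u f1 e') ∨ (C.u f2 e' < v ∧ v < C.u f2 e) := by
  obtain ⟨l1, l2, r1, r2, r3, r4⟩ := L.lo e he h
  obtain ⟨m1, m2, q1, q2, q3, q4⟩ := L.hi e' he' h'
  have k' := (mem_LC.1 he').2.2
  have A1 : C.u f1 e < v := by
    by_contra hc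
    rcases lt_or_eq_of_le (not_lt.1 hc) with hc | hc
    · exact forbid' n e hc l1 (by linarith : a < C.u f2 e) hv r1 r3 r2
    grind
  have A2 : v < C.u f2 e := by
    by_contra hc
    rcases lt_or_eq_of_le (not_lt.1 hc) with hc | hc
    · exact forbid n e l1 (by linarith : a < C.u f2 e) hc r1 r3 r2 hv
    grind
  by_cases c1 : v < C.u f1 e'
  · grind
  by_cases c2 : C.u f2 e' < v
  · grind
  exfalso
  push Not at c1 c2
  rcases lt_or_eq_of_le c1 with c1 | c1
  · rcases lt_or_eq_of_le c2 with c2 | c2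
    · exact forbid' n e' m1 c1 c2 q3 q1 hv' q2
    grind
  grind
lemma locB {g0 g1 g0' g1' e n' : Quad} {a' b' v : ℝ} (L : Loc C f1 f2 g0 g1 n a b)
    (L' : Loc C f1 f2 g0' g1' n' a' b') (he : e ∈ C.LC f1 f2)
    (h : C.u f1 g1 < C.u f1 e) (h' : C.u f1 e < C.u f1 g0') (hv : e.ev v < n.ev v)
    (hv' : e.ev v < n'.ev v) :
    (a < v ∧ v < a') ∨ (b' < v ∧ v < b) := by
  obtain ⟨l1, l2, r1, r2, r3, r4⟩ := L.hi e he h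
  obtain ⟨m1, m2, q1, q2, q3, q4⟩ := L'.lo e he h'
  have hab' := L'.hab
  have A1 : a < v := by
    by_contra hc
    rcases lt_or_eq_of_le (not_lt.1 hc) with hc | hc
    · exact forbid n e hc l1 (by linarith : C.u f1 e < b) hv r3 r1 r4
    grind
  have A2 : v < b := by
    by_contra hc
    rcases lt_or_eq_of_le (not_lt.1 hc) with hc | hc
    · exact forbid' n e l1 (by linarith : C.u f1 e < b) hc r3 r1 r4 hv
    grind
  by_cases c1 : v < a'
  · grind
  by_cases c2 : b' < v
  · grind
  exfalso
  push Not at c1 c2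
  rcases lt_or_eq_of_le c1 with c1 | c1
  · rcases lt_or_eq_of_le c2 with c2 | c2
    · exact forbid n' e m1 c1 c2 q1 q3 hv' q4
    grind
  grind
end Cfg
namespace Cfg
variable {C : Cfg} {f1 f2 s : Quad}
lemma spaced (P : Quad → Quad → Prop)
    (h : 13 ≤ ((C.LC f1 f2).filter (fun g1 => ∃ g0, Pred C f1 f2 g0 g1 ∧ P g0 g1)).card) :
    ∃ G0 G1 : ℕ → Quad, (∀ k, k < 13 → Pred C f1 f2 (G0 k) (G1 k) ∧ P (G0 k) (G1 k)) ∧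
      ∀ j k, j + 2 ≤ k → k < 13 → C.u f1 (G1 j) < C.u f1 (G0 k) := by
  set T := (C.LC f1 f2).filter (fun g1 => ∃ g0, Pred C f1 f2 g0 g1 ∧ P g0 g1) with hT
  have hinj : Set.InjOn (C.u f1) T := by
    intro x hx y hy hxy
    have hx' := (mem_LC.1 (mem_filter.1 hx).1).1
    have hy' := (mem_LC.1 (mem_filter.1 hy).1).1
    exact u_inj hx' hy' hxy
  have hcard : 13 ≤ (T.image (C.u f1)).card := by grind
  obtain ⟨U, hU, hU13⟩ := Finset.exists_subset_card_eq hcard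
  let i := U.orderEmbOfFin hU13
  have hi : ∀ k : Fin 13, ∃ g1, g1 ∈ T ∧ C.u f1 g1 = i k := fun k => by
    have := hU (U.orderEmbOfFin_mem hU13 k)
    simpa using this
  choose g1 hg1 hgi using hi
  have hp : ∀ k : Fin 13, ∃ g0, Pred C f1 f2 g0 (g1 k) ∧ P g0 (g1 k) := fun k =>
    (mem_filter.1 (hg1 k)).2
  choose g0 hp0 hp1 using hp
  refine ⟨fun k => g0 (Fin.ofNat 13 k), fun k => g1 (Fin.ofNat 13 k), fun k _ => ⟨hp0 _, hp1 _⟩, ?_⟩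
  intro j k hjk hk
  have e1 : i (Fin.ofNat 13 j) < i (Fin.ofNat 13 (j + 1)) := by
    apply (U.orderEmbOfFin hU13).strictMono
    simp only [Fin.lt_def, Fin.ofNat]; omega
  have e2 : i (Fin.ofNat 13 (j + 1)) < i (Fin.ofNat 13 k) := by
    apply (U.orderEmbOfFin hU13).strictMono
    simp only [Fin.lt_def, Fin.ofNat]; omega
  rw [← hgi, ← hgi] at e1 e2
  have := (hp0 (Fin.ofNat 13 k)).2.2.2 _ (mem_filter.1 (hg1 (Fin.ofNat 13 (j + 1)))).1
  rcases this with h | h <;> linarith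
lemma e_bounds {g0 g1 e : Quad} (hp : Pred C f1 f2 g0 g1) (he : e = g0 ∨ e = g1) :
    e ∈ C.LC f1 f2 ∧ C.u f1 g0 ≤ C.u f1 e ∧ C.u f1 e ≤ C.u f1 g1 := by
  have := hp.2.2.1
  rcases he with rfl | rfl
  · exact ⟨hp.1, le_refl _, by linarith⟩
  · exact ⟨hp.2.1, by linarith, le_refl _⟩
lemma typeA_card :
    ((C.LC f1 f2).filter (fun g1 => ∃ g0, Pred C f1 f2 g0 g1 ∧ TypeA C f1 f2 s g0 g1)).card ≤ 12 := by
  by_contra hc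
  obtain ⟨G0, G1, hP, hS⟩ := spaced (fun g0 g1 => TypeA C f1 f2 s g0 g1)
    (show 13 ≤ _ by exact not_le.1 hc)
  have hE : ∀ k, k < 13 → ∃ e, e ∈ C.LC f1 f2 ∧ C.u f1 (G0 k) ≤ C.u f1 e ∧
      C.u f1 e ≤ C.u f1 (G1 k) ∧ ∀ x, s.ev x ≤ e.ev x := fun k hk => by
    obtain ⟨e, he, hs⟩ := (hP k hk).2.1
    obtain ⟨x1, x2, x3⟩ := e_bounds (hP k hk).1 he
    grind
  have main : ∀ k, 2 ≤ k → k < 11 → ∀ e e', e ∈ C.LC f1 f2 → e' ∈ C.LC f1 f2 →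
      C.u f1 e ≤ C.u f1 (G1 (k - 2)) → C.u f1 (G0 (k + 2)) ≤ C.u f1 e' →
      (∀ x, s.ev x ≤ e.ev x) → (∀ x, s.ev x ≤ e'.ev x) →
      ∃ v, f1.ev v ≤ s.ev v ∧ f2.ev v ≤ s.ev v ∧
        ((C.u f1 e < v ∧ v < C.u f1 e') ∨ (C.u f2 e' < v ∧ v < C.u f2 e)) := by
    intro k hk hk' e e' he he' h h' hs hs'
    obtain ⟨n, a, b, v, L, q1, q2, q3⟩ := (hP k (by omega)).2.2
    have i1 := hS (k - 2) k (by omega) (by omega)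
    have i2 := hS k (k + 2) (by omega) (by omega)
    exact ⟨v, by linarith, by linarith, locA L he he' (by linarith) (by linarith)
      (q1.trans (hs v)) (q1.trans (hs' v))⟩
  obtain ⟨e0, m0, l0, r0, s0⟩ := hE 0 (by norm_num)
  obtain ⟨e4, m4, l4, r4, s4⟩ := hE 4 (by norm_num)
  obtain ⟨e8, m8, l8, r8, s8⟩ := hE 8 (by norm_num)
  obtain ⟨e12, m12, l12, r12, s12⟩ := hE 12 (by norm_num)
  obtain ⟨v2, A2, B2, D2⟩ := main 2 (by norm_num) (by norm_num) e0 e4 m0 m4 r0 l4 s0 s4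
  obtain ⟨v6, A6, B6, D6⟩ := main 6 (by norm_num) (by norm_num) e4 e8 m4 m8 r4 l8 s4 s8
  obtain ⟨v10, A10, B10, D10⟩ := main 10 (by norm_num) (by norm_num) e8 e12 m8 m12 r8 l12 s8 s12
  have hx : ∀ e, e ∈ C.LC f1 f2 → (∀ x, s.ev x ≤ e.ev x) →
      s.ev (C.u f1 e) < f1.ev (C.u f1 e) ∧ s.ev (C.u f2 e) < f2.ev (C.u f2 e) := fun e he hs => by
    have k := mem_LC.1 he
    exact ⟨lt_of_le_of_lt (hs _) (C.tan _ _ k.1).lt, lt_of_le_of_lt (hs _) (C.tan _ _ k.2.1).lt⟩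
  obtain ⟨x0, y0⟩ := hx e0 m0 s0
  obtain ⟨x4, y4⟩ := hx e4 m4 s4
  obtain ⟨x8, y8⟩ := hx e8 m8 s8
  have o48 : C.u f1 e4 < C.u f1 e8 := by have := hS 4 8 (by norm_num) (by norm_num); linarith
  have o84 : C.u f2 e8 < C.u f2 e4 := by have := LC_nest m4 m8 o48; linarith [C.hρ]
  rcases D2 with D2 | D2 <;> rcases D6 with D6 | D6
  · exact forbid f1 s D2.1 D2.2 D6.1 x0 A2 x4 A6
  · rcases D10 with D10 | D10
    · exact forbid f1 s D2.1 D2.2 (o48.trans D10.1) x0 A2 x4 A10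
    · exact forbid' f2 s D10.2 D6.1 D6.2 B10 y8 B6 y4
  · rcases D10 with D10 | D10
    · exact forbid f1 s D6.1 D6.2 D10.1 x4 A6 x8 A10
    · exact forbid' f2 s (D10.2.trans o84) D2.1 D2.2 B10 y4 B2 y0
  · exact forbid' f2 s D6.2 D2.1 D2.2 B6 y4 B2 y0
lemma typeB_card :
    ((C.LC f1 f2).filter (fun g1 => ∃ g0, Pred C f1 f2 g0 g1 ∧ TypeB C f1 f2 s g0 g1)).card ≤ 12 := by
  by_contra hc
  obtain ⟨G0, G1, hP, hS⟩ := spaced (fun g0 g1 => TypeB C f1 f2 s g0 g1)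
    (show 13 ≤ _ by linarith)
  have hE : ∀ k, k < 13 → ∃ n a b, Loc C f1 f2 (G0 k) (G1 k) n a b ∧ ∀ x, s.ev x ≤ n.ev x :=
    fun k hk => (hP k hk).2.1
  have main : ∀ k, 2 ≤ k → k < 11 → ∀ n a b n' a' b', Loc C f1 f2 (G0 (k - 2)) (G1 (k - 2)) n a b →
      Loc C f1 f2 (G0 (k + 2)) (G1 (k + 2)) n' a' b' →
      (∀ x, s.ev x ≤ n.ev x) → (∀ x, s.ev x ≤ n'.ev x) →
      ∃ v, f1.ev v < s.ev v ∧ f2.ev v < s.ev v ∧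
        a < a' ∧ b' < b ∧ ((a < v ∧ v < a') ∨ (b' < v ∧ v < b)) := by
    intro k hk hk' n a b n' a' b' L L' hs hs'
    obtain ⟨e, he, v, q1, q2, q3⟩ := (hP k (by omega)).2.2
    have i1 := hS (k - 2) k (by omega) (by omega)
    have i2 := hS k (k + 2) (by omega) (by omega)
    obtain ⟨x1, x2, x3⟩ := e_bounds (hP k (by omega)).1 he
    obtain ⟨z1, z2, -⟩ := L.hi e x1 (by linarith)
    obtain ⟨z3, z4, -⟩ := L'.lo e x1 (by linarith)
    exact ⟨v, by linarith, by linarith, by linarith, by linarith,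
      locB L L' x1 (by linarith) (by linarith)
      (lt_of_lt_of_le q1 (hs v)) (lt_of_lt_of_le q1 (hs' v))⟩
  obtain ⟨n0, a0, b0, L0, s0⟩ := hE 0 (by norm_num)
  obtain ⟨n4, a4, b4, L4, s4⟩ := hE 4 (by norm_num)
  obtain ⟨n8, a8, b8, L8, s8⟩ := hE 8 (by norm_num)
  obtain ⟨n12, a12, b12, L12, s12⟩ := hE 12 (by norm_num)
  obtain ⟨v2, A2, B2, -, -, D2⟩ := main 2 (by norm_num) (by norm_num) _ _ _ _ _ _ L0 L4 s0 s4
  obtain ⟨v6, A6, B6, o48, o84, D6⟩ := main 6 (by norm_num) (by norm_num) _ _ _ _ _ _ L4 L8 s4 s8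
  obtain ⟨v10, A10, B10, -, -, D10⟩ :=
    main 10 (by norm_num) (by norm_num) _ _ _ _ _ _ L8 L12 s8 s12
  have x0 := (s0 a0).trans L0.na
  have x4 := (s4 a4).trans L4.na
  have x8 := (s8 a8).trans L8.na
  have y0 := (s0 b0).trans L0.nb
  have y4 := (s4 b4).trans L4.nb
  have y8 := (s8 b8).trans L8.nb
  rcases D2 with D2 | D2 <;> rcases D6 with D6 | D6
  · exact forbid' s f1 D2.1 D2.2 D6.1 x0 A2 x4 A6
  · rcases D10 with D10 | D10
    · exact forbid' s f1 D2.1 D2.2 (o48.trans D10.1) x0 A2 x4 A10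
    · exact forbid s f2 D10.2 D6.1 D6.2 B10 y8 B6 y4
  · rcases D10 with D10 | D10
    · exact forbid' s f1 D6.1 D6.2 D10.1 x4 A6 x8 A10
    · exact forbid s f2 (D10.2.trans o84) D2.1 D2.2 B10 y4 B2 y0
  · exact forbid s f2 D6.2 D2.1 D2.2 B6 y4 B2 y0
end Cfg
section rank
variable {α : Type*} (T : Finset α) (k : α → ℝ)
def rk (x : α) : ℕ := (T.filter (fun y => k y < k x)).card
lemma rk_lt {x y : α} (hx : x ∈ T) (h : k x < k y) : rk T k x < rk T k y := by
  apply Finset.card_lt_card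
  refine ⟨fun z hz => ?_, fun hc => ?_⟩
  · grind
  · have : x ∈ T.filter (fun z => k z < k x) := hc (by simp [hx, h])
    simp at this
lemma rk_lt_card {x : α} (hx : x ∈ T) : rk T k x < T.card := by
  apply Finset.card_lt_card
  grind
lemma rk_inj (hk : Set.InjOn k T) : Set.InjOn (rk T k) T := by
  intro x hx y hy h
  rcases lt_trichotomy (k x) (k y) with h' | h' | h'
  · exact absurd h (rk_lt T k hx h').ne
  · exact hk hx hy h'
  · exact absurd h (rk_lt T k hy h').ne'
lemma rk_surj (hk : Set.InjOn k T) {j : ℕ} (hj : j < T.card) : ∃ x ∈ T, rk T k x = j := by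
  have h1 : T.image (rk T k) = Finset.range T.card := by
    apply Finset.eq_of_subset_of_card_le
    · intro j hj
      obtain ⟨x, hx, rfl⟩ := Finset.mem_image.1 hj
      exact Finset.mem_range.2 (rk_lt_card T k hx)
    · rw [card_image_of_injOn (rk_inj T k hk)]; simp
  have : j ∈ T.image (rk T k) := by grind
  simpa using this
end rank
namespace Cfg
variable (C : Cfg) (S : Finset Quad) (off q : ℕ)
def cross (s g : Quad) : Prop := ∃ x, g.ev x < s.ev x
def pat (g : Quad) : Finset Quad := S.filter (fun s => cross s g)
def Lp (f : Quad) (p : Finset Quad) : Finset Quad :=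
  C.B.filter (fun g => (f, g) ∈ C.H ∧ pat S g = p)
def rank (f g : Quad) : ℕ := rk (C.Lp S f (pat S g)) (C.u f) g
def cls (f g : Quad) : Finset Quad × ℕ := (pat S g, (C.rank S f g + off) / q)
def Wall (f w : Quad) : Prop := (f, w) ∈ C.H ∧ (C.rank S f w + off) % q = 0
variable {C S off q}
lemma mem_Lp {f g : Quad} {p : Finset Quad} : g ∈ C.Lp S f p ↔ (f, g) ∈ C.H ∧ pat S g = p := by
  simp only [Lp, mem_filter, and_iff_right_iff_imp]
  intro h; exact (C.sub _ _ h.1).2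
lemma Lp_inj (f : Quad) (p : Finset Quad) : Set.InjOn (C.u f) (C.Lp S f p) := by
  intro x hx y hy h
  exact u_inj (mem_Lp.1 hx).1 (mem_Lp.1 hy).1 h
lemma wall_exists (hq : 0 < q) {f g0 g1 : Quad} (h0 : (f, g0) ∈ C.H) (h1 : (f, g1) ∈ C.H)
    (hp : pat S g0 = pat S g1) (hu : C.u f g0 < C.u f g1)
    (hc : C.cls S off q f g0 ≠ C.cls S off q f g1) :
    ∃ w, C.Wall S off q f w ∧ pat S w = pat S g1 ∧ C.u f g0 < C.u f w ∧ C.u f w ≤ C.u f g1 := by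
  set T := C.Lp S f (pat S g1) with hT
  have m0 : g0 ∈ T := mem_Lp.2 ⟨h0, hp⟩
  have m1 : g1 ∈ T := mem_Lp.2 ⟨h1, rfl⟩
  have r01 := rk_lt T (C.u f) m0 hu
  have r1c := rk_lt_card T (C.u f) m1
  have hc' : (rk T (C.u f) g0 + off) / q ≠ (rk T (C.u f) g1 + off) / q := by
    intro h; apply hc
    simp only [cls, rank, hp]; grind
  set r0 := rk T (C.u f) g0
  set r1 := rk T (C.u f) g1
  have hlt : (r0 + off) / q < (r1 + off) / q :=
    lt_of_le_of_ne (Nat.div_le_div_right (by omega)) hc'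
  have k1 : (r1 + off) / q * q ≤ r1 + off := Nat.div_mul_le_self _ _
  have k2 : r0 + off < (r1 + off) / q * q := (Nat.div_lt_iff_lt_mul hq).1 hlt
  obtain ⟨w, hw, hj⟩ := rk_surj T (C.u f) (Lp_inj f _) (j := (r1 + off) / q * q - off) (by omega)
  have hw' := mem_Lp.1 hw
  refine ⟨w, ⟨hw'.1, ?_⟩, hw'.2, ?_, ?_⟩
  · simp only [rank]
    rw [hw'.2, ← hT, hj, Nat.sub_add_cancel (by omega)]; simp
  · by_contra hcon
    push Not at hcon
    rcases lt_or_eq_of_le hcon with hh | hh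
    · have := rk_lt T (C.u f) hw hh; omega
    · have := Lp_inj f _ hw m0 hh; subst this; omega
  · by_contra hcon
    push Not at hcon
    have := rk_lt T (C.u f) m1 hcon; omega
lemma cls_card (hq : 0 < q) (f g : Quad) :
    (C.B.filter (fun g' => (f, g') ∈ C.H ∧ C.cls S off q f g' = C.cls S off q f g)).card ≤ q := by
  set c := (C.rank S f g + off) / q
  set T := C.Lp S f (pat S g) with hT
  have key : ∀ g' ∈ C.B.filter (fun g' => (f, g') ∈ C.H ∧ C.cls S off q f g' = C.cls S off q f g),
      g' ∈ T ∧ (rk T (C.u f) g' + off) / q = c := by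
    intro g' hg'
    obtain ⟨-, h1, h2⟩ := mem_filter.1 hg'
    simp only [cls, Prod.mk.injEq] at h2
    refine ⟨mem_Lp.2 ⟨h1, h2.1⟩, ?_⟩
    have := h2.2
    rw [rank, h2.1] at this
    exact this
  calc _ ≤ (Finset.Ico (c * q) (c * q + q)).card := by
        apply card_le_card_of_injOn (fun g' => rk T (C.u f) g' + off)
        · intro g' hg'
          obtain ⟨-, h⟩ := key g' hg'
          simp only [Finset.coe_Ico, Set.mem_Ico]
          have a1 := Nat.div_mul_le_self (rk T (C.u f) g' + off) q
          have a2 := Nat.lt_div_mul_add (a := rk T (C.u f) g' + off) hq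
          rw [h] at a1 a2
          exact ⟨a1, a2⟩
        · intro x hx y hy hxy
          have := Nat.add_right_cancel hxy
          exact rk_inj T _ (Lp_inj f _) (key x hx).1 (key y hy).1 this
    _ = q := by simp
def Gap (C : Cfg) (S : Finset Quad) (sg : ℝ) (f w : Quad) : Finset Quad :=
  C.W.filter (fun z => Zset sg f w (C.u f w) z ∧ ∀ s ∈ S, Zset sg f w (C.u f w) s →
    ¬ Nb C.ρ f (C.u f w) s →
    ¬ (0 < th w (C.u f w) s ∧ th w (C.u f w) s ≤ th w (C.u f w) z) ∧
    ¬ (th w (C.u f w) z ≤ th w (C.u f w) s ∧ th w (C.u f w) s ≤ 0))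
def Near (C : Cfg) (S : Finset Quad) (f1 f2 e : Quad) : Prop :=
  ∃ s ∈ S, Nb C.ρ f1 (C.u f1 e) s ∨ Nb C.ρ f2 (C.u f2 e) s
variable {f1 f2 g0 g1 : Quad}
lemma real_cross {e s : Quad} (hS : S ⊆ C.W) (he : e ∈ C.LC f1 f2) (hs : s ∈ S)
    (hn : ¬ Near C S f1 f2 e) (hc : cross s e) :
    ∃ v, e.ev v < s.ev v ∧ f1.ev v ≤ e.ev v ∧ f2.ev v ≤ e.ev v := by
  have k := mem_LC.1 he
  have hl := (C.tan _ _ k.1).lead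
  have hw := abs_le.1 (C.lW _ (C.sub _ _ k.1).1 s (hS hs))
  refine real_nondeg C.hρ (C.tan _ _ k.1) (C.tan _ _ k.2.1)
    (C.sepg _ _ _ k.1 k.2.1 (LC_ne he)) (by linarith) (by linarith) hc ?_ ?_
  · intro h; exact hn ⟨s, hs, Or.inl h⟩
  · intro h; exact hn ⟨s, hs, Or.inr h⟩
lemma not_cross {s g : Quad} (h : ¬ cross s g) : ∀ x, s.ev x ≤ g.ev x := by
  intro x; by_contra hx; exact h ⟨x, not_le.1 hx⟩
lemma break_pat (hS : S ⊆ C.W) (hp : Pred C f1 f2 g0 g1) (hpat : pat S g0 ≠ pat S g1)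
    (n0 : ¬ Near C S f1 f2 g0) (n1 : ¬ Near C S f1 f2 g1) :
    ∃ s ∈ S, TypeA C f1 f2 s g0 g1 := by
  have : ∃ s ∈ S, ¬ (cross s g0 ↔ cross s g1) := by
    by_contra hc
    push Not at hc
    apply hpat
    exact Finset.filter_congr hc
  obtain ⟨s, hs, hne⟩ := this
  refine ⟨s, hs, ?_⟩
  by_cases c0 : cross s g0
  · have c1 : ¬ cross s g1 := fun h => hne ⟨fun _ => h, fun _ => c0⟩
    obtain ⟨v, v1, v2, v3⟩ := real_cross hS hp.1 hs n0 c0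
    exact ⟨⟨g1, Or.inr rfl, not_cross c1⟩, g0, _, _, v, loc_real hp (Or.inl rfl), v1.le, v2, v3⟩
  · have c1 : cross s g1 := by
      grind
    obtain ⟨v, v1, v2, v3⟩ := real_cross hS hp.2.1 hs n1 c1
    exact ⟨⟨g0, Or.inl rfl, not_cross c0⟩, g1, _, _, v, loc_real hp (Or.inr rfl), v1.le, v2, v3⟩
lemma cross_iff {s g g' : Quad} (hs : s ∈ S) (h : pat S g = pat S g') : cross s g ↔ cross s g' := by
  have : s ∈ pat S g ↔ s ∈ pat S g' := by rw [h]
  simpa [pat, hs] using this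
lemma wall_use (hS : S ⊆ C.W) (hp : Pred C f1 f2 g0 g1) {sg a b : ℝ} {f f' w : Quad}
    (hf : (f = f1 ∧ f' = f2) ∨ (f = f2 ∧ f' = f1)) (hw : (f, w) ∈ C.H)
    (hpw : pat S w = pat S g1) (hZ : Zset sg f w (C.u f w) f')
    (hL : Loc C f1 f2 g0 g1 (addq w (th w (C.u f w) f') (C.u f w)) a b)
    (n1 : ¬ Near C S f1 f2 g1) (hG : f' ∉ Gap C S sg f w) :
    ∃ s ∈ S, TypeA C f1 f2 s g0 g1 ∨ TypeB C f1 f2 s g0 g1 := by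
  have k1 := mem_LC.1 hp.2.1
  have hfW : f' ∈ C.W := by
    rcases hf with ⟨-, rfl⟩ | ⟨-, rfl⟩
    exacts [(C.sub _ _ k1.2.1).1, (C.sub _ _ k1.1).1]
  have hfW' : f ∈ C.W := (C.sub _ _ hw).1
  simp only [Gap, mem_filter, not_and] at hG
  have hG := hG hfW hZ
  push Not at hG
  obtain ⟨s, hs, zs, ns, hcase⟩ := hG
  refine ⟨s, hs, ?_⟩
  have tw := C.tan _ _ hw
  have thmono : ∀ {x θ θ' : ℝ}, θ ≤ θ' →
      (addq w θ (C.u f w)).ev x ≤ (addq w θ' (C.u f w)).ev x := by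
    intro x θ θ' h
    rw [addq_ev, addq_ev]
    nlinarith
  have nd := zs.nondeg C.hρ tw ns (C.lW _ hfW' _ (hS hs))
  by_cases hc : 0 < th w (C.u f w) s ∧ th w (C.u f w) s ≤ th w (C.u f w) f'
  · right
    have cw : cross s w := by
      refine ⟨vt w (C.u f w) s, ?_⟩
      rw [← zs.eq_G, addq_ev]
      have : 0 < (vt w (C.u f w) s - C.u f w) ^ 2 := by
        rw [← sq_abs]; have := C.hρ; exact pow_pos (by linarith) 2
      have := mul_pos hc.1 this
      linarith
    obtain ⟨v, v1, v2, v3⟩ := real_cross hS hp.2.1 hs n1 ((cross_iff hs hpw).1 cw)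
    exact ⟨⟨_, a, b, hL, fun x => (zs.le_G x).trans (thmono hc.2)⟩, g1, Or.inr rfl, v, v1, v2, v3⟩
  · left
    have hc' := hcase (by simpa using hc)
    have cw : ¬ cross s w := by
      rintro ⟨x, hx⟩
      have h1 := zs.le_G x
      have h2 := thmono (x := x) hc'.2
      rw [addq_ev w 0] at h2
      linarith
    refine ⟨⟨g1, Or.inr rfl, not_cross (fun h => cw ((cross_iff hs hpw).2 h))⟩,
      _, a, b, vt w (C.u f w) s, hL, ?_, ?_⟩
    · rw [← zs.eq_G]; exact thmono hc'.1
    · have e1 := hZ.le_G (vt w (C.u f w) s)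
      have e2 := addq_ge C.hρ.le tw hZ.2.2.1 (x := vt w (C.u f w) s) (by linarith [C.hρ])
      grind
lemma break_cases (hq : 0 < q) (hS : S ⊆ C.W) (hp : Pred C f1 f2 g0 g1)
    (hc : (C.cls S off q f1 g0, C.cls S off q f2 g0) ≠ (C.cls S off q f1 g1, C.cls S off q f2 g1)) :
    (Near C S f1 f2 g0 ∨ Near C S f1 f2 g1) ∨
    (∃ w, C.Wall S off q f1 w ∧ C.u f1 g0 < C.u f1 w ∧ C.u f1 w ≤ C.u f1 g1 ∧
      ((f2, w) ∈ C.H ∨ f2 ∈ Gap C S 1 f1 w)) ∨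
    (∃ w, C.Wall S off q f2 w ∧ C.u f2 g1 < C.u f2 w ∧ C.u f2 w ≤ C.u f2 g0 ∧
      ((f1, w) ∈ C.H ∨ f1 ∈ Gap C S (-1) f2 w)) ∨
    (∃ s ∈ S, TypeA C f1 f2 s g0 g1 ∨ TypeB C f1 f2 s g0 g1) := by
  by_cases n0 : Near C S f1 f2 g0
  · grind
  by_cases n1 : Near C S f1 f2 g1
  · grind
  right
  have k0 := mem_LC.1 hp.1
  have k1 := mem_LC.1 hp.2.1
  by_cases hpat : pat S g0 = pat S g1
  swap
  · right; right
    obtain ⟨s, hs, h⟩ := break_pat hS hp hpat n0 n1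
    grind
  by_cases hc1 : C.cls S off q f1 g0 = C.cls S off q f1 g1
  · have hc2 : C.cls S off q f2 g1 ≠ C.cls S off q f2 g0 := fun h => hc (by rw [hc1, h])
    have hlt : C.u f2 g1 < C.u f2 g0 := by
      have := LC_nest hp.1 hp.2.1 hp.2.2.1; linarith [C.hρ]
    obtain ⟨w, hw, w1, w2, w3⟩ := wall_exists hq k1.2.1 k0.2.1 hpat.symm hlt hc2
    right
    rcases lt_or_eq_of_le w3 with h | h
    · obtain ⟨z, L⟩ := loc_virt' hp hw.1 h w2
      by_cases hg : f1 ∈ Gap C S (-1) f2 w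
      · grind
      · right
        exact wall_use hS hp (Or.inr ⟨rfl, rfl⟩) hw.1 (w1.trans hpat) z L n1 hg
    · left
      have := u_inj hw.1 k0.2.1 h
      grind
  · obtain ⟨w, hw, w1, w2, w3⟩ := wall_exists hq k0.1 k1.1 hpat hp.2.2.1 hc1
    rcases lt_or_eq_of_le w3 with h | h
    · obtain ⟨z, L⟩ := loc_virt hp hw.1 w2 h
      by_cases hg : f2 ∈ Gap C S 1 f1 w
      · grind
      · right; right
        exact wall_use hS hp (Or.inl ⟨rfl, rfl⟩) hw.1 w1 z L n1 hg
    · left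
      have := u_inj hw.1 k1.1 h
      grind
end Cfg
lemma image_breaks {α β : Type*} [DecidableEq α] [DecidableEq β] (T : Finset α) (k : α → ℝ) (c : α → β) :
    Set.InjOn k T →
    (T.image c).card ≤ 1 + (T.filter (fun x => ∃ y ∈ T, k y < k x ∧
      (∀ z ∈ T, k z ≤ k y ∨ k x ≤ k z) ∧ c y ≠ c x)).card := by
  induction T using Finset.induction_on_max_value k with
  | empty => simp
  | insert a s ha hmax ih =>
    intro hk
    have hks : Set.InjOn k s := hk.mono (by simp)
    have ih := ih hks
    have hlt : ∀ x ∈ s, k x < k a := fun x hx => lt_of_le_of_ne (hmax x hx) (fun h =>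
      ha (hk (by simp [hx]) (by simp) h ▸ hx))
    have hsub : s.filter (fun x => ∃ y ∈ s, k y < k x ∧
      (∀ z ∈ s, k z ≤ k y ∨ k x ≤ k z) ∧ c y ≠ c x) ⊆ (insert a s).filter (fun x =>
        ∃ y ∈ insert a s, k y < k x ∧
      (∀ z ∈ insert a s, k z ≤ k y ∨ k x ≤ k z) ∧ c y ≠ c x) := by
      grind
    rw [Finset.image_insert]
    by_cases hca : c a ∈ s.image c
    · rw [Finset.insert_eq_of_mem hca]
      exact ih.trans (Nat.add_le_add_left (Finset.card_le_card hsub) 1)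
    · rcases s.eq_empty_or_nonempty with rfl | hne
      · simp
      rw [Finset.card_insert_of_notMem hca]
      obtain ⟨y, hy, hymax⟩ := s.exists_max_image k hne
      have hsub2 : insert a (s.filter (fun x => ∃ y ∈ s, k y < k x ∧
        (∀ z ∈ s, k z ≤ k y ∨ k x ≤ k z) ∧ c y ≠ c x)) ⊆ (insert a s).filter (fun x =>
        ∃ y ∈ insert a s, k y < k x ∧
        (∀ z ∈ insert a s, k z ≤ k y ∨ k x ≤ k z) ∧ c y ≠ c x) := by
        grind
      have := Finset.card_le_card hsub2
      rw [Finset.card_insert_of_notMem (by simp [ha])] at this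
      omega
lemma sum_card_le {α β γ : Type*} (P : Finset (α × β)) (F : α → β → Finset γ)
    (T : Finset (α × β × γ)) (h : ∀ p ∈ P, ∀ g ∈ F p.1 p.2, (p.1, p.2, g) ∈ T) :
    ∑ p ∈ P, (F p.1 p.2).card ≤ T.card := by
  rw [← card_sigma]
  apply card_le_card_of_injOn (fun x : (Σ _ : α × β, γ) => (x.1.1, x.1.2, x.2))
  · intro x hx
    grind
  · rintro ⟨⟨a, b⟩, c⟩ _ ⟨⟨a', b'⟩, c'⟩ _ h
    grind
namespace Cfg
variable (C : Cfg) (S : Finset Quad) (off q : ℕ)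
def LT : Finset (Quad × Quad × Quad) :=
  (C.W ×ˢ C.W ×ˢ C.B).filter (fun t => t.2.2 ∈ C.LC t.1 t.2.1)
def key2 (f1 f2 g : Quad) : (Finset Quad × ℕ) × (Finset Quad × ℕ) :=
  (C.cls S off q f1 g, C.cls S off q f2 g)
def Nl : ℕ := (C.LT.image (fun t => (t.1, t.2.1, C.key2 S off q t.1 t.2.1 t.2.2))).card
def dg (g : Quad) : ℕ := (C.W.filter (fun f => (f, g) ∈ C.H)).card
def Deg (s : Quad) : ℕ := (C.LT.filter (fun t => Nb C.ρ t.1 (C.u t.1 t.2.2) s ∨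
    Nb C.ρ t.2.1 (C.u t.2.1 t.2.2) s)).card
def WL : Finset (Quad × Quad) := C.H.filter (fun e => (C.rank S e.1 e.2 + off) % q = 0)
def BR (f1 f2 : Quad) : Finset Quad := (C.LC f1 f2).filter (fun g1 => ∃ g0, Pred C f1 f2 g0 g1 ∧
  C.key2 S off q f1 f2 g0 ≠ C.key2 S off q f1 f2 g1)
variable {C S off q}
lemma mem_LT {f1 f2 g : Quad} : (f1, f2, g) ∈ C.LT ↔ g ∈ C.LC f1 f2 := by
  simp only [LT, mem_filter, mem_product, and_iff_right_iff_imp]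
  intro h
  have k := mem_LC.1 h
  exact ⟨(C.sub _ _ k.1).1, (C.sub _ _ k.2.1).1, (C.sub _ _ k.1).2⟩
lemma image_le (f1 f2 : Quad) :
    ((C.LC f1 f2).image (C.key2 S off q f1 f2)).card ≤ 1 + (C.BR S off q f1 f2).card := by
  refine (image_breaks (C.LC f1 f2) (C.u f1) (C.key2 S off q f1 f2) ?_).trans ?_
  · intro x hx y hy h
    exact u_inj (mem_LC.1 hx).1 (mem_LC.1 hy).1 h
  · apply Nat.add_le_add_left
    apply Finset.card_le_card
    intro x hx
    simp only [mem_filter] at hx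
    obtain ⟨hx, y, hy, h1, h2, h3⟩ := hx
    exact mem_filter.2 ⟨hx, y, ⟨hy, hx, h1, h2⟩, h3⟩
lemma Nl_le_sum : C.Nl S off q ≤ ∑ p ∈ C.W ×ˢ C.W, (1 + (C.BR S off q p.1 p.2).card) := by
  have : C.LT.image (fun t => (t.1, t.2.1, C.key2 S off q t.1 t.2.1 t.2.2)) ⊆
      (C.W ×ˢ C.W).biUnion (fun p => ((C.LC p.1 p.2).image (C.key2 S off q p.1 p.2)).image
        (fun z => (p.1, p.2, z))) := by
    intro z hz
    obtain ⟨⟨f1, f2, g⟩, ht, rfl⟩ := Finset.mem_image.1 hz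
    have hg := mem_LT.1 ht
    have k := mem_LC.1 hg
    simp only [Finset.mem_biUnion, Finset.mem_image]
    exact ⟨(f1, f2), mem_product.2 ⟨(C.sub _ _ k.1).1, (C.sub _ _ k.2.1).1⟩, _,
      ⟨g, hg, rfl⟩, rfl⟩
  refine (Finset.card_le_card this).trans (card_biUnion_le.trans ?_)
  apply sum_le_sum
  intro p _
  exact Finset.card_image_le.trans (image_le p.1 p.2)
def BW1 (C : Cfg) (S : Finset Quad) (off q : ℕ) (f1 f2 : Quad) : Finset Quad :=
  (C.LC f1 f2).filter (fun g1 => ∃ g0, Pred C f1 f2 g0 g1 ∧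
    ∃ w, C.Wall S off q f1 w ∧ C.u f1 g0 < C.u f1 w ∧ C.u f1 w ≤ C.u f1 g1 ∧
      ((f2, w) ∈ C.H ∨ f2 ∈ Gap C S 1 f1 w))
def BW2 (C : Cfg) (S : Finset Quad) (off q : ℕ) (f1 f2 : Quad) : Finset Quad :=
  (C.LC f1 f2).filter (fun g1 => ∃ g0, Pred C f1 f2 g0 g1 ∧
    ∃ w, C.Wall S off q f2 w ∧ C.u f2 g1 < C.u f2 w ∧ C.u f2 w ≤ C.u f2 g0 ∧
      ((f1, w) ∈ C.H ∨ f1 ∈ Gap C S (-1) f2 w))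
def NS (C : Cfg) (S : Finset Quad) (f1 f2 : Quad) : Finset Quad :=
  (C.LC f1 f2).filter (fun e => Near C S f1 f2 e)
def BN0 (C : Cfg) (S : Finset Quad) (f1 f2 : Quad) : Finset Quad :=
  (C.LC f1 f2).filter (fun g1 => ∃ g0, Pred C f1 f2 g0 g1 ∧ Near C S f1 f2 g0)
lemma BW1_le (f1 f2 : Quad) : (BW1 C S off q f1 f2).card ≤
    (C.B.filter (fun w => C.Wall S off q f1 w ∧ ((f2, w) ∈ C.H ∨ f2 ∈ Gap C S 1 f1 w))).card := by
  have : ∀ g1 ∈ BW1 C S off q f1 f2, ∃ w g0, Pred C f1 f2 g0 g1 ∧ C.Wall S off q f1 w ∧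
      C.u f1 g0 < C.u f1 w ∧ C.u f1 w ≤ C.u f1 g1 ∧ ((f2, w) ∈ C.H ∨ f2 ∈ Gap C S 1 f1 w) := by
    intro g1 h
    obtain ⟨-, g0, h0, w, h⟩ := mem_filter.1 h
    grind
  choose! w g0 h1 h2 h3 h4 h5 using this
  apply card_le_card_of_injOn w
  · intro g hg
    exact mem_filter.2 ⟨(C.sub _ _ (h2 g hg).1).2, h2 g hg, h5 g hg⟩
  · intro g hg g' hg' hw
    have a1 := h3 g hg; have a2 := h4 g hg; have a3 := h3 g' hg'; have a4 := h4 g' hg'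
    rw [hw] at a1 a2
    have k := (h1 g hg); have k' := h1 g' hg'
    rcases lt_trichotomy (C.u f1 g) (C.u f1 g') with h | h | h
    · rcases k'.2.2.2 g k.2.1 with h | h <;> linarith
    · exact u_inj (mem_LC.1 k.2.1).1 (mem_LC.1 k'.2.1).1 h
    · rcases k.2.2.2 g' k'.2.1 with h | h <;> linarith
lemma BW2_le (f1 f2 : Quad) : (BW2 C S off q f1 f2).card ≤
    (C.B.filter (fun w => C.Wall S off q f2 w ∧ ((f1, w) ∈ C.H ∨ f1 ∈ Gap C S (-1) f2 w))).card := by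
  have : ∀ g1 ∈ BW2 C S off q f1 f2, ∃ w g0, Pred C f1 f2 g0 g1 ∧ C.Wall S off q f2 w ∧
      C.u f2 g1 < C.u f2 w ∧ C.u f2 w ≤ C.u f2 g0 ∧ ((f1, w) ∈ C.H ∨ f1 ∈ Gap C S (-1) f2 w) := by
    intro g1 h
    obtain ⟨-, g0, h0, w, h⟩ := mem_filter.1 h
    grind
  choose! w g0 h1 h2 h3 h4 h5 using this
  have mono : ∀ {x y : Quad}, x ∈ C.LC f1 f2 → y ∈ C.LC f1 f2 → C.u f1 x ≤ C.u f1 y →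
      C.u f2 y ≤ C.u f2 x := by
    intro x y hx hy h
    rcases lt_or_eq_of_le h with h | h
    · have := LC_nest hx hy h; linarith [C.hρ]
    · rw [u_inj (mem_LC.1 hx).1 (mem_LC.1 hy).1 h]
  apply card_le_card_of_injOn w
  · intro g hg
    exact mem_filter.2 ⟨(C.sub _ _ (h2 g hg).1).2, h2 g hg, h5 g hg⟩
  · intro g hg g' hg' hw
    have a1 := h3 g hg; have a2 := h4 g hg; have a3 := h3 g' hg'; have a4 := h4 g' hg'
    rw [hw] at a1 a2
    have k := (h1 g hg); have k' := h1 g' hg'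
    rcases lt_trichotomy (C.u f1 g) (C.u f1 g') with h | h | h
    · rcases k'.2.2.2 g k.2.1 with h | h
      · have := mono k.2.1 k'.1 h; linarith
      · linarith
    · exact u_inj (mem_LC.1 k.2.1).1 (mem_LC.1 k'.2.1).1 h
    · rcases k.2.2.2 g' k'.2.1 with h | h
      · have := mono k'.2.1 k.1 h; linarith
      · linarith
lemma BN0_le (f1 f2 : Quad) : (BN0 C S f1 f2).card ≤ (NS C S f1 f2).card := by
  have : ∀ g1 ∈ BN0 C S f1 f2, ∃ g0, Pred C f1 f2 g0 g1 ∧ Near C S f1 f2 g0 := by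
    intro g1 h
    exact (mem_filter.1 h).2
  choose! g0 h1 h2 using this
  apply card_le_card_of_injOn g0
  · intro g hg
    exact mem_filter.2 ⟨(h1 g hg).1, h2 g hg⟩
  · intro g hg g' hg' hw
    have k := (h1 g hg); have k' := h1 g' hg'
    rw [hw] at k
    rcases lt_trichotomy (C.u f1 g) (C.u f1 g') with h | h | h
    · rcases k'.2.2.2 g k.2.1 with h | h
      · linarith [k.2.2.1]
      · linarith
    · exact u_inj (mem_LC.1 k.2.1).1 (mem_LC.1 k'.2.1).1 h
    · rcases k.2.2.2 g' k'.2.1 with h | h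
      · linarith [k'.2.2.1]
      · linarith
lemma BR_le (hq : 0 < q) (hS : S ⊆ C.W) (f1 f2 : Quad) :
    (C.BR S off q f1 f2).card ≤ 2 * (NS C S f1 f2).card + (BW1 C S off q f1 f2).card +
      (BW2 C S off q f1 f2).card + 24 * S.card := by
  have hsub : C.BR S off q f1 f2 ⊆ (BN0 C S f1 f2 ∪ NS C S f1 f2) ∪ (BW1 C S off q f1 f2 ∪
      BW2 C S off q f1 f2) ∪ S.biUnion (fun s =>
        (C.LC f1 f2).filter (fun g1 => ∃ g0, Pred C f1 f2 g0 g1 ∧ TypeA C f1 f2 s g0 g1) ∪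
        (C.LC f1 f2).filter (fun g1 => ∃ g0, Pred C f1 f2 g0 g1 ∧ TypeB C f1 f2 s g0 g1)) := by
    intro g1 hg
    obtain ⟨h1, g0, hp, hc⟩ := mem_filter.1 hg
    simp only [Finset.mem_union, Finset.mem_biUnion]
    rcases break_cases hq hS hp hc with (h | h) | h | h | ⟨s, hs, h | h⟩
    · left; left; left; exact mem_filter.2 ⟨h1, g0, hp, h⟩
    · left; left; right; exact mem_filter.2 ⟨h1, h⟩
    · left; right; left; exact mem_filter.2 ⟨h1, g0, hp, h⟩
    · left; right; right; exact mem_filter.2 ⟨h1, g0, hp, h⟩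
    · grind
    grind
  have hb := Finset.card_le_card hsub
  have u1 : ∀ X Y : Finset Quad, (X ∪ Y).card ≤ X.card + Y.card := Finset.card_union_le
  have hbi : (S.biUnion (fun s =>
        (C.LC f1 f2).filter (fun g1 => ∃ g0, Pred C f1 f2 g0 g1 ∧ TypeA C f1 f2 s g0 g1) ∪
        (C.LC f1 f2).filter (fun g1 => ∃ g0, Pred C f1 f2 g0 g1 ∧ TypeB C f1 f2 s g0 g1))).card
        ≤ S.card * 24 := by
    refine Finset.card_biUnion_le_card_mul _ _ _ ?_
    intro s _
    refine (u1 _ _).trans ?_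
    have a := typeA_card (C := C) (f1 := f1) (f2 := f2) (s := s)
    have b := typeB_card (C := C) (f1 := f1) (f2 := f2) (s := s)
    omega
  have b1 := u1 ((BN0 C S f1 f2 ∪ NS C S f1 f2) ∪ (BW1 C S off q f1 f2 ∪
      BW2 C S off q f1 f2)) (S.biUnion (fun s =>
        (C.LC f1 f2).filter (fun g1 => ∃ g0, Pred C f1 f2 g0 g1 ∧ TypeA C f1 f2 s g0 g1) ∪
        (C.LC f1 f2).filter (fun g1 => ∃ g0, Pred C f1 f2 g0 g1 ∧ TypeB C f1 f2 s g0 g1)))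
  have b2 := u1 (BN0 C S f1 f2 ∪ NS C S f1 f2) (BW1 C S off q f1 f2 ∪ BW2 C S off q f1 f2)
  have b3 := u1 (BN0 C S f1 f2) (NS C S f1 f2)
  have b4 := u1 (BW1 C S off q f1 f2) (BW2 C S off q f1 f2)
  have b5 := BN0_le (C := C) (S := S) f1 f2
  omega
lemma sum_NS_le : ∑ p ∈ C.W ×ˢ C.W, (NS C S p.1 p.2).card ≤ ∑ s ∈ S, C.Deg s := by
  have h1 : ∑ p ∈ C.W ×ˢ C.W, (NS C S p.1 p.2).card ≤
      (C.LT.filter (fun t => Near C S t.1 t.2.1 t.2.2)).card := by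
    apply sum_card_le
    intro p _ g hg
    have := mem_filter.1 hg
    exact mem_filter.2 ⟨mem_LT.2 this.1, this.2⟩
  refine h1.trans ?_
  have h2 : C.LT.filter (fun t => Near C S t.1 t.2.1 t.2.2) ⊆ S.biUnion (fun s =>
      C.LT.filter (fun t => Nb C.ρ t.1 (C.u t.1 t.2.2) s ∨ Nb C.ρ t.2.1 (C.u t.2.1 t.2.2) s)) := by
    intro t ht
    obtain ⟨h2, s, hs, h3⟩ := mem_filter.1 ht
    grind
  refine (Finset.card_le_card h2).trans ?_
  exact card_biUnion_le
lemma wall_sum {G : ℕ} (sg : ℝ) (hG : ∀ f w, (f, w) ∈ C.H → (Gap C S sg f w).card ≤ G) :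
    ∑ f ∈ C.W, ∑ f' ∈ C.W, (C.B.filter (fun w => C.Wall S off q f w ∧
      ((f', w) ∈ C.H ∨ f' ∈ Gap C S sg f w))).card ≤ ∑ e ∈ C.WL S off q, (C.dg e.2 + G) := by
  have h1 : ∀ f ∈ C.W, ∑ f' ∈ C.W, (C.B.filter (fun w => C.Wall S off q f w ∧
      ((f', w) ∈ C.H ∨ f' ∈ Gap C S sg f w))).card ≤
      ∑ w ∈ C.B.filter (fun w => C.Wall S off q f w), (C.dg w + G) := by
    intro f _
    have : ∀ f', C.B.filter (fun w => C.Wall S off q f w ∧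
      ((f', w) ∈ C.H ∨ f' ∈ Gap C S sg f w)) = (C.B.filter (fun w => C.Wall S off q f w)).filter
        (fun w => (f', w) ∈ C.H ∨ f' ∈ Gap C S sg f w) := fun f' => by
      rw [Finset.filter_filter]
    simp only [this]
    simp only [card_filter _ (Finset.filter _ _)]
    rw [sum_comm]
    apply sum_le_sum
    intro w hw
    rw [← card_filter]
    have hw' := (mem_filter.1 hw).2
    refine le_trans (Finset.card_le_card (t := C.W.filter (fun f => (f, w) ∈ C.H) ∪
      Gap C S sg f w) ?_) ((Finset.card_union_le _ _).trans (Nat.add_le_add_left (hG f w hw'.1) _))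
    grind
  refine (sum_le_sum h1).trans (le_of_eq ?_)
  rw [Finset.sum_sigma']
  apply Finset.sum_bij (fun (x : Σ _ : Quad, Quad) _ => (x.1, x.2))
  · intro x hx
    obtain ⟨-, h⟩ := mem_sigma.1 hx
    have := (mem_filter.1 h).2
    exact mem_filter.2 this
  · grind
  · rintro ⟨a, b⟩ h
    have h := mem_filter.1 h
    have k := C.sub _ _ h.1
    exact ⟨⟨a, b⟩, mem_sigma.2 ⟨k.1, mem_filter.2 ⟨k.2, h⟩⟩, rfl⟩
  grind
theorem Nl_bound (hq : 0 < q) (hS : S ⊆ C.W) {G : ℕ}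
    (hG : ∀ f w, (f, w) ∈ C.H → (Gap C S 1 f w).card ≤ G)
    (hG' : ∀ f w, (f, w) ∈ C.H → (Gap C S (-1) f w).card ≤ G) :
    C.Nl S off q ≤ C.W.card ^ 2 * (1 + 24 * S.card) + 2 * ∑ s ∈ S, C.Deg s +
      2 * ∑ e ∈ C.WL S off q, (C.dg e.2 + G) := by
  have h1 : ∑ p ∈ C.W ×ˢ C.W, (1 + (C.BR S off q p.1 p.2).card) ≤
      ∑ p ∈ C.W ×ˢ C.W, ((1 + 24 * S.card) + 2 * (NS C S p.1 p.2).card +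
        (BW1 C S off q p.1 p.2).card + (BW2 C S off q p.1 p.2).card) := by
    apply sum_le_sum
    intro p _
    have := BR_le (off := off) hq hS p.1 p.2
    omega
  have h2 : ∑ p ∈ C.W ×ˢ C.W, (BW1 C S off q p.1 p.2).card ≤
      ∑ e ∈ C.WL S off q, (C.dg e.2 + G) := by
    refine le_trans ?_ (wall_sum 1 hG)
    rw [sum_product]
    exact sum_le_sum fun f _ => sum_le_sum fun f' _ => BW1_le f f'
  have h3 : ∑ p ∈ C.W ×ˢ C.W, (BW2 C S off q p.1 p.2).card ≤
      ∑ e ∈ C.WL S off q, (C.dg e.2 + G) := by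
    refine le_trans ?_ (wall_sum (-1) hG')
    rw [sum_product, sum_comm]
    exact sum_le_sum fun f _ => sum_le_sum fun f' _ => BW2_le f' f
  have h4 := sum_NS_le (C := C) (S := S)
  refine Nl_le_sum.trans (h1.trans ?_)
  rw [sum_add_distrib, sum_add_distrib, sum_add_distrib, ← mul_sum,
    sum_const, card_product, smul_eq_mul, ← pow_two]
  omega
end Cfg
lemma hit {α ι : Type*} (W : Finset α) (hW : W.Nonempty) (D : α → ℝ) (hD : ∀ a, 0 ≤ D a)
    (m : ℝ) (hm : m ≤ W.card) (X : ℝ) (hX : 0 ≤ X) (A : ι → Finset α) (k : ℕ) :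
    ∀ 𝒜 : Finset ι, (∀ i ∈ 𝒜, A i ⊆ W ∧ m ≤ (A i).card) →
    ∃ S ⊆ W, S.card ≤ k ∧ X * ((𝒜.filter (fun i => Disjoint (A i) S)).card : ℝ) + ∑ s ∈ S, D s ≤
      X * 𝒜.card * (1 - m / W.card) ^ k + k * ((∑ s ∈ W, D s) / W.card) := by
  have hWc : (0 : ℝ) < W.card := by exact_mod_cast hW.card_pos
  set θ : ℝ := 1 - m / W.card with hθ
  have hθ0 : 0 ≤ θ := by
    have : m / W.card ≤ 1 := by rw [div_le_one hWc]; exact hm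
    linarith
  induction k with
  | zero =>
    intro 𝒜 _
    refine ⟨∅, by simp, by simp, ?_⟩
    simp
  | succ k ih =>
    intro 𝒜 h𝒜
    have hav : ∃ s ∈ W, X * ((𝒜.filter (fun i => s ∉ A i)).card : ℝ) * θ ^ k + D s ≤
        X * 𝒜.card * θ ^ (k + 1) + (∑ s ∈ W, D s) / W.card := by
      apply exists_le_of_sum_le hW
      rw [sum_add_distrib, sum_const, nsmul_eq_mul, mul_add,
        mul_div_cancel₀ _ hWc.ne']
      have hc : ∑ s ∈ W, ((𝒜.filter (fun i => s ∉ A i)).card : ℝ) ≤ 𝒜.card * (W.card * θ) := by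
        have : ∑ s ∈ W, ((𝒜.filter (fun i => s ∉ A i)).card : ℝ) =
            ∑ i ∈ 𝒜, ((W.filter (fun s => s ∉ A i)).card : ℝ) := by
          simp only [card_filter, Nat.cast_sum]
          rw [sum_comm]
        rw [this, ← nsmul_eq_mul]
        apply sum_le_card_nsmul
        intro i hi
        obtain ⟨h1, h2⟩ := h𝒜 i hi
        have h3 : (W.filter (fun s => s ∉ A i)) = W \ A i := by
          ext x; simp
        have h4 : ((W \ A i).card : ℝ) = W.card - (A i).card := by
          rw [Finset.card_sdiff_of_subset h1, Nat.cast_sub (Finset.card_le_card h1)]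
        rw [h3, h4, hθ, mul_sub, mul_div_cancel₀ _ hWc.ne']
        linarith
      have h5 : ∑ s ∈ W, X * ((𝒜.filter (fun i => s ∉ A i)).card : ℝ) * θ ^ k =
          X * θ ^ k * ∑ s ∈ W, ((𝒜.filter (fun i => s ∉ A i)).card : ℝ) := by
        rw [mul_sum]; apply sum_congr rfl; intros; ring
      rw [h5]
      have h6 := mul_le_mul_of_nonneg_left hc (mul_nonneg hX (pow_nonneg hθ0 k))
      have h7 : X * θ ^ k * (𝒜.card * (W.card * θ)) = W.card * (X * 𝒜.card * θ ^ (k + 1)) := by ring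
      linarith
    obtain ⟨s, hs, hs2⟩ := hav
    obtain ⟨S, hS, hSk, hS2⟩ := ih (𝒜.filter (fun i => s ∉ A i))
      (fun i hi => h𝒜 i (mem_filter.1 hi).1)
    refine ⟨insert s S, Finset.insert_subset hs hS, (Finset.card_insert_le _ _).trans (by omega), ?_⟩
    have e1 : (𝒜.filter (fun i => Disjoint (A i) (insert s S))) =
        (𝒜.filter (fun i => s ∉ A i)).filter (fun i => Disjoint (A i) S) := by
      ext i; simp only [mem_filter, Finset.disjoint_insert_right]; tauto
    rw [e1]
    have e2 : ∑ x ∈ insert s S, D x ≤ D s + ∑ x ∈ S, D x := by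
      by_cases h : s ∈ S
      · rw [Finset.insert_eq_of_mem h]; linarith [hD s]
      · rw [Finset.sum_insert h]
    push_cast
    linarith
lemma hit_all {α ι : Type*} (W : Finset α) (hW : W.Nonempty) (D : α → ℝ) (hD : ∀ a, 0 ≤ D a)
    (m : ℝ) (hm : m ≤ W.card) (A : ι → Finset α) (k : ℕ)
    (𝒜 : Finset ι) (h𝒜 : ∀ i ∈ 𝒜, A i ⊆ W ∧ m ≤ (A i).card)
    (hk : (𝒜.card : ℝ) * (1 - m / W.card) ^ k ≤ 1 / 2) :
    ∃ S ⊆ W, S.card ≤ k ∧ (∀ i ∈ 𝒜, ¬ Disjoint (A i) S) ∧ ∑ s ∈ S, D s ≤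
      2 * k * ((∑ s ∈ W, D s) / W.card) + 1 := by
  set a := (k : ℝ) * ((∑ s ∈ W, D s) / W.card) with ha
  have ha0 : 0 ≤ a := by
    have := sum_nonneg (s := W) (fun s _ => hD s)
    positivity
  obtain ⟨S, h1, h2, h3⟩ := hit W hW D hD m hm (2 * a + 1) (by linarith) A k 𝒜 h𝒜
  rw [mul_assoc] at h3
  have h4 := mul_le_mul_of_nonneg_left hk (show 0 ≤ 2 * a + 1 by linarith)
  have hSD := sum_nonneg (s := S) (fun s _ => hD s)
  refine ⟨S, h1, h2, ?_, ?_⟩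
  · by_contra hc
    push Not at hc
    obtain ⟨i, hi, hd⟩ := hc
    have : (1 : ℝ) ≤ ((𝒜.filter (fun i => Disjoint (A i) S)).card : ℝ) := by
      have : 0 < (𝒜.filter (fun i => Disjoint (A i) S)).card :=
        card_pos.2 ⟨i, mem_filter.2 ⟨hi, hd⟩⟩
      exact_mod_cast this
    have := mul_le_mul_of_nonneg_left this (show 0 ≤ 2 * a + 1 by linarith)
    linarith
  nlinarith
namespace Cfg
variable {C : Cfg} {S : Finset Quad} {off q : ℕ}
def DP (C : Cfg) (sg : ℝ) (f w z : Quad) : Finset Quad :=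
  C.W.filter (fun y => Zset sg f w (C.u f w) y ∧ ¬ Nb C.ρ f (C.u f w) y ∧
    0 < th w (C.u f w) y ∧ th w (C.u f w) y ≤ th w (C.u f w) z)
def DM (C : Cfg) (sg : ℝ) (f w z : Quad) : Finset Quad :=
  C.W.filter (fun y => Zset sg f w (C.u f w) y ∧ ¬ Nb C.ρ f (C.u f w) y ∧
    th w (C.u f w) z ≤ th w (C.u f w) y ∧ th w (C.u f w) y ≤ 0)
lemma gap_bound {sg : ℝ} {f w : Quad} {m μ : ℕ} (hf : (f, w) ∈ C.H)
    (hμ : (C.W.filter (fun s => Nb C.ρ f (C.u f w) s)).card ≤ μ)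
    (h1 : ∀ z ∈ C.W, m ≤ (DP C sg f w z).card → ¬ Disjoint (DP C sg f w z) S)
    (h2 : ∀ z ∈ C.W, m ≤ (DM C sg f w z).card → ¬ Disjoint (DM C sg f w z) S) :
    (Gap C S sg f w).card ≤ 2 * m + μ := by
  set T := (Gap C S sg f w).filter (fun z => ¬ Nb C.ρ f (C.u f w) z)
  have hP : (T.filter (fun z => 0 < th w (C.u f w) z)).card ≤ m := by
    rcases (T.filter (fun z => 0 < th w (C.u f w) z)).eq_empty_or_nonempty with h | h
    · rw [h]; simp
    obtain ⟨z, hz, hmax⟩ := Finset.exists_max_image _ (th w (C.u f w)) h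
    obtain ⟨hz1, hz2⟩ := mem_filter.1 hz
    obtain ⟨hz3, hz4⟩ := mem_filter.1 hz1
    obtain ⟨hz5, hz6, hz7⟩ := mem_filter.1 hz3
    by_contra hc
    have hsub : T.filter (fun z => 0 < th w (C.u f w) z) ⊆ DP C sg f w z := by
      intro y hy
      have hm := hmax y hy
      obtain ⟨hy1, hy2⟩ := mem_filter.1 hy
      obtain ⟨hy3, hy4⟩ := mem_filter.1 hy1
      obtain ⟨hy5, hy6, -⟩ := mem_filter.1 hy3
      exact mem_filter.2 ⟨hy5, hy6, hy4, hy2, hm⟩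
    have := Finset.card_le_card hsub
    have := h1 z hz5 (by omega)
    rw [Finset.not_disjoint_iff] at this
    obtain ⟨s, hs, hsS⟩ := this
    obtain ⟨-, a1, a2, a3, a4⟩ := mem_filter.1 hs
    grind
  have hM : (T.filter (fun z => ¬ 0 < th w (C.u f w) z)).card ≤ m := by
    rcases (T.filter (fun z => ¬ 0 < th w (C.u f w) z)).eq_empty_or_nonempty with h | h
    · rw [h]; simp
    obtain ⟨z, hz, hmax⟩ := Finset.exists_min_image _ (th w (C.u f w)) h
    obtain ⟨hz1, hz2⟩ := mem_filter.1 hz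
    obtain ⟨hz3, hz4⟩ := mem_filter.1 hz1
    obtain ⟨hz5, hz6, hz7⟩ := mem_filter.1 hz3
    by_contra hc
    have hsub : T.filter (fun z => ¬ 0 < th w (C.u f w) z) ⊆ DM C sg f w z := by
      intro y hy
      have hm := hmax y hy
      obtain ⟨hy1, hy2⟩ := mem_filter.1 hy
      obtain ⟨hy3, hy4⟩ := mem_filter.1 hy1
      obtain ⟨hy5, hy6, -⟩ := mem_filter.1 hy3
      exact mem_filter.2 ⟨hy5, hy6, hy4, hm, not_lt.1 hy2⟩
    have := Finset.card_le_card hsub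
    have := h2 z hz5 (by omega)
    rw [Finset.not_disjoint_iff] at this
    obtain ⟨s, hs, hsS⟩ := this
    obtain ⟨-, a1, a2, a3, a4⟩ := mem_filter.1 hs
    grind
  have e1 := card_filter_add_card_filter_not (s := T) (fun z => 0 < th w (C.u f w) z)
  have e2 := card_filter_add_card_filter_not (s := Gap C S sg f w)
    (fun z => Nb C.ρ f (C.u f w) z)
  have e3 : ((Gap C S sg f w).filter (fun z => Nb C.ρ f (C.u f w) z)).card ≤ μ := by
    refine le_trans (Finset.card_le_card ?_) hμ
    intro z hz
    obtain ⟨a, b⟩ := mem_filter.1 hz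
    exact mem_filter.2 ⟨(mem_filter.1 a).1, b⟩
  linarith
lemma off_avg (S : Finset Quad) (hq : 0 < q) (wt : Quad × Quad → ℝ) (h0 : ∀ e, 0 ≤ wt e) :
    ∃ off, ∑ e ∈ C.WL S off q, wt e ≤ (∑ e ∈ C.H, wt e) / q := by
  have hqr : (0 : ℝ) < q := by exact_mod_cast hq
  have : ∃ off ∈ Finset.range q, ∑ e ∈ C.WL S off q, wt e ≤ (∑ e ∈ C.H, wt e) / q := by
    apply exists_le_of_sum_le (by grind)
    rw [sum_const, card_range, nsmul_eq_mul, mul_div_cancel₀ _ hqr.ne']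
    simp only [WL, sum_filter]
    rw [sum_comm]
    apply sum_le_sum
    intro e _
    rw [← sum_filter, sum_const, nsmul_eq_mul]
    have : ((Finset.range q).filter (fun off => (C.rank S e.1 e.2 + off) % q = 0)).card ≤ 1 := by
      rw [Finset.card_le_one]
      intro a ha b hb
      simp only [mem_filter, Finset.mem_range] at ha hb
      have h : (C.rank S e.1 e.2 + a) ≡ (C.rank S e.1 e.2 + b) [MOD q] := by
        unfold Nat.ModEq; rw [ha.2, hb.2]
      have h2 := Nat.ModEq.add_left_cancel' _ h
      exact Nat.ModEq.eq_of_lt_of_lt h2 ha.1 hb.1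
    have h3 : (((Finset.range q).filter (fun off => (C.rank S e.1 e.2 + off) % q = 0)).card : ℝ) ≤ 1 := by
      exact_mod_cast this
    nlinarith [h0 e]
  grind
lemma sum_Deg {μ : ℕ} (hμ : ∀ f g, (f, g) ∈ C.H →
    (C.W.filter (fun s => Nb C.ρ f (C.u f g) s)).card ≤ μ) :
    ∑ s ∈ C.W, C.Deg s ≤ C.LT.card * (2 * μ) := by
  simp only [Deg, card_filter]
  rw [sum_comm, ← smul_eq_mul]
  apply sum_le_card_nsmul
  rintro ⟨f1, f2, g⟩ ht
  have k := mem_LC.1 (mem_LT.1 ht)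
  rw [← card_filter, Finset.filter_or]
  grind
lemma DP_sub (sg : ℝ) (f w z : Quad) : DP C sg f w z ⊆ C.W := filter_subset _ _
lemma DM_sub (sg : ℝ) (f w z : Quad) : DM C sg f w z ⊆ C.W := filter_subset _ _
theorem Nl_main {μ m k : ℕ} (hq : 0 < q) (hW : C.W.Nonempty) (hm : m ≤ C.W.card)
    (hμ : ∀ f g, (f, g) ∈ C.H → (C.W.filter (fun s => Nb C.ρ f (C.u f g) s)).card ≤ μ)
    (hk : (4 * C.H.card * C.W.card : ℝ) * (1 - m / C.W.card) ^ k ≤ 1 / 2) :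
    ∃ S off, (C.Nl S off q : ℝ) ≤ C.W.card ^ 2 * (1 + 24 * k) +
      2 * (4 * k * μ * C.LT.card / C.W.card + 1) +
      2 * ((∑ e ∈ C.H, ((C.dg e.2 : ℝ) + (2 * m + μ))) / q) := by
  let sgn : Bool → ℝ := fun b => if b then 1 else -1
  let A : ((Quad × Quad) × Quad) × (Bool × Bool) → Finset Quad := fun i =>
    if i.2.2 then DP C (sgn i.2.1) i.1.1.1 i.1.1.2 i.1.2
    else DM C (sgn i.2.1) i.1.1.1 i.1.1.2 i.1.2
  let 𝒜 := ((C.H ×ˢ C.W) ×ˢ (Finset.univ : Finset (Bool × Bool))).filter (fun i => m ≤ (A i).card)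
  have hcard : (𝒜.card : ℝ) ≤ 4 * C.H.card * C.W.card := by
    have h1 : 𝒜.card ≤ (C.H.card * C.W.card) * 4 := by
      refine (Finset.card_filter_le _ _).trans ?_
      rw [card_product, card_product]; simp
    have : (𝒜.card : ℝ) ≤ (C.H.card * C.W.card) * 4 := by exact_mod_cast h1
    linarith
  have hWc : (0 : ℝ) < C.W.card := by exact_mod_cast hW.card_pos
  have hmr : (m : ℝ) ≤ C.W.card := by exact_mod_cast hm
  have hθ0 : (0 : ℝ) ≤ (1 - m / C.W.card) ^ k := by
    apply pow_nonneg
    have : (m : ℝ) / C.W.card ≤ 1 := by rw [div_le_one hWc]; exact hmr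
    linarith
  obtain ⟨S, hS, hSk, hhit, hD⟩ := hit_all C.W hW (fun s => (C.Deg s : ℝ)) (fun _ => by positivity)
    (m : ℝ) hmr A k 𝒜 (by
      intro i hi
      refine ⟨?_, by exact_mod_cast (mem_filter.1 hi).2⟩
      simp only [A]; split_ifs
      · exact DP_sub _ _ _ _
      · exact DM_sub _ _ _ _) (le_trans (mul_le_mul_of_nonneg_right hcard hθ0) hk)
  have hgap : ∀ b : Bool, ∀ f w, (f, w) ∈ C.H → (Gap C S (sgn b) f w).card ≤ 2 * m + μ := by
    intro b f w hfw
    apply gap_bound hfw (hμ f w hfw)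
    · intro z hz hmz
      exact hhit (((f, w), z), (b, true)) (mem_filter.2 ⟨by simp [hfw, hz], hmz⟩)
    · intro z hz hmz
      exact hhit (((f, w), z), (b, false)) (mem_filter.2 ⟨by simp [hfw, hz], hmz⟩)
  obtain ⟨off, hoff⟩ := off_avg (C := C) S hq (fun e => (C.dg e.2 : ℝ) + (2 * m + μ))
    (fun e => by positivity)
  refine ⟨S, off, ?_⟩
  have hN := Nl_bound (off := off) hq hS (G := 2 * m + μ) (hgap true) (hgap false)
  have hN' : (C.Nl S off q : ℝ) ≤ C.W.card ^ 2 * (1 + 24 * S.card) + 2 * ∑ s ∈ S, (C.Deg s : ℝ) +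
      2 * ∑ e ∈ C.WL S off q, ((C.dg e.2 : ℝ) + (2 * m + μ)) := by exact_mod_cast hN
  have hSk' : (S.card : ℝ) ≤ k := by exact_mod_cast hSk
  have hd : (∑ s ∈ C.W, (C.Deg s : ℝ)) ≤ C.LT.card * (2 * μ) := by exact_mod_cast sum_Deg hμ
  have h1 : (C.W.card : ℝ) ^ 2 * (1 + 24 * S.card) ≤ C.W.card ^ 2 * (1 + 24 * k) := by gcongr
  have h2 : 2 * (k : ℝ) * ((∑ s ∈ C.W, (C.Deg s : ℝ)) / C.W.card) ≤
      4 * k * μ * C.LT.card / C.W.card := by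
    rw [← mul_div_assoc]
    apply div_le_div_of_nonneg_right _ hWc.le
    have := mul_le_mul_of_nonneg_left hd (show (0 : ℝ) ≤ 2 * k by positivity)
    linarith
  linarith
lemma triples : ∑ e ∈ C.H, C.dg e.2 = 2 * C.LT.card + C.H.card := by
  have hT : ∑ e ∈ C.H, C.dg e.2 = (C.W ×ˢ C.W ×ˢ C.B |>.filter
      (fun t => (t.1, t.2.2) ∈ C.H ∧ (t.2.1, t.2.2) ∈ C.H)).card := by
    simp only [dg]
    rw [← card_sigma]
    apply Finset.card_bij (fun (x : (Σ _ : Quad × Quad, Quad)) _ => (x.1.1, x.2, x.1.2))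
    · rintro ⟨⟨f, g⟩, f'⟩ hx
      simp only [mem_sigma, mem_filter] at hx
      have k := C.sub _ _ hx.1
      simp [hx, k]
    · grind
    · rintro ⟨a, b, c⟩ h
      simp only [mem_filter, mem_product] at h
      exact ⟨⟨(a, c), b⟩, by simp [h], rfl⟩
  have hU : (C.W ×ˢ C.W ×ˢ C.B |>.filter
      (fun t => (t.1, t.2.2) ∈ C.H ∧ (t.2.1, t.2.2) ∈ C.H)) =
      (C.LT ∪ C.LT.image (fun t => (t.2.1, t.1, t.2.2))) ∪ C.H.image (fun e => (e.1, e.1, e.2)) := by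
    ext ⟨a, b, c⟩
    simp only [Finset.mem_union, Finset.mem_image, mem_filter, mem_product]
    constructor
    · rintro ⟨-, h1, h2⟩
      rcases eq_or_ne a b with rfl | hab
      · grind
      · left
        have hs := C.sepg _ _ _ h1 h2 hab
        rcases lt_trichotomy (C.u a c) (C.u b c) with h | h | h
        · left; exact mem_LT.2 (mem_LC.2 ⟨h1, h2, h⟩)
        · rw [h] at hs; simp at hs; linarith [C.hρ]
        · right; exact ⟨(b, a, c), mem_LT.2 (mem_LC.2 ⟨h2, h1, h⟩), rfl⟩
    · rintro ((h | ⟨⟨x, y, z⟩, h, he⟩) | ⟨⟨x, y⟩, h, he⟩)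
      · have k := mem_LC.1 (mem_LT.1 h)
        exact ⟨⟨(C.sub _ _ k.1).1, (C.sub _ _ k.2.1).1, (C.sub _ _ k.1).2⟩, k.1, k.2.1⟩
      · simp only [Prod.mk.injEq] at he
        obtain ⟨rfl, rfl, rfl⟩ := he
        have k := mem_LC.1 (mem_LT.1 h)
        exact ⟨⟨(C.sub _ _ k.2.1).1, (C.sub _ _ k.1).1, (C.sub _ _ k.1).2⟩, k.2.1, k.1⟩
      · simp only [Prod.mk.injEq] at he
        obtain ⟨rfl, rfl, rfl⟩ := he
        exact ⟨⟨(C.sub _ _ h).1, (C.sub _ _ h).1, (C.sub _ _ h).2⟩, h, h⟩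
  rw [hT, hU, card_union_of_disjoint, card_union_of_disjoint, Finset.card_image_of_injective,
    Finset.card_image_of_injective]
  · ring
  · rintro ⟨a, b⟩ ⟨a', b'⟩ h
    grind
  · rintro ⟨a, b, c⟩ ⟨a', b', c'⟩ h
    grind
  · rw [Finset.disjoint_left]
    rintro ⟨a, b, c⟩ h h'
    obtain ⟨⟨x, y, z⟩, h2, he⟩ := Finset.mem_image.1 h'
    simp only [Prod.mk.injEq] at he
    obtain ⟨rfl, rfl, rfl⟩ := he
    have k := mem_LC.1 (mem_LT.1 h)
    have k' := mem_LC.1 (mem_LT.1 h2)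
    linarith
  · rw [Finset.disjoint_left]
    rintro ⟨a, b, c⟩ h h'
    obtain ⟨⟨x, z⟩, h', he⟩ := Finset.mem_image.1 h'
    simp only [Prod.mk.injEq] at he
    obtain ⟨rfl, rfl, rfl⟩ := he
    rcases Finset.mem_union.1 h with h | h
    · exact LC_ne (mem_LT.1 h) rfl
    · obtain ⟨⟨x', y, z'⟩, h2, he⟩ := Finset.mem_image.1 h
      simp only [Prod.mk.injEq] at he
      obtain ⟨rfl, rfl, rfl⟩ := he
      exact LC_ne (mem_LT.1 h2) rfl
end Cfg
lemma psd_key {α β : Type*} [DecidableEq β] (L : Finset α) (κ : α → β) (a : α → ℝ) :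
    0 ≤ ∑ x ∈ L, ∑ x' ∈ L, (if κ x = κ x' then a x * a x' else 0) := by
  have h : ∑ x ∈ L, ∑ x' ∈ L, (if κ x = κ x' then a x * a x' else 0) =
      ∑ y ∈ L.image κ, (∑ x ∈ L, if κ x = y then a x else 0) ^ 2 := by
    simp only [pow_two, sum_mul_sum]
    rw [Finset.sum_comm' (s := L.image κ) (t := fun _ => L) (t' := L) (s' := fun _ => L.image κ)
      (by intros; tauto)]
    apply sum_congr rfl
    intro x hx
    rw [sum_comm]
    apply sum_congr rfl
    intro x' hx'
    rw [Finset.sum_eq_single (κ x)]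
    · grind
    · grind
    grind
  rw [h]
  positivity
lemma cs_pairs {α β : Type*} [DecidableEq β] (T : Finset α) (K : α → β) :
    (T.card : ℝ) ^ 2 ≤ (T.image K).card *
      (((T ×ˢ T).filter (fun x => K x.1 = K x.2)).card : ℝ) := by
  have h1 : ((((T ×ˢ T).filter (fun x => K x.1 = K x.2)).card : ℕ) : ℝ) =
      ∑ y ∈ T.image K, ((T.filter (fun x => K x = y)).card : ℝ) ^ 2 := by
    rw [card_eq_sum_card_fiberwise (f := fun x : α × α => K x.1) (t := T.image K)]
    · push_cast
      apply sum_congr rfl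
      intro y _
      rw [pow_two, ← Nat.cast_mul, ← card_product]
      congr 2
      grind
    · intro x hx
      grind
  have h2 : (T.card : ℝ) = ∑ y ∈ T.image K, ((T.filter (fun x => K x = y)).card : ℝ) := by
    rw [card_eq_sum_card_fiberwise (f := K) (t := T.image K)]
    · push_cast; rfl
    · intro x hx; exact Finset.mem_image_of_mem K hx
  rw [h1, h2]
  exact sq_sum_le_card_mul_sum_sq
namespace Cfg
variable (C : Cfg) (S : Finset Quad) (off q : ℕ) (β : ℝ → ℤ)
def vv (f g g' : Quad) : ℝ :=
  if (f, g) ∈ C.H ∧ (f, g') ∈ C.H ∧ C.cls S off q f g = C.cls S off q f g' ∧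
    β (C.u f g) = β (C.u f g') then
    (if C.u f g < C.u f g' then 1 else if C.u f g' < C.u f g then -1 else 0) else 0
def kap (f1 f2 g : Quad) : ((Finset Quad × ℕ) × (Finset Quad × ℕ)) × (ℤ × ℤ) :=
  (C.key2 S off q f1 f2 g, (β (C.u f1 g), β (C.u f2 g)))
def Co (f1 f2 : Quad) : Finset Quad := C.B.filter (fun g => (f1, g) ∈ C.H ∧ (f2, g) ∈ C.H)
def NN (f1 f2 : Quad) : Finset (Quad × Quad) :=
  (C.LC f1 f2 ×ˢ C.LC f1 f2).filter (fun x => β (C.u f1 x.1) < β (C.u f2 x.1) ∧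
    C.kap S off q β f1 f2 x.1 = C.kap S off q β f1 f2 x.2)
def tt (f1 f2 g : Quad) : ℝ := if C.u f1 g < C.u f2 g then 1 else -1
variable {C S off q β}
lemma tt_sq (f1 f2 g : Quad) : C.tt f1 f2 g * C.tt f1 f2 g = 1 := by
  unfold tt; split_ifs <;> norm_num
lemma kap_iff {f1 f2 g g' : Quad} : C.kap S off q β f1 f2 g = C.kap S off q β f1 f2 g' ↔
    (C.cls S off q f1 g = C.cls S off q f1 g' ∧ β (C.u f1 g) = β (C.u f1 g')) ∧
    (C.cls S off q f2 g = C.cls S off q f2 g' ∧ β (C.u f2 g) = β (C.u f2 g')) := by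
  simp only [kap, key2, Prod.mk.injEq]; tauto
lemma T_ge (hβ : Monotone β) (f1 f2 : Quad) : ((C.NN S off q β f1 f2).card : ℝ) ≤
    ∑ g ∈ C.Co f1 f2, ∑ g' ∈ C.Co f1 f2, (if C.kap S off q β f1 f2 g = C.kap S off q β f1 f2 g' then
      C.tt f1 f2 g * C.tt f1 f2 g' else 0) := by
  let b : Quad → ℝ := fun g => if β (C.u f1 g) < β (C.u f2 g) then 0 else C.tt f1 f2 g
  let a : Quad → ℝ := fun g => if β (C.u f1 g) < β (C.u f2 g) then 1 else 0
  have hpt : ∀ g g', (if C.kap S off q β f1 f2 g = C.kap S off q β f1 f2 g' then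
      C.tt f1 f2 g * C.tt f1 f2 g' else 0) =
      (if C.kap S off q β f1 f2 g = C.kap S off q β f1 f2 g' then a g * a g' else 0) +
      (if C.kap S off q β f1 f2 g = C.kap S off q β f1 f2 g' then b g * b g' else 0) := by
    intro g g'
    by_cases h : C.kap S off q β f1 f2 g = C.kap S off q β f1 f2 g'
    · rw [if_pos h, if_pos h, if_pos h]
      have h' := kap_iff.1 h
      have e : β (C.u f1 g) < β (C.u f2 g) ↔ β (C.u f1 g') < β (C.u f2 g') := by
        grind
      by_cases hl : β (C.u f1 g) < β (C.u f2 g)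
      · have hl' := e.1 hl
        have u1 := hβ.reflect_lt hl
        have u2 := hβ.reflect_lt hl'
        simp [a, b, hl, hl', tt, u1, u2]
      grind
    · simp [h]
  simp only [hpt, sum_add_distrib]
  have h0 := psd_key (C.Co f1 f2) (C.kap S off q β f1 f2) b
  have h1 : ((C.NN S off q β f1 f2).card : ℝ) ≤ ∑ g ∈ C.Co f1 f2, ∑ g' ∈ C.Co f1 f2,
      (if C.kap S off q β f1 f2 g = C.kap S off q β f1 f2 g' then a g * a g' else 0) := by
    rw [← sum_product' (f := fun g g' =>
      (if C.kap S off q β f1 f2 g = C.kap S off q β f1 f2 g' then a g * a g' else 0))]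
    have hsub : C.NN S off q β f1 f2 ⊆ C.Co f1 f2 ×ˢ C.Co f1 f2 := by
      rintro ⟨x, y⟩ hx
      obtain ⟨h1, -⟩ := mem_filter.1 hx
      obtain ⟨h1, h2⟩ := mem_product.1 h1
      have k1 := mem_LC.1 h1
      have k2 := mem_LC.1 h2
      exact mem_product.2 ⟨mem_filter.2 ⟨(C.sub _ _ k1.1).2, k1.1, k1.2.1⟩,
        mem_filter.2 ⟨(C.sub _ _ k2.1).2, k2.1, k2.2.1⟩⟩
    refine le_trans ?_ (sum_le_sum_of_subset_of_nonneg hsub ?_)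
    · rw [card_eq_sum_ones]
      push_cast
      apply sum_le_sum
      rintro ⟨x, y⟩ hx
      obtain ⟨-, h1, h2⟩ := mem_filter.1 hx
      simp only at h1 h2
      have h' := kap_iff.1 h2
      grind
    · intro x _ _
      simp only [a]
      split_ifs <;> norm_num
  linarith
lemma LC_nest_iff {f1 f2 g g' : Quad} (h : g ∈ C.LC f1 f2) (h' : g' ∈ C.LC f1 f2) (hne : g ≠ g') :
    (C.u f1 g < C.u f1 g' ∧ C.u f2 g' < C.u f2 g) ∨ (C.u f1 g' < C.u f1 g ∧ C.u f2 g < C.u f2 g') := by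
  have hρ := C.hρ
  rcases lt_trichotomy (C.u f1 g) (C.u f1 g') with hl | hl | hl
  · left; exact ⟨hl, by linarith [LC_nest h h' hl]⟩
  · exact absurd (u_inj (mem_LC.1 h).1 (mem_LC.1 h').1 hl) hne
  · right; exact ⟨hl, by linarith [LC_nest h' h hl]⟩
lemma vv_abs (f g g' : Quad) : |C.vv S off q β f g g'| ≤ 1 := by
  unfold vv; split_ifs <;> norm_num
lemma off_diag {f1 f2 : Quad} (hf : f1 ≠ f2) {g g' : Quad} (hg : g ∈ C.Co f1 f2)
    (hg' : g' ∈ C.Co f1 f2) :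
    C.vv S off q β f1 g g' * C.vv S off q β f2 g g' ≤ (if g = g' then 1 else 0) -
      (if C.kap S off q β f1 f2 g = C.kap S off q β f1 f2 g' then
        C.tt f1 f2 g * C.tt f1 f2 g' else 0) := by
  obtain ⟨-, a1, a2⟩ := mem_filter.1 hg
  obtain ⟨-, b1, b2⟩ := mem_filter.1 hg'
  by_cases h : g = g'
  · subst h
    have : C.vv S off q β f1 g g = 0 := by simp [vv]
    simp [this, tt_sq]
  rw [if_neg h]
  by_cases hk : C.kap S off q β f1 f2 g = C.kap S off q β f1 f2 g'
  · rw [if_pos hk]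
    have hk' := kap_iff.1 hk
    have typ : ∀ {x}, (f1, x) ∈ C.H → (f2, x) ∈ C.H → x ∈ C.LC f1 f2 ∨ x ∈ C.LC f2 f1 := by
      intro x h1 h2
      have hs := C.sepg _ _ _ h1 h2 hf
      rcases lt_trichotomy (C.u f1 x) (C.u f2 x) with h | h | h
      · left; exact mem_LC.2 ⟨h1, h2, h⟩
      · rw [h] at hs; simp at hs; linarith [C.hρ]
      · right; exact mem_LC.2 ⟨h2, h1, h⟩
    have ub : C.vv S off q β f1 g g' * C.vv S off q β f2 g g' ≤ 1 := by
      have := abs_mul (C.vv S off q β f1 g g') (C.vv S off q β f2 g g')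
      have h3 := mul_le_mul (vv_abs (C := C) (S := S) (off := off) (q := q) (β := β) f1 g g')
        (vv_abs (C := C) (S := S) (off := off) (q := q) (β := β) f2 g g') (abs_nonneg _) zero_le_one
      grind
    rcases typ a1 a2 with t1 | t1 <;> rcases typ b1 b2 with t2 | t2
    · have c1 := (mem_LC.1 t1).2.2
      have c2 := (mem_LC.1 t2).2.2
      rcases LC_nest_iff t1 t2 h with ⟨n1, n2⟩ | ⟨n1, n2⟩
      · simp [vv, a1, a2, b1, b2, hk', n1, n2, n2.le, not_lt.2 n2.le, tt, c1, c2]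
      · simp [vv, a1, a2, b1, b2, hk', n1, n2, n2.le, not_lt.2 n1.le, tt, c1, c2]
    · have c1 := (mem_LC.1 t1).2.2
      have c2 := (mem_LC.1 t2).2.2
      refine ub.trans ?_
      simp [tt, c1, not_lt.2 c2.le]
    · have c1 := (mem_LC.1 t1).2.2
      have c2 := (mem_LC.1 t2).2.2
      refine ub.trans ?_
      simp [tt, c2, not_lt.2 c1.le]
    · have c1 := (mem_LC.1 t1).2.2
      have c2 := (mem_LC.1 t2).2.2
      rcases LC_nest_iff t1 t2 h with ⟨n1, n2⟩ | ⟨n1, n2⟩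
      · simp [vv, a1, a2, b1, b2, hk', n1, n2, not_lt.2 n2.le, tt, not_lt.2 c1.le, not_lt.2 c2.le]
      · simp [vv, a1, a2, b1, b2, hk', n1, n2, not_lt.2 n1.le, tt, not_lt.2 c1.le, not_lt.2 c2.le]
  · rw [if_neg hk]
    have : C.vv S off q β f1 g g' * C.vv S off q β f2 g g' = 0 := by
      by_contra hc
      have h1 := left_ne_zero_of_mul hc
      have h2 := right_ne_zero_of_mul hc
      apply hk
      rw [kap_iff]
      constructor
      · by_contra hx
        apply h1; unfold vv; rw [if_neg]; tauto
      · by_contra hx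
        apply h2; unfold vv; rw [if_neg]; tauto
    linarith
lemma pair_sum {f1 f2 : Quad} (hβ : Monotone β) (hf : f1 ≠ f2) :
    ∑ g ∈ C.B, ∑ g' ∈ C.B, C.vv S off q β f1 g g' * C.vv S off q β f2 g g' ≤
      (C.Co f1 f2).card - ((C.NN S off q β f1 f2).card : ℝ) := by
  have hz : ∀ g g', ¬ (g ∈ C.Co f1 f2 ∧ g' ∈ C.Co f1 f2) →
      C.vv S off q β f1 g g' * C.vv S off q β f2 g g' = 0 := by
    intro g g' h
    by_contra hc
    have h1 := left_ne_zero_of_mul hc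
    have h2 := right_ne_zero_of_mul hc
    apply h
    have k1 : (f1, g) ∈ C.H ∧ (f1, g') ∈ C.H := by
      by_contra hx; apply h1; unfold vv; rw [if_neg]; tauto
    have k2 : (f2, g) ∈ C.H ∧ (f2, g') ∈ C.H := by
      by_contra hx; apply h2; unfold vv; rw [if_neg]; tauto
    exact ⟨mem_filter.2 ⟨(C.sub _ _ k1.1).2, k1.1, k2.1⟩,
      mem_filter.2 ⟨(C.sub _ _ k1.2).2, k1.2, k2.2⟩⟩
  have hsub : C.Co f1 f2 ⊆ C.B := filter_subset _ _
  have e1 : ∑ g ∈ C.B, ∑ g' ∈ C.B, C.vv S off q β f1 g g' * C.vv S off q β f2 g g' =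
      ∑ g ∈ C.Co f1 f2, ∑ g' ∈ C.Co f1 f2, C.vv S off q β f1 g g' * C.vv S off q β f2 g g' := by
    symm
    rw [← sum_subset hsub]
    · apply sum_congr rfl
      intro g _
      apply sum_subset hsub
      grind
    · intro g _ h
      apply Finset.sum_eq_zero
      grind
  rw [e1]
  have h2 := T_ge (C := C) (S := S) (off := off) (q := q) hβ f1 f2
  have h3 : ∑ g ∈ C.Co f1 f2, ∑ g' ∈ C.Co f1 f2, C.vv S off q β f1 g g' * C.vv S off q β f2 g g' ≤
      ∑ g ∈ C.Co f1 f2, ∑ g' ∈ C.Co f1 f2, ((if g = g' then 1 else 0) -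
      (if C.kap S off q β f1 f2 g = C.kap S off q β f1 f2 g' then
        C.tt f1 f2 g * C.tt f1 f2 g' else 0)) :=
    sum_le_sum fun g hg => sum_le_sum fun g' hg' => off_diag hf hg hg'
  simp only [sum_sub_distrib] at h3
  have h4 : ∑ g ∈ C.Co f1 f2, ∑ g' ∈ C.Co f1 f2, (if g = g' then (1 : ℝ) else 0) =
      (C.Co f1 f2).card := by
    simp
  linarith
lemma sum_H {M : Type*} [AddCommMonoid M] (F : Quad × Quad → M) :
    ∑ e ∈ C.H, F e = ∑ f ∈ C.W, ∑ g ∈ C.B, if (f, g) ∈ C.H then F (f, g) else 0 := by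
  rw [← sum_product' (f := fun f g => if (f, g) ∈ C.H then F (f, g) else 0),
    ← sum_filter]
  congr 1
  ext ⟨f, g⟩
  simp only [mem_filter, mem_product]
  constructor
  · intro h; exact ⟨C.sub _ _ h, h⟩
  grind
lemma sum_Co : ∑ f1 ∈ C.W, ∑ f2 ∈ C.W, (C.Co f1 f2).card = 2 * C.LT.card + C.H.card := by
  rw [← triples, sum_H]
  apply sum_congr rfl
  intro f1 _
  simp only [Co, card_filter]
  rw [sum_comm]
  apply sum_congr rfl
  intro g _
  by_cases h : (f1, g) ∈ C.H
  · simp only [h, true_and, if_true, dg]; rw [card_filter]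
  · simp [h]
lemma diag_sum (hq : 0 < q) :
    ∑ f ∈ C.W, ∑ g ∈ C.B, ∑ g' ∈ C.B, C.vv S off q β f g g' * C.vv S off q β f g g' ≤
      C.H.card * q := by
  have : (C.H.card * q : ℝ) = ∑ e ∈ C.H, (q : ℝ) := by simp
  rw [this, sum_H]
  apply sum_le_sum
  intro f _
  apply sum_le_sum
  intro g _
  have h1 : ∀ g', C.vv S off q β f g g' * C.vv S off q β f g g' ≤
      if (f, g) ∈ C.H ∧ (f, g') ∈ C.H ∧ C.cls S off q f g' = C.cls S off q f g then 1 else 0 := by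
    intro g'
    by_cases h : (f, g) ∈ C.H ∧ (f, g') ∈ C.H ∧ C.cls S off q f g' = C.cls S off q f g
    · rw [if_pos h]
      have := vv_abs (C := C) (S := S) (off := off) (q := q) (β := β) f g g'
      nlinarith [abs_le.1 this]
    · rw [if_neg h]
      have : C.vv S off q β f g g' = 0 := by
        unfold vv; grind
      simp [this]
  refine (sum_le_sum fun g' _ => h1 g').trans ?_
  by_cases h : (f, g) ∈ C.H
  · have h2 := cls_card (C := C) (S := S) (off := off) hq f g
    rw [card_filter] at h2
    have h3 : (∑ g' ∈ C.B, if (f, g') ∈ C.H ∧ C.cls S off q f g' = C.cls S off q f g then (1 : ℝ)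
      else 0) ≤ q := by exact_mod_cast h2
    simpa [h] using h3
  · simp [h]
theorem level_bound (hq : 0 < q) (hβ : Monotone β) :
    ∑ f1 ∈ C.W, ∑ f2 ∈ C.W, ((C.NN S off q β f1 f2).card : ℝ) ≤
      2 * C.LT.card + C.H.card * (q + 1) := by
  have h0 : 0 ≤ ∑ g ∈ C.B, ∑ g' ∈ C.B, (∑ f ∈ C.W, C.vv S off q β f g g') ^ 2 := by positivity
  have h1 : ∑ g ∈ C.B, ∑ g' ∈ C.B, (∑ f ∈ C.W, C.vv S off q β f g g') ^ 2 =
      ∑ f1 ∈ C.W, ∑ f2 ∈ C.W, ∑ g ∈ C.B, ∑ g' ∈ C.B,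
        C.vv S off q β f1 g g' * C.vv S off q β f2 g g' := by
    simp only [pow_two, sum_mul_sum]
    have a1 : ∀ g ∈ C.B, ∑ g' ∈ C.B, ∑ f1 ∈ C.W, ∑ f2 ∈ C.W,
        C.vv S off q β f1 g g' * C.vv S off q β f2 g g' = ∑ f1 ∈ C.W, ∑ f2 ∈ C.W, ∑ g' ∈ C.B,
        C.vv S off q β f1 g g' * C.vv S off q β f2 g g' := by
      intro g _
      rw [sum_comm]
      exact sum_congr rfl fun f1 _ => sum_comm
    rw [sum_congr rfl a1, sum_comm]
    exact sum_congr rfl fun f1 _ => sum_comm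
  rw [h1] at h0
  have h2 : ∀ f1 ∈ C.W, ∀ f2 ∈ C.W, ∑ g ∈ C.B, ∑ g' ∈ C.B,
        C.vv S off q β f1 g g' * C.vv S off q β f2 g g' ≤
      ((C.Co f1 f2).card - ((C.NN S off q β f1 f2).card : ℝ)) +
      (if f1 = f2 then ∑ g ∈ C.B, ∑ g' ∈ C.B,
        C.vv S off q β f1 g g' * C.vv S off q β f1 g g' else 0) := by
    intro f1 _ f2 _
    by_cases h : f1 = f2
    · subst h
      have : C.NN S off q β f1 f1 = ∅ := by
        unfold NN
        grind
      rw [this]; simp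
    · rw [if_neg h, add_zero]
      exact pair_sum hβ h
  have h3 := sum_le_sum fun f1 h1 => sum_le_sum fun f2 hh2 => h2 f1 h1 f2 hh2
  simp only [sum_add_distrib, sum_sub_distrib] at h3
  have h4 : ∑ f1 ∈ C.W, ∑ f2 ∈ C.W, (if f1 = f2 then ∑ g ∈ C.B, ∑ g' ∈ C.B,
        C.vv S off q β f1 g g' * C.vv S off q β f1 g g' else 0) =
        ∑ f1 ∈ C.W, ∑ g ∈ C.B, ∑ g' ∈ C.B,
        C.vv S off q β f1 g g' * C.vv S off q β f1 g g' := by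
    apply sum_congr rfl
    intro f hf
    rw [Finset.sum_ite_eq, if_pos hf]
  rw [h4] at h3
  have h5 := diag_sum (C := C) (S := S) (off := off) (β := β) hq
  have h6 : ∑ f1 ∈ C.W, ∑ f2 ∈ C.W, ((C.Co f1 f2).card : ℝ) = 2 * C.LT.card + C.H.card := by
    exact_mod_cast sum_Co
  linarith
def blk (l : ℕ) (x : ℝ) : ℤ := ⌊2 ^ l * ((x + 2) / 5)⌋
lemma blk_mono (l : ℕ) : Monotone (blk l) := by
  intro x y h
  apply Int.floor_le_floor
  gcongr
lemma blk_succ (l : ℕ) (x : ℝ) : blk (l + 1) x = 2 * blk l x ∨ blk (l + 1) x = 2 * blk l x + 1 := by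
  have e : blk (l + 1) x = ⌊2 * (2 ^ l * ((x + 2) / 5))⌋ := by
    unfold blk; congr 1; ring
  rw [e]; unfold blk
  set y := (2 : ℝ) ^ l * ((x + 2) / 5)
  have h1 := Int.floor_le y
  have h2 := Int.lt_floor_add_one y
  have h3 := Int.floor_le (2 * y)
  have h4 := Int.lt_floor_add_one (2 * y)
  have h5 : 2 * ⌊y⌋ < ⌊2 * y⌋ + 1 := by exact_mod_cast (show (2 * ⌊y⌋ : ℝ) < ⌊2 * y⌋ + 1 by linarith)
  have h6 : ⌊2 * y⌋ < 2 * ⌊y⌋ + 2 := by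
    exact_mod_cast (show (⌊2 * y⌋ : ℝ) < 2 * ⌊y⌋ + 2 by linarith)
  omega
lemma blk_zero {x : ℝ} (h : |x| ≤ 2) : blk 0 x = 0 := by
  unfold blk
  rw [Int.floor_eq_zero_iff]
  grind
lemma blk_lt {Lv : ℕ} {ρ x y : ℝ} (hLv : 5 ≤ 2 ^ Lv * ρ) (h : x + ρ ≤ y) : blk Lv x < blk Lv y := by
  unfold blk
  have : (2 : ℝ) ^ Lv * ((x + 2) / 5) + 1 ≤ 2 ^ Lv * ((y + 2) / 5) := by
    have := mul_le_mul_of_nonneg_left h (show (0 : ℝ) ≤ 2 ^ Lv by positivity)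
    linarith
  have h2 := Int.floor_le_floor this
  rw [Int.floor_add_one] at h2
  omega
lemma lev_exists {Lv : ℕ} (hLv : 5 ≤ 2 ^ Lv * C.ρ) {f1 f2 g : Quad} (h : g ∈ C.LC f1 f2) :
    ∃ l < Lv, blk l (C.u f1 g) = blk l (C.u f2 g) ∧ blk (l + 1) (C.u f1 g) < blk (l + 1) (C.u f2 g) := by
  have k := mem_LC.1 h
  have h0 : blk 0 (C.u f1 g) = blk 0 (C.u f2 g) := by
    rw [blk_zero (C.rng _ _ k.1), blk_zero (C.rng _ _ k.2.1)]
  have h1 := blk_lt hLv (LC_gap h)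
  have hex : ∃ l, blk l (C.u f1 g) ≠ blk l (C.u f2 g) := ⟨Lv, h1.ne⟩
  have hs := Nat.find_spec hex
  have hle : Nat.find hex ≤ Lv := Nat.find_min' hex h1.ne
  have hpos : Nat.find hex ≠ 0 := by
    grind
  obtain ⟨l, hl⟩ := Nat.exists_eq_succ_of_ne_zero hpos
  have hmin := Nat.find_min hex (m := l) (by omega)
  push Not at hmin
  rw [hl] at hs
  exact ⟨l, by omega, hmin, lt_of_le_of_ne (blk_mono _ k.2.2.le) hs⟩
theorem LT_sq (hq : 0 < q) {Lv : ℕ} (hLv : 5 ≤ 2 ^ Lv * C.ρ) :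
    (C.LT.card : ℝ) ^ 2 ≤ (Lv * C.Nl S off q) *
      (Lv * (2 * C.LT.card + C.H.card * (q + 1))) := by
  have hl : ∀ t ∈ C.LT, ∃ l < Lv, blk l (C.u t.1 t.2.2) = blk l (C.u t.2.1 t.2.2) ∧
      blk (l + 1) (C.u t.1 t.2.2) < blk (l + 1) (C.u t.2.1 t.2.2) := by
    rintro ⟨f1, f2, g⟩ ht
    exact lev_exists hLv (mem_LT.1 ht)
  choose! lam hl1 hl2 hl3 using hl
  let K : Quad × Quad × Quad → ℕ × (Quad × Quad × ((Finset Quad × ℕ) × (Finset Quad × ℕ))) :=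
    fun t => (lam t, (t.1, t.2.1, C.key2 S off q t.1 t.2.1 t.2.2))
  have hcs := cs_pairs C.LT K
  have him : ((C.LT.image K).card : ℝ) ≤ Lv * C.Nl S off q := by
    have : C.LT.image K ⊆ Finset.range Lv ×ˢ
        (C.LT.image (fun t => (t.1, t.2.1, C.key2 S off q t.1 t.2.1 t.2.2))) := by
      grind
    have := Finset.card_le_card this
    rw [card_product, card_range] at this
    exact_mod_cast this
  have hpairs : (((C.LT ×ˢ C.LT).filter (fun x => K x.1 = K x.2)).card : ℝ) ≤
      Lv * (2 * C.LT.card + C.H.card * (q + 1)) := by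
    have h1 : ((C.LT ×ˢ C.LT).filter (fun x => K x.1 = K x.2)).card ≤
        ∑ l ∈ Finset.range Lv, ∑ f1 ∈ C.W, ∑ f2 ∈ C.W, (C.NN S off q (blk (l + 1)) f1 f2).card := by
      simp only [← card_sigma]
      apply card_le_card_of_injOn (fun x => (⟨lam x.1, x.1.1, x.1.2.1, (x.1.2.2, x.2.2.2)⟩ :
        (Σ _ : ℕ, Σ _ : Quad, Σ _ : Quad, Quad × Quad)))
      · rintro ⟨⟨f1, f2, g⟩, ⟨f1', f2', g'⟩⟩ hx
        obtain ⟨h1, h2⟩ := mem_filter.1 hx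
        obtain ⟨h1, h1'⟩ := mem_product.1 h1
        simp only [K, Prod.mk.injEq] at h2
        obtain ⟨e1, rfl, rfl, e2⟩ := h2
        simp only at h1 h1'
        have L1 := mem_LT.1 h1
        have L2 := mem_LT.1 h1'
        have k1 := mem_LC.1 L1
        have a1 := hl1 _ h1
        have a2 := hl2 _ h1
        have a3 := hl3 _ h1
        have b2 := hl2 _ h1'
        have b3 := hl3 _ h1'
        rw [← e1] at b2 b3
        simp only at a2 a3 b2 b3
        refine mem_sigma.2 ⟨Finset.mem_range.2 a1, mem_sigma.2 ⟨(C.sub _ _ k1.1).1,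
          mem_sigma.2 ⟨(C.sub _ _ k1.2.1).1, mem_filter.2
          ⟨mem_product.2 ⟨L1, L2⟩, a3, ?_⟩⟩⟩⟩
        simp only [kap]
        rw [e2]
        have s1 := blk_succ (lam (f1, f2, g)) (C.u f1 g)
        have s2 := blk_succ (lam (f1, f2, g)) (C.u f2 g)
        have s3 := blk_succ (lam (f1, f2, g)) (C.u f1 g')
        have s4 := blk_succ (lam (f1, f2, g)) (C.u f2 g')
        have hb : blk (lam (f1, f2, g)) (C.u f1 g) = blk (lam (f1, f2, g)) (C.u f1 g') := by
          by_cases hgg : g = g'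
          · rw [hgg]
          rcases LC_nest_iff L1 L2 hgg with ⟨n1, n2⟩ | ⟨n1, n2⟩
          · have m1 := blk_mono (lam (f1, f2, g)) n1.le
            have m2 := blk_mono (lam (f1, f2, g)) n2.le
            omega
          · have m1 := blk_mono (lam (f1, f2, g)) n1.le
            have m2 := blk_mono (lam (f1, f2, g)) n2.le
            omega
        grind
      · rintro ⟨⟨f1, f2, g⟩, ⟨f1', f2', g'⟩⟩ hx ⟨⟨F1, F2, G⟩, ⟨F1', F2', G'⟩⟩ hX h
        grind
    have h2 : (((C.LT ×ˢ C.LT).filter (fun x => K x.1 = K x.2)).card : ℝ) ≤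
        ∑ l ∈ Finset.range Lv, ∑ f1 ∈ C.W, ∑ f2 ∈ C.W,
          ((C.NN S off q (blk (l + 1)) f1 f2).card : ℝ) := by exact_mod_cast h1
    refine h2.trans ?_
    refine (sum_le_sum fun l _ => level_bound hq (blk_mono (l + 1))).trans ?_
    rw [sum_const, card_range, nsmul_eq_mul]
  refine hcs.trans ?_
  gcongr
end Cfg
lemma core1_num {E w b L N Lv μ Λ q k m x : ℝ} (hw : 1 ≤ w) (hx : 1 ≤ x)
    (hb : b = w * x ^ 2) (hxw : x * Λ ^ 6 ≤ w) (hΛ : 100 ≤ Λ) (hLv0 : 0 ≤ Lv) (hLv : Lv ≤ Λ)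
    (hμ0 : 0 ≤ μ) (hμ : μ ≤ Λ) (hE : 100 * Λ ^ 2 * b ≤ E) (hL0 : 0 ≤ L)
    (hq1 : q * b ≤ E) (hq2 : E ≤ (q + 1) * b) (h3 : E ^ 2 ≤ b * (2 * L + E))
    (hk1 : 1 ≤ k) (hk2 : k ≤ 2 * x) (hm0 : 0 ≤ m) (hm : m ≤ w * Λ / x + 1)
    (hN : N ≤ w ^ 2 * (1 + 24 * k) + 2 * (4 * k * μ * L / w + 1) +
      2 * ((2 * L + E + E * (2 * m + μ)) / q))
    (hLN : L ^ 2 ≤ (Lv * N) * (Lv * (2 * L + E * (q + 1)))) :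
    E ^ 2 ≤ 3 * Λ ^ 4 * (w * b) * (w * x) := by
  have hb1 : 1 ≤ b := hb ▸ one_le_mul_of_one_le_of_one_le hw (one_le_pow₀ hx)
  have hb0 : 0 ≤ b := by linarith
  have hΛ0 : 0 < Λ := by linarith
  have hΛ2 : 10000 ≤ Λ ^ 2 := by linarith [pow_le_pow_left₀ (by norm_num) hΛ 2]
  have hEb : 1000000 * b ≤ E := by linarith [mul_le_mul_of_nonneg_right hΛ2 hb0]
  have hE0 : 0 < E := by linarith
  have hq87 : 80 * Λ ^ 2 ≤ q := by
    have : 100 * Λ ^ 2 * b ≤ (q + 1) * b := hE.trans hq2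
    have := le_of_mul_le_mul_right this (by linarith); linarith
  have hq0 : 0 < q := by linarith
  have hEE : 1000000 * (b * E) ≤ E ^ 2 := by linarith [mul_le_mul_of_nonneg_right hEb hE0.le]
  have hbL : 0.49 * E ^ 2 ≤ b * L := by linarith [sq_nonneg E]
  have hL00 : 0 < L := by
    by_contra h
    have : L = 0 := le_antisymm (not_lt.1 h) hL0
    rw [this] at hbL
    linarith [pow_pos hE0 2]
  have h5 : 2 * L + E * (q + 1) ≤ 5 * L := by
    have : b * (2 * L + E * (q + 1)) ≤ b * (5 * L) := by
      linarith [mul_le_mul_of_nonneg_left hq1 hE0.le, sq_nonneg E]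
    exact le_of_mul_le_mul_left this (by linarith)
  have hN0 : 0 ≤ N := by
    by_contra h
    push Not at h
    have : Lv * N ≤ 0 := mul_nonpos_of_nonneg_of_nonpos hLv0 h.le
    have h2 : 0 ≤ Lv * (2 * L + E * (q + 1)) := by positivity
    have h4 := mul_nonpos_of_nonpos_of_nonneg this h2
    have h6 : 0 < L ^ 2 := by positivity
    linarith
  have hLN2 : L ≤ 5 * Λ ^ 2 * N := by
    have h1 : L ^ 2 ≤ (Λ * N) * (Λ * (5 * L)) := by
      refine hLN.trans ?_
      gcongr
    have : L * L ≤ L * (5 * Λ ^ 2 * N) := by linarith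
    exact le_of_mul_le_mul_left this hL00
  have hΛ3 : 1000000 ≤ Λ ^ 3 := by
    have : (100:ℝ) ^ 3 ≤ Λ ^ 3 := by gcongr
    linarith
  have hkw : 160 * Λ ^ 3 * k ≤ w := by
    have : 160 * Λ ^ 3 * k ≤ 160 * Λ ^ 3 * (2 * x) := by gcongr
    have h2 : 320 * (Λ ^ 3 * x) ≤ Λ ^ 3 * (Λ ^ 3 * x) := by
      gcongr; linarith
    linarith
  have t1 : 5 * Λ ^ 2 * (2 * (4 * k * μ * L / w)) ≤ L / 4 := by
    have : 5 * Λ ^ 2 * (2 * (4 * k * μ * L / w)) = (40 * Λ ^ 2 * μ * k * L) / w := by ring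
    rw [this, div_le_iff₀ (by linarith)]
    have : 40 * Λ ^ 2 * μ * k ≤ 40 * Λ ^ 2 * Λ * k := by gcongr
    linarith [mul_le_mul_of_nonneg_right this hL0, mul_le_mul_of_nonneg_right hkw hL0]
  have t2 : 5 * Λ ^ 2 * (2 * (2 * L / q)) ≤ L / 4 := by
    have : 5 * Λ ^ 2 * (2 * (2 * L / q)) = (20 * Λ ^ 2 * L) / q := by ring
    rw [this, div_le_iff₀ hq0]
    linarith [mul_le_mul_of_nonneg_right hq87 hL0]
  have hEq : E / q ≤ 8 / 7 * b := by
    rw [div_le_iff₀ hq0]; linarith [mul_le_mul_of_nonneg_right (show 7 ≤ q by linarith) hb0]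
  have hwx : Λ ^ 6 ≤ w / x := by
    rw [le_div_iff₀ (by linarith)]; linarith
  set y := w / x with hy
  have hm' : m ≤ y * Λ + 1 := by rw [hy]; convert hm using 2; ring
  have hyx : y * x = w := by rw [hy]; field_simp
  have hys : Λ ≤ y := (le_self_pow₀ (by linarith) (by norm_num)).trans hwx
  have hL2 : L ≤ 10 * Λ ^ 2 * (w ^ 2 * (1 + 24 * k) + 2 + 2 * (8 / 7 * b * (1 + 2 * m + μ))) := by
    have : 2 * ((2 * L + E + E * (2 * m + μ)) / q) =
      2 * (2 * L / q) + 2 * (E / q * (1 + 2 * m + μ)) := by ring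
    have h' : E / q * (1 + 2 * m + μ) ≤ 8 / 7 * b * (1 + 2 * m + μ) := by gcongr
    have h'' : 5 * Λ ^ 2 * N ≤ 5 * Λ ^ 2 * (w ^ 2 * (1 + 24 * k) + 2 * (4 * k * μ * L / w + 1) +
      (2 * (2 * L / q) + 2 * (8 / 7 * b * (1 + 2 * m + μ)))) := by
      gcongr; linarith
    linarith
  have e1 : w ^ 2 * (1 + 24 * k) + 2 ≤ 54 * (w ^ 2 * x) := by
    have : 1 ≤ w ^ 2 := one_le_pow₀ hw
    linarith [mul_le_mul_of_nonneg_left hk2 (sq_nonneg w), mul_le_mul_of_nonneg_left hx (sq_nonneg w)]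
  have e2 : 1 + 2 * m + μ ≤ 3 * Λ * y := by
    linarith [mul_le_mul_of_nonneg_left hys hΛ0.le, mul_le_mul_of_nonneg_left hΛ hΛ0.le]
  have e3 : 2 * (8 / 7 * b * (1 + 2 * m + μ)) ≤ 7 * Λ * (w ^ 2 * x) := by
    have : 2 * (8 / 7 * b * (1 + 2 * m + μ)) ≤ 2 * (8 / 7 * b * (3 * Λ * y)) := by gcongr
    have h' : b * y = w ^ 2 * x := by rw [hb, ← hyx]; ring
    have h'' : 0 ≤ Λ * (w ^ 2 * x) := by positivity
    have : 2 * (8 / 7 * b * (3 * Λ * y)) = 48 / 7 * (Λ * (w ^ 2 * x)) := by rw [← h']; ring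
    linarith
  have e4 : L ≤ Λ ^ 4 * (w ^ 2 * x) := by
    have : L ≤ 10 * Λ ^ 2 * (54 * (w ^ 2 * x) + 7 * Λ * (w ^ 2 * x)) := by
      refine hL2.trans ?_
      gcongr
    have h2 : 10 * Λ ^ 2 * (54 * (w ^ 2 * x) + 7 * Λ * (w ^ 2 * x)) =
      Λ ^ 2 * (w ^ 2 * x) * (540 + 70 * Λ) := by ring
    have h3 : Λ ^ 4 * (w ^ 2 * x) = Λ ^ 2 * (w ^ 2 * x) * Λ ^ 2 := by ring
    rw [h3]; rw [h2] at this
    refine this.trans ?_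
    gcongr; linarith [mul_le_mul_of_nonneg_left hΛ hΛ0.le]
  have e5 : E ^ 2 ≤ 3 * (b * L) := by linarith [sq_nonneg E]
  calc E ^ 2 ≤ 3 * (b * L) := e5
    _ ≤ 3 * (b * (Λ ^ 4 * (w ^ 2 * x))) := by gcongr
    _ = _ := by ring
namespace Cfg
variable {C : Cfg}
lemma sum_dg : ∑ g ∈ C.B, C.dg g = C.H.card := by
  rw [card_eq_sum_ones, sum_H (C := C), sum_comm]
  apply sum_congr rfl
  intro g _
  simp only [dg, card_filter]
lemma dg_sq : ∑ e ∈ C.H, C.dg e.2 = ∑ g ∈ C.B, C.dg g ^ 2 := by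
  rw [sum_H (C := C), sum_comm]
  apply sum_congr rfl
  intro g _
  rw [← sum_filter]
  change ∑ a ∈ C.W with (a, g) ∈ C.H, C.dg g = _
  rw [sum_const, smul_eq_mul, pow_two]
  rfl
lemma H_sq : (C.H.card : ℝ) ^ 2 ≤ C.B.card * (2 * C.LT.card + C.H.card) := by
  have h1 : (C.H.card : ℝ) = ∑ g ∈ C.B, (C.dg g : ℝ) := by
    rw [← sum_dg (C := C)]; push_cast; rfl
  have h2 : (2 * C.LT.card + C.H.card : ℝ) = ∑ g ∈ C.B, (C.dg g : ℝ) ^ 2 := by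
    have := (triples (C := C)).symm.trans (dg_sq (C := C))
    exact_mod_cast this
  rw [h2, h1]
  exact sq_sum_le_card_mul_sum_sq
theorem core1 {b Λ : ℝ} {Lv μ : ℕ} (hb : (C.B.card : ℝ) ≤ b) (hW : C.W.Nonempty)
    (hwb : (C.W.card : ℝ) ≤ b) (hbw : b * Λ ^ 12 ≤ (C.W.card : ℝ) ^ 3) (hΛ : 100 ≤ Λ)
    (hLv : (Lv : ℝ) ≤ Λ) (hμΛ : (μ : ℝ) ≤ Λ)
    (hlog : 8 * (C.H.card : ℝ) * C.W.card ≤ Real.exp Λ) (hρ : 5 ≤ 2 ^ Lv * C.ρ)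
    (hμ : ∀ f g, (f, g) ∈ C.H → (C.W.filter (fun s => Nb C.ρ f (C.u f g) s)).card ≤ μ) :
    (C.H.card : ℝ) ≤ 100 * Λ ^ 2 * b ∨
      (C.H.card : ℝ) ^ 2 ≤ 3 * Λ ^ 4 * (C.W.card * b) * (Real.sqrt (C.W.card * b)) := by
  by_cases hE : (C.H.card : ℝ) ≤ 100 * Λ ^ 2 * b
  · exact Or.inl hE
  right
  push Not at hE
  set w : ℝ := (C.W.card : ℝ) with hw
  set E : ℝ := (C.H.card : ℝ) with hEd
  have hw1 : 1 ≤ w := by rw [hw]; exact_mod_cast hW.card_pos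
  have hb1 : 1 ≤ b := hw1.trans hwb
  set x := Real.sqrt (b / w) with hx
  obtain ⟨hbx, hx0, hx1⟩ : b = w * x ^ 2 ∧ 0 ≤ x ∧ 1 ≤ x := by
    have hx2 : x ^ 2 = b / w := Real.sq_sqrt (div_nonneg (by linarith) (by linarith))
    have hx0 : 0 ≤ x := Real.sqrt_nonneg _
    refine ⟨by grind, hx0, ?_⟩
    have : 1 ≤ x ^ 2 := by rw [hx2, le_div_iff₀ (by linarith)]; linarith
    exact (one_le_sq_iff₀ hx0).1 this
  clear_value x; clear hx
  have hwx : Real.sqrt (w * b) = w * x := by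
    rw [Real.sqrt_eq_iff_mul_self_eq (by positivity) (by positivity), hbx]; ring
  have hxw : x * Λ ^ 6 ≤ w := by
    have : (x * Λ ^ 6) ^ 2 ≤ w ^ 2 := by
      nlinarith
    exact le_of_sq_le_sq this (by linarith)
  set k : ℕ := ⌈x⌉₊ with hk
  have hk1 : x ≤ k := Nat.le_ceil _
  have hk2 : (k : ℝ) ≤ 2 * x := by
    have := (Nat.ceil_lt_add_one hx0).le
    linarith
  set q : ℕ := ⌊E / b⌋₊ with hq
  have hqE : (q : ℝ) * b ≤ E := by
    rw [← le_div_iff₀ (by linarith)]; exact Nat.floor_le (by positivity)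
  have hqE2 : E ≤ (q + 1) * b := by
    rw [← div_le_iff₀ (by linarith)]; exact (Nat.lt_floor_add_one _).le
  have hq0 : 0 < q := by
    rw [hq, Nat.floor_pos, le_div_iff₀ (by linarith)]; linarith only [hE, hb1, mul_le_mul_of_nonneg_right (one_le_pow₀ (show 1 ≤ Λ by linarith) (n := 2)) (show 0 ≤ b by linarith)]
  set m : ℕ := min C.W.card ⌈w * Λ / k⌉₊ with hm
  have hkp : (0 : ℝ) < k := by linarith
  have hmle : (m : ℝ) ≤ w * Λ / x + 1 := by
    have h1 : (m : ℝ) ≤ (⌈w * Λ / k⌉₊ : ℕ) := by exact Nat.cast_le.2 (min_le_right _ _)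
    have h2 := (Nat.ceil_lt_add_one (show 0 ≤ w * Λ / k by positivity)).le
    have h3 : w * Λ / k ≤ w * Λ / x := by gcongr
    linarith
  have hkk : (4 * E * w : ℝ) * (1 - m / w) ^ k ≤ 1 / 2 := by
    have hmw : (m : ℝ) ≤ w := by
      rw [hw]; exact Nat.cast_le.2 (min_le_left _ _)
    have h0 : 0 ≤ 1 - m / w := by
      rw [sub_nonneg, div_le_one (by linarith)]; exact hmw
    rcases le_total C.W.card ⌈w * Λ / k⌉₊ with h | h
    · have : (m : ℝ) = w := by rw [hm, min_eq_left h]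
      rw [this, div_self (by linarith), sub_self, zero_pow (by positivity)]; norm_num
    · have h1 : w * Λ / k ≤ m := by rw [hm, min_eq_right h]; exact Nat.le_ceil _
      have h2 : (1 - m / w) ^ k ≤ Real.exp (-Λ) := by
        calc (1 - m / w) ^ k ≤ (Real.exp (-(m / w))) ^ k := by
              gcongr; linarith [Real.add_one_le_exp (-(m / w))]
          _ = Real.exp (k * (-(m / w))) := (Real.exp_nat_mul _ _).symm
          _ ≤ Real.exp (-Λ) := by
            apply Real.exp_le_exp.2
            rw [div_le_iff₀ hkp] at h1
            have : Λ ≤ k * (m / w) := by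
              rw [← mul_div_assoc, le_div_iff₀ (by linarith)]; linarith only [h1]
            linarith
      have h3 : Real.exp Λ * Real.exp (-Λ) = 1 := by rw [← Real.exp_add]; simp
      calc (4 * E * w : ℝ) * (1 - m / w) ^ k ≤ (Real.exp Λ / 2) * Real.exp (-Λ) := by
            gcongr; linarith
        _ = 1 / 2 := by linarith
  obtain ⟨S, off, hN⟩ := Nl_main (C := C) (μ := μ) (m := m) (k := k) hq0 hW (min_le_left _ _) hμ hkk
  have hLN := LT_sq (C := C) (S := S) (off := off) hq0 hρ
  rw [hwx]
  have hsum : (∑ e ∈ C.H, ((C.dg e.2 : ℝ) + (2 * m + μ))) =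
      2 * C.LT.card + E + E * (2 * m + μ) := by
    rw [sum_add_distrib, sum_const, nsmul_eq_mul]
    have := triples (C := C)
    have h' : (∑ e ∈ C.H, (C.dg e.2 : ℝ)) = 2 * C.LT.card + E := by
      rw [hEd]; exact_mod_cast this
    rw [h']
  rw [hsum] at hN
  refine core1_num (L := C.LT.card) (N := C.Nl S off q) (Lv := Lv) (μ := μ) (q := q) (k := k)
    (m := m) hw1 hx1 hbx hxw hΛ (by positivity) hLv (by positivity) hμΛ hE.le (by positivity)
    hqE hqE2 ?_ (hx1.trans hk1) hk2 (by positivity) hmle hN hLN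
  refine (H_sq (C := C)).trans ?_
  gcongr
end Cfg
lemma exists_rich {α : Type*} [DecidableEq α] (d : α → ℝ) (b : ℕ) (hb : 0 < b) : ∀ (n : ℕ) (s : Finset α),
    s.card = b + n → ∃ t ⊆ s, t.card = b ∧ b * ∑ a ∈ s, d a ≤ s.card * ∑ a ∈ t, d a := by
  intro n
  induction n with
  | zero => intro s hs; exact ⟨s, subset_rfl, by simpa using hs, by rw [hs]; simp⟩
  | succ n ih =>
    intro s hs
    have hne : s.Nonempty := by rw [← card_pos]; omega
    obtain ⟨x, hx, hmin⟩ := s.exists_min_image d hne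
    have hc : (s.erase x).card = b + n := by grind
    obtain ⟨t, ht, htc, hle⟩ := ih _ hc
    refine ⟨t, ht.trans (Finset.erase_subset _ _), htc, ?_⟩
    have h1 : ∑ a ∈ s.erase x, d a + d x = ∑ a ∈ s, d a := Finset.sum_erase_add _ _ hx
    have h2 : (s.card : ℝ) * d x ≤ ∑ a ∈ s, d a := by
      have := Finset.card_nsmul_le_sum s d (d x) hmin
      simpa using this
    have hc' : ((s.erase x).card : ℝ) = s.card - 1 := by
      rw [Finset.card_erase_of_mem hx, Nat.cast_sub (by omega)]; simp
    rw [hc'] at hle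
    have hs1 : (0 : ℝ) < s.card - 1 := by
      rw [← hc', hc]; positivity
    have h3 : (s.card - 1 : ℝ) * ∑ a ∈ s, d a ≤ s.card * ∑ a ∈ s.erase x, d a := by
      nlinarith
    nlinarith
lemma core2_num {w n b E E' Λ : ℝ} (hΛ : 100 ≤ Λ) (hw : 1 ≤ w) (hb1 : 1 ≤ b) (hE0 : 0 ≤ E')
    (hbw : w ^ 3 ≤ 2 * Λ ^ 12 * b)
    (h : E' ≤ 100 * Λ ^ 2 * b ∨ E' ^ 2 ≤ 3 * Λ ^ 4 * (w * b) * Real.sqrt (w * b))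
    (hE : b * E ≤ n * E') (hn : 0 ≤ n) : E ≤ Λ ^ 7 * n := by
  have key : E' ≤ Λ ^ 7 * b := by
    rcases h with h | h
    · refine h.trans ?_
      have : (1:ℝ) ≤ Λ ^ 4 := one_le_pow₀ (by linarith)
      gcongr ?_ * b
      calc 100 * Λ ^ 2 ≤ Λ * Λ ^ 2 * 1 := by rw [mul_one]; gcongr
        _ ≤ Λ * Λ ^ 2 * Λ ^ 4 := by gcongr
        _ = Λ ^ 7 := by ring
    · have h1 : (w * b) * Real.sqrt (w * b) ≤ 2 * Λ ^ 6 * b ^ 2 := by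
        refine le_of_sq_le_sq ?_ (by positivity)
        rw [mul_pow, Real.sq_sqrt (by positivity)]
        calc (w * b) ^ 2 * (w * b) = w ^ 3 * b ^ 3 := by ring
          _ ≤ 2 * Λ ^ 12 * b * b ^ 3 := by gcongr
          _ ≤ (2 * Λ ^ 6 * b ^ 2) ^ 2 := by
            nlinarith
      have h2 : E' ^ 2 ≤ (Λ ^ 7 * b) ^ 2 := by
        calc E' ^ 2 ≤ 3 * Λ ^ 4 * ((w * b) * Real.sqrt (w * b)) := by linarith
          _ ≤ 3 * Λ ^ 4 * (2 * Λ ^ 6 * b ^ 2) := by gcongr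
          _ = 6 * 1 * (Λ ^ 10 * b ^ 2) := by ring
          _ ≤ Λ * Λ ^ 3 * (Λ ^ 10 * b ^ 2) := by
            have : (1:ℝ) ≤ Λ ^ 3 := one_le_pow₀ (by linarith)
            gcongr; linarith
          _ = _ := by ring
      exact (pow_le_pow_iff_left₀ hE0 (by positivity) two_ne_zero).1 h2
  nlinarith
namespace Cfg
variable {C : Cfg}
def restrictB (C : Cfg) (B' : Finset Quad) : Cfg where
  W := C.W
  B := B'
  H := C.H.filter (fun e => e.2 ∈ B')
  u := C.u
  ρ := C.ρ
  hρ := C.hρ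
  sub f g h := ⟨(C.sub f g (mem_filter.1 h).1).1, (mem_filter.1 h).2⟩
  tan f g h := C.tan f g (mem_filter.1 h).1
  sepf f g g' h h' := C.sepf f g g' (mem_filter.1 h).1 (mem_filter.1 h').1
  sepg f f' g h h' := C.sepg f f' g (mem_filter.1 h).1 (mem_filter.1 h').1
  rng f g h := C.rng f g (mem_filter.1 h).1
  lW := C.lW
lemma restrictB_card {B' : Finset Quad} :
    ((C.restrictB B').H.card : ℝ) = ∑ g ∈ B', (C.dg g : ℝ) := by
  rw [← sum_dg (C := C.restrictB B')]
  push_cast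
  apply sum_congr rfl
  intro g hg
  simp only [dg, restrictB, mem_filter]
  have : g ∈ B' := hg
  simp [this]
theorem core2 {Λ : ℝ} {Lv μ : ℕ} (hwb : C.W.card ≤ C.B.card) (hΛ : 100 ≤ Λ)
    (hLv : (Lv : ℝ) ≤ Λ) (hμΛ : (μ : ℝ) ≤ Λ)
    (hlog : 8 * (C.H.card : ℝ) * C.W.card ≤ Real.exp Λ) (hρ : 5 ≤ 2 ^ Lv * C.ρ)
    (hμ : ∀ f g, (f, g) ∈ C.H → (C.W.filter (fun s => Nb C.ρ f (C.u f g) s)).card ≤ μ) :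
    (C.H.card : ℝ) ≤ Λ ^ 7 * (((C.W.card : ℝ) * C.B.card) ^ ((3 : ℝ) / 4) + C.B.card) := by
  have hp : (0:ℝ) ≤ ((C.W.card : ℝ) * C.B.card) ^ ((3 : ℝ) / 4) := by positivity
  rcases C.W.eq_empty_or_nonempty with hW | hW
  · have : C.H = ∅ := by
      rw [Finset.eq_empty_iff_forall_notMem]; rintro ⟨f, g⟩ h
      have := (C.sub f g h).1; grind
    rw [this]; simp; positivity
  have hw1 : (1 : ℝ) ≤ C.W.card := by exact_mod_cast hW.card_pos
  have hwbr : (C.W.card : ℝ) ≤ C.B.card := by exact_mod_cast hwb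
  have hE0 : (0:ℝ) ≤ C.H.card := by positivity
  have hn0 : (0:ℝ) ≤ C.B.card := by positivity
  by_cases h1 : (C.B.card : ℝ) * Λ ^ 12 ≤ (C.W.card : ℝ) ^ 3
  · rcases core1 le_rfl hW hwbr h1 hΛ hLv hμΛ hlog hρ hμ with h | h
    · refine h.trans ?_
      have : (1:ℝ) ≤ Λ ^ 4 := one_le_pow₀ (by linarith)
      have h2 : 100 * Λ ^ 2 ≤ Λ ^ 7 := by
        calc 100 * Λ ^ 2 ≤ Λ * Λ ^ 2 * 1 := by rw [mul_one]; gcongr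
          _ ≤ Λ * Λ ^ 2 * Λ ^ 4 := by gcongr
          _ = Λ ^ 7 := by ring
      calc 100 * Λ ^ 2 * (C.B.card : ℝ) ≤ Λ ^ 7 * C.B.card := by gcongr
        _ ≤ _ := by gcongr; linarith
    · set z : ℝ := (C.W.card : ℝ) * C.B.card with hz
      have hz0 : 0 ≤ z := by positivity
      have hz2 : (z ^ ((3:ℝ)/4)) ^ 2 = z * Real.sqrt z := by
        rw [← Real.rpow_natCast, ← Real.rpow_mul hz0, Real.sqrt_eq_rpow]
        nth_rewrite 2 [← Real.rpow_one z]
        rw [← Real.rpow_add_of_nonneg hz0 (by norm_num) (by norm_num)]; norm_num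
      have : (C.H.card : ℝ) ^ 2 ≤ (Λ ^ 7 * z ^ ((3:ℝ)/4)) ^ 2 := by
        rw [mul_pow, hz2]
        calc (C.H.card : ℝ) ^ 2 ≤ 3 * Λ ^ 4 * z * Real.sqrt z := h
          _ = 3 * 1 * Λ ^ 4 * (z * Real.sqrt z) := by ring
          _ ≤ Λ * Λ ^ 9 * Λ ^ 4 * (z * Real.sqrt z) := by
            have : (1:ℝ) ≤ Λ ^ 9 := one_le_pow₀ (by linarith)
            gcongr; linarith
          _ = _ := by ring
      have := (pow_le_pow_iff_left₀ hE0 (by positivity) two_ne_zero).1 this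
      refine this.trans ?_
      gcongr; linarith
  push Not at h1
  suffices (C.H.card : ℝ) ≤ Λ ^ 7 * C.B.card from this.trans (by gcongr; linarith)
  by_cases h2 : (C.W.card : ℝ) ≤ 2 * Λ ^ 6
  · have h3 : (C.H.card : ℝ) ≤ C.W.card * C.B.card := by
      have : C.H ⊆ C.W ×ˢ C.B := by
        rintro ⟨f, g⟩ h; exact mem_product.2 (C.sub f g h)
      have := Finset.card_le_card this
      rw [card_product] at this
      exact_mod_cast this
    calc (C.H.card : ℝ) ≤ C.W.card * C.B.card := h3
      _ ≤ (Λ * Λ ^ 6) * C.B.card := by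
        gcongr; refine h2.trans ?_; gcongr; linarith
      _ = _ := by ring
  push Not at h2
  set b : ℕ := ⌊(C.W.card : ℝ) ^ 3 / Λ ^ 12⌋₊ with hb
  have hb2 : (b : ℝ) ≤ (C.W.card : ℝ) ^ 3 / Λ ^ 12 := Nat.floor_le (by positivity)
  have hb3 : (C.W.card : ℝ) ^ 3 / Λ ^ 12 < b + 1 := Nat.lt_floor_add_one _
  have hb4 : C.W.card ≤ b := by
    apply Nat.le_floor
    rw [le_div_iff₀ (by positivity)]
    have : Λ ^ 12 ≤ (C.W.card : ℝ) ^ 2 := by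
      calc Λ ^ 12 = (Λ ^ 6) ^ 2 := by ring
        _ ≤ (C.W.card : ℝ) ^ 2 := by
          have : 0 < Λ ^ 6 := by positivity
          gcongr; linarith
    calc (C.W.card : ℝ) * Λ ^ 12 ≤ C.W.card * (C.W.card : ℝ) ^ 2 := by gcongr
      _ = _ := by ring
  have hb5 : b ≤ C.B.card := by
    have : (b : ℝ) ≤ C.B.card := by
      refine hb2.trans ?_
      rw [div_le_iff₀ (by positivity)]; exact h1.le
    exact_mod_cast this
  have hb1 : 1 ≤ b := (hW.card_pos).trans_le hb4
  obtain ⟨B', hB', hB'c, hrich⟩ := exists_rich (fun g => (C.dg g : ℝ)) b hb1 (C.B.card - b) C.B (by omega)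
  have hEE : (∑ a ∈ C.B, (C.dg a : ℝ)) = C.H.card := by
    rw [← sum_dg (C := C)]; push_cast; rfl
  rw [hEE, ← restrictB_card] at hrich
  have hb1r : (1:ℝ) ≤ b := by exact_mod_cast hb1
  have hb4r : (C.W.card:ℝ) ≤ b := by exact_mod_cast hb4
  have hsubc : ((C.restrictB B').H.card : ℝ) ≤ C.H.card := by
    exact_mod_cast Finset.card_le_card (filter_subset _ _)
  refine core2_num (w := C.W.card) (b := b) (E' := ((C.restrictB B').H.card : ℝ)) hΛ hw1 hb1r
    (by positivity) ?_ ?_ hrich hn0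
  · rw [div_lt_iff₀ (by positivity)] at hb3
    have : 0 < Λ ^ 12 := by positivity
    nlinarith
  · refine core1 (C := C.restrictB B') (b := b) (Lv := Lv) (μ := μ) ?_ hW hb4r ?_ hΛ hLv hμΛ ?_ hρ ?_
    · exact_mod_cast hB'c.le
    · change (b : ℝ) * Λ ^ 12 ≤ (C.W.card : ℝ) ^ 3
      rwa [← le_div_iff₀ (by positivity)]
    · refine le_trans ?_ hlog
      change 8 * ((C.restrictB B').H.card : ℝ) * C.W.card ≤ _
      gcongr
    · intro f g h
      exact hμ f g (mem_filter.1 h).1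
def ng (f : Quad) : Quad := ⟨-f.c0, -f.c1, -f.c2⟩
@[simp] lemma ng_ng (f : Quad) : ng (ng f) = f := by simp [ng]
lemma ng_inj : Function.Injective ng := fun a b h => by rw [← ng_ng a, h, ng_ng]
lemma Tan_ng {ρ a : ℝ} {f g : Quad} (h : Tan ρ f g a) : Tan ρ (ng g) (ng f) a := by
  obtain ⟨τ, κ, h1, h2, h3, h4, rfl⟩ := h
  refine ⟨τ, κ, h1, h2, h3, h4, ?_⟩
  ext <;> simp [ng] <;> ring
def swap (C : Cfg) (lB : ∀ f ∈ C.B, ∀ f' ∈ C.B, |f.c2 - f'.c2| ≤ 1 / 2) : Cfg where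
  W := C.B.image ng
  B := C.W.image ng
  H := C.H.image (fun e => (ng e.2, ng e.1))
  u f g := C.u (ng g) (ng f)
  ρ := C.ρ
  hρ := C.hρ
  sub f g h := by
    obtain ⟨⟨a, b⟩, hab, he⟩ := Finset.mem_image.1 h
    simp only [Prod.mk.injEq] at he
    obtain ⟨rfl, rfl⟩ := he
    have := C.sub _ _ hab
    grind
  tan f g h := by
    obtain ⟨⟨a, b⟩, hab, he⟩ := Finset.mem_image.1 h
    simp only [Prod.mk.injEq] at he
    obtain ⟨rfl, rfl⟩ := he
    simpa using Tan_ng (C.tan _ _ hab)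
  sepf f g g' h h' hne := by
    obtain ⟨⟨a, b⟩, hab, he⟩ := Finset.mem_image.1 h
    simp only [Prod.mk.injEq] at he
    obtain ⟨rfl, rfl⟩ := he
    obtain ⟨⟨a', b'⟩, hab', he⟩ := Finset.mem_image.1 h'
    simp only [Prod.mk.injEq] at he
    obtain ⟨he, rfl⟩ := he
    obtain rfl := ng_inj he
    simp only [ng_ng]
    exact C.sepg _ _ _ hab hab' (fun h => hne (by rw [h]))
  sepg f f' g h h' hne := by
    obtain ⟨⟨a, b⟩, hab, he⟩ := Finset.mem_image.1 h
    simp only [Prod.mk.injEq] at he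
    obtain ⟨rfl, rfl⟩ := he
    obtain ⟨⟨a', b'⟩, hab', he⟩ := Finset.mem_image.1 h'
    simp only [Prod.mk.injEq] at he
    obtain ⟨rfl, he⟩ := he
    obtain rfl := ng_inj he
    simp only [ng_ng]
    exact C.sepf _ _ _ hab hab' (fun h => hne (by rw [h]))
  rng f g h := by
    obtain ⟨⟨a, b⟩, hab, he⟩ := Finset.mem_image.1 h
    simp only [Prod.mk.injEq] at he
    obtain ⟨rfl, rfl⟩ := he
    simpa using C.rng _ _ hab
  lW f hf f' hf' := by
    obtain ⟨a, ha, rfl⟩ := Finset.mem_image.1 hf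
    obtain ⟨a', ha', rfl⟩ := Finset.mem_image.1 hf'
    simp only [ng]
    grind
lemma Nb_ng {ρ a : ℝ} {f s : Quad} : Nb ρ (ng f) a (ng s) ↔ Nb ρ f a s := by
  have h1 : (ng s).ev a - (ng f).ev a = -(s.ev a - f.ev a) := by simp only [ng, ev]; ring
  have h2 : (ng s).der a - (ng f).der a = -(s.der a - f.der a) := by simp only [ng, der]; ring
  simp only [Nb, h1, h2, abs_neg]
theorem core3 {Λ : ℝ} {Lv μ : ℕ} (hΛ : 100 ≤ Λ)
    (lB : ∀ f ∈ C.B, ∀ f' ∈ C.B, |f.c2 - f'.c2| ≤ 1 / 2)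
    (hLv : (Lv : ℝ) ≤ Λ) (hμΛ : (μ : ℝ) ≤ Λ)
    (hlog : 8 * (C.H.card : ℝ) * C.W.card ≤ Real.exp Λ)
    (hlog' : 8 * (C.H.card : ℝ) * C.B.card ≤ Real.exp Λ) (hρ : 5 ≤ 2 ^ Lv * C.ρ)
    (hμ : ∀ f g, (f, g) ∈ C.H → (C.W.filter (fun s => Nb C.ρ f (C.u f g) s)).card ≤ μ)
    (hμ' : ∀ f g, (f, g) ∈ C.H → (C.B.filter (fun s => Nb C.ρ g (C.u f g) s)).card ≤ μ) :
    (C.H.card : ℝ) ≤ Λ ^ 7 * (((C.W.card : ℝ) * C.B.card) ^ ((3 : ℝ) / 4) + C.W.card + C.B.card) := by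
  rcases le_total C.W.card C.B.card with h | h
  · refine (core2 h hΛ hLv hμΛ hlog hρ hμ).trans ?_
    gcongr
    linarith
  · have c1 : (C.swap lB).W.card = C.B.card := Finset.card_image_of_injective _ ng_inj
    have c2 : (C.swap lB).B.card = C.W.card := Finset.card_image_of_injective _ ng_inj
    have c3 : (C.swap lB).H.card = C.H.card := by
      apply Finset.card_image_of_injective
      rintro ⟨a, b⟩ ⟨a', b'⟩ h
      simp only [Prod.mk.injEq] at h
      rw [ng_inj h.1, ng_inj h.2]
    have := core2 (C := C.swap lB) (Λ := Λ) (Lv := Lv) (μ := μ) (by linarith) hΛ hLv hμΛ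
      (by grind) hρ (by
        intro f g hfg
        obtain ⟨⟨a, b⟩, hab, he⟩ := Finset.mem_image.1 hfg
        simp only [Prod.mk.injEq] at he
        obtain ⟨rfl, rfl⟩ := he
        refine le_trans ?_ (hμ' a b hab)
        rw [← Finset.card_image_of_injective (C.B.filter _) ng_inj]
        apply Finset.card_le_card
        intro s hs
        obtain ⟨hs1, hs2⟩ := mem_filter.1 hs
        obtain ⟨s', hs', rfl⟩ := Finset.mem_image.1 hs1
        apply Finset.mem_image_of_mem
        refine mem_filter.2 ⟨hs', ?_⟩
        have := Nb_ng.1 hs2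
        simpa [swap] using this)
    rw [c1, c2, c3] at this
    refine this.trans ?_
    rw [mul_comm (C.B.card : ℝ)]
    refine mul_le_mul_of_nonneg_left ?_ (by positivity)
    linarith
end Cfg
set_option maxHeartbeats 1000000 in
lemma sample {ι α : Type*} [DecidableEq ι] [DecidableEq α] (R : Finset ι) (W : Finset α) (A A' : ι → Finset α)
    (M X : ℝ) (hM : 1 ≤ M) (hX : 1 ≤ X) (hne : R.Nonempty)
    (hA : ∀ i ∈ R, A i ⊆ W ∧ M ≤ (A i).card) (hA' : ∀ i ∈ R, A' i ⊆ W ∧ ((A' i).card : ℝ) ≤ M * X) :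
    ∃ S ⊆ W, (S.card : ℝ) ≤ 3 * (W.card / M) ∧ ∃ R' ⊆ R, (R.card : ℝ) ≤ 2 * R'.card ∧
      ∀ i ∈ R', (∃ a ∈ S, a ∈ A i) ∧ (((A' i) ∩ S).card : ℝ) ≤ 36 * X := by
  obtain ⟨i0, hi0⟩ := hne
  have hMW : M ≤ W.card := (hA i0 hi0).2.trans (by exact_mod_cast Finset.card_le_card (hA i0 hi0).1)
  have hW0 : (0:ℝ) < W.card := by linarith
  have hW : W.Nonempty := by rw [← card_pos]; exact_mod_cast hW0
  have hR0 : (0:ℝ) < R.card := by exact_mod_cast card_pos.2 ⟨i0, hi0⟩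
  set D : α → ℝ := fun a => ((R.filter (fun i => a ∈ A' i)).card : ℝ) with hD
  have hDsum : ∀ T : Finset α, ∑ a ∈ T, D a = ∑ i ∈ R, ((A' i ∩ T).card : ℝ) := by
    intro T
    simp only [hD, card_filter]
    push_cast
    rw [sum_comm]
    apply sum_congr rfl
    intro i _
    rw [← sum_filter, sum_const, nsmul_eq_mul, mul_one, Finset.filter_mem_eq_inter, Finset.inter_comm]
  have hwM : 1 ≤ W.card / M := by rw [le_div_iff₀ (by linarith)]; linarith
  set k : ℕ := ⌈2 * (W.card / M : ℝ)⌉₊ with hk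
  have hk1 : 2 * (W.card / M : ℝ) ≤ k := Nat.le_ceil _
  have hk2 : (k : ℝ) ≤ 3 * (W.card / M) := by
    have := (Nat.ceil_lt_add_one (show 0 ≤ 2 * (W.card / M : ℝ) by positivity)).le
    rw [← hk] at this; linarith
  have hexp : (1 - M / W.card) ^ k ≤ 1 / 7 := by
    have h0 : 0 ≤ 1 - M / W.card := by rw [sub_nonneg, div_le_one hW0]; exact hMW
    calc (1 - M / W.card) ^ k ≤ (Real.exp (-(M / W.card))) ^ k := by
          gcongr; linarith [Real.add_one_le_exp (-(M / W.card))]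
      _ = Real.exp (k * (-(M / W.card))) := (Real.exp_nat_mul _ _).symm
      _ ≤ Real.exp (-2) := by
        apply Real.exp_le_exp.2
        have : 2 ≤ k * (M / W.card) := by
          have h2 : 2 * (W.card / M) * (M / W.card) ≤ k * (M / W.card) := by gcongr
          have h3 : 2 * (W.card / M) * (M / W.card) = (2:ℝ) := by field_simp
          linarith
        linarith
      _ ≤ 1 / 7 := by
        have h1 : Real.exp (-2) * Real.exp 2 = 1 := by rw [← Real.exp_add]; simp
        have h2 : (7:ℝ) ≤ Real.exp 2 := by
          have := Real.exp_one_gt_d9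
          have h3 : Real.exp 2 = Real.exp 1 * Real.exp 1 := by rw [← Real.exp_add]; norm_num
          nlinarith
        have h4 := Real.exp_pos (-2)
        nlinarith
  obtain ⟨S, hS, hSk, hhit⟩ := hit W hW D (fun a => by positivity) M hMW (21 * X) (by positivity) A k R hA
  have hDW : 0 ≤ ∑ a ∈ W, D a := sum_nonneg (fun a _ => Nat.cast_nonneg _)
  have hav : k * ((∑ a ∈ W, D a) / W.card) ≤ 3 * X * R.card := by
    have h1 : ∑ a ∈ W, D a ≤ R.card * (M * X) := by
      rw [hDsum]
      calc ∑ i ∈ R, ((A' i ∩ W).card : ℝ) ≤ ∑ i ∈ R, M * X := by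
            apply sum_le_sum
            intro i hi
            refine le_trans ?_ (hA' i hi).2
            exact_mod_cast Finset.card_le_card Finset.inter_subset_left
        _ = _ := by simp
    calc k * ((∑ a ∈ W, D a) / W.card) ≤ (3 * (W.card / M)) * ((R.card * (M * X)) / W.card) := by
          exact mul_le_mul hk2 (div_le_div_of_nonneg_right h1 hW0.le) (div_nonneg hDW hW0.le) (by positivity)
      _ = 3 * X * R.card * ((W.card / W.card) * (M / M)) := by ring
      _ = _ := by rw [div_self hW0.ne', div_self (by linarith)]; ring
  set bad1 := R.filter (fun i => Disjoint (A i) S) with hb1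
  set bad2 := R.filter (fun i => 36 * X < ((A' i ∩ S).card : ℝ)) with hb2
  have hhit' : 21 * X * (bad1.card : ℝ) + ∑ s ∈ S, D s ≤
    21 * X * R.card * (1 - M / W.card) ^ k + k * ((∑ s ∈ W, D s) / W.card) := by
    convert hhit using 5
    rw [hb1]; congr
  have hDS : 0 ≤ ∑ a ∈ S, D a := sum_nonneg (fun a _ => by positivity)
  have hX21 : 21 * X * R.card * (1 - M / W.card) ^ k ≤ 21 * X * R.card * (1 / 7) := by gcongr
  have hbad1 : (bad1.card : ℝ) ≤ 2 / 7 * R.card := by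
    have : 21 * X * bad1.card ≤ 21 * X * (2 / 7 * R.card) := by linarith
    exact le_of_mul_le_mul_left this (by positivity)
  have hbad2 : (bad2.card : ℝ) ≤ 1 / 6 * R.card := by
    have h1 : ∑ a ∈ S, D a ≤ 6 * X * R.card := by
      have : 0 ≤ 21 * X * (bad1.card : ℝ) := by positivity
      linarith
    rw [hDsum] at h1
    have h2 : bad2.card * (36 * X) ≤ ∑ i ∈ R, ((A' i ∩ S).card : ℝ) := by
      calc bad2.card * (36 * X) = ∑ i ∈ bad2, 36 * X := by simp
        _ ≤ ∑ i ∈ bad2, ((A' i ∩ S).card : ℝ) :=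
          sum_le_sum (fun i hi => (mem_filter.1 hi).2.le)
        _ ≤ _ := sum_le_sum_of_subset_of_nonneg (filter_subset _ _)
          (fun _ _ _ => by positivity)
    have : (36 * X) * bad2.card ≤ (36 * X) * (1 / 6 * R.card) := by linarith
    exact le_of_mul_le_mul_left this (by positivity)
  refine ⟨S, hS, ?_, R \ (bad1 ∪ bad2), Finset.sdiff_subset, ?_, ?_⟩
  · refine le_trans ?_ hk2
    exact_mod_cast hSk
  · have h1 : R.card ≤ (R \ (bad1 ∪ bad2)).card + (bad1.card + bad2.card) := by
      have := Finset.card_le_card_sdiff_add_card (s := R) (t := bad1 ∪ bad2)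
      have := Finset.card_union_le bad1 bad2
      omega
    have h1' : (R.card : ℝ) ≤ (R \ (bad1 ∪ bad2)).card + (bad1.card + bad2.card) := by exact_mod_cast h1
    linarith
  · intro i hi
    simp only [Finset.mem_sdiff, Finset.mem_union, not_or, hb1, hb2, mem_filter, not_and, not_lt] at hi
    obtain ⟨hi, h1, h2⟩ := hi
    refine ⟨?_, h2 hi⟩
    have := h1 hi
    rw [Finset.not_disjoint_iff] at this
    obtain ⟨a, h3, h4⟩ := this
    exact ⟨a, h4, h3⟩
def In (ρ : ℝ) (U c c' : ℝ) (f : Quad) : Prop := |f.ev U - c| ≤ ρ ^ 2 ∧ |f.der U - c'| ≤ ρ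
def sh (a : ℝ) (f : Quad) : Quad := ⟨f.c0 + a, f.c1, f.c2⟩
lemma sh_inj (a : ℝ) : Function.Injective (sh a) := by
  intro f g h
  simp only [sh, Quad.mk.injEq] at h
  ext
  · linarith
  · exact h.2.1
  linarith
lemma sh_ev (a x : ℝ) (f : Quad) : (sh a f).ev x = f.ev x + a := by simp only [sh, ev]; ring
lemma sh_der (a x : ℝ) (f : Quad) : (sh a f).der x = f.der x := by simp only [sh, der]
def vx (f g : Quad) : ℝ := - (g.c1 - f.c1) / (2 * (g.c2 - f.c2))
lemma vx_near' {ρ U c c' : ℝ} {f g : Quad} (hf : In ρ U c c' f) (hg : In ρ U c c' g)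
    (hk : 1 ≤ g.c2 - f.c2) : (g.c2 - f.c2) * |vx f g - U| ≤ ρ := by
  have h1 : |g.der U - f.der U| ≤ 2 * ρ := by
    have : g.der U - f.der U = (g.der U - c') - (f.der U - c') := by ring
    rw [this]; exact (abs_sub _ _).trans (by linarith [hf.2, hg.2])
  have h2 : vx f g - U = -(g.der U - f.der U) / (2 * (g.c2 - f.c2)) := by
    simp only [vx, der]; field_simp; ring
  rw [h2, abs_div, abs_neg, abs_of_pos (show 0 < 2 * (g.c2 - f.c2) by linarith)]
  have h3 : (g.c2 - f.c2) * (|g.der U - f.der U| / (2 * (g.c2 - f.c2))) = |g.der U - f.der U| / 2 := by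
    grind
  rw [h3]; linarith
lemma vx_near {ρ U c c' : ℝ} {f g : Quad} (hf : In ρ U c c' f) (hg : In ρ U c c' g)
    (hk : 1 ≤ g.c2 - f.c2) : |vx f g - U| ≤ ρ := by
  have h1 : |g.der U - f.der U| ≤ 2 * ρ := by
    have : g.der U - f.der U = (g.der U - c') - (f.der U - c') := by ring
    rw [this]; exact (abs_sub _ _).trans (by linarith [hf.2, hg.2])
  have h2 : vx f g - U = -(g.der U - f.der U) / (2 * (g.c2 - f.c2)) := by
    simp only [vx, der]; field_simp; ring
  rw [h2, abs_div, abs_neg, abs_of_pos (show 0 < 2 * (g.c2 - f.c2) by linarith),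
    div_le_iff₀ (by linarith)]
  have : 0 ≤ ρ := (abs_nonneg _).trans hf.2
  linarith [mul_le_mul_of_nonneg_left hk this]
lemma tan_edge {ρ U c c' : ℝ} {f g : Quad} (hρ : 0 < ρ) (hf : In ρ U c c' f) (hg : In ρ U c c' g)
    (hk : 1 ≤ g.c2 - f.c2) (hk2 : g.c2 - f.c2 ≤ 2) :
    Tan (11 * ρ) (sh (4 * ρ ^ 2) f) g (vx f g) := by
  have hv := vx_near hf hg hk
  set κ := g.c2 - f.c2 with hκ
  set v := vx f g with hvd
  have hc1 : g.c1 - f.c1 = -2 * κ * v := by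
    rw [hvd, vx, ← hκ]; field_simp
  have hD : g.ev U - f.ev U = (g.c0 - f.c0) - κ * v ^ 2 + κ * (U - v) ^ 2 := by
    have : g.ev U - f.ev U = (g.c0 - f.c0) + (g.c1 - f.c1) * U + κ * U ^ 2 := by
      rw [hκ]; simp only [ev]; ring
    rw [this, hc1]; ring
  have h1 := abs_le.1 hf.1
  have h2 := abs_le.1 hg.1
  have hsq : (U - v) ^ 2 ≤ ρ ^ 2 := by
    rw [abs_sub_comm] at hv; exact sq_le_sq' (by linarith [(abs_le.1 hv).1]) (abs_le.1 hv).2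
  have hs0 := sq_nonneg (U - v)
  refine ⟨4 * ρ ^ 2 - (g.c0 - f.c0) + κ * v ^ 2, κ, ?_, ?_, hk, hk2, ?_⟩
  · have h3 : κ * (U - v) ^ 2 ≤ κ * ρ ^ 2 := by gcongr
    linarith [sq_pos_of_pos hρ, mul_le_mul_of_nonneg_right hk2 (sq_nonneg ρ), mul_nonneg (show 0 ≤ κ by linarith) hs0]
  · have h4 : κ * |v - U| ≤ ρ := vx_near' hf hg hk
    have h5 : (κ * |v - U|) ^ 2 ≤ ρ ^ 2 := by gcongr
    rw [mul_pow, sq_abs] at h5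
    have h3 : κ * (U - v) ^ 2 ≤ ρ ^ 2 := by linarith [mul_nonneg (mul_nonneg (show 0 ≤ κ by linarith) hs0) (sub_nonneg.2 hk)]
    linarith [sq_pos_of_pos hρ, mul_nonneg (show 0 ≤ κ by linarith) hs0]
  · ext
    · simp only [sh]; ring
    · simp only [sh]; linarith
    · simp only [sh]; linarith
lemma near_Nb {ρ U c c' v : ℝ} {f s : Quad} (hρ : 0 < ρ) (hf : In ρ U c c' f) (hv : |v - U| ≤ ρ)
    (hl : |s.c2 - f.c2| ≤ 1 / 2)
    (h : Nb (11 * ρ) f v s) : In (112 * ρ) U c c' s := by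
  obtain ⟨h1, h2⟩ := h
  have e1 : s.ev U - c = (s.ev v - f.ev v) + (s.der v - f.der v) * (U - v) +
    (s.c2 - f.c2) * (U - v) ^ 2 + (f.ev U - c) := by simp only [ev, der]; ring
  have e2 : s.der U - c' = (s.der v - f.der v) + 2 * (s.c2 - f.c2) * (U - v) + (f.der U - c') := by
    simp only [der]; ring
  rw [abs_sub_comm] at hv
  have a1 : |(s.der v - f.der v) * (U - v)| ≤ 10 * (11 * ρ) * ρ := by
    rw [abs_mul]; gcongr
  have a2 : |(s.c2 - f.c2) * (U - v) ^ 2| ≤ 1 / 2 * ρ ^ 2 := by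
    rw [abs_mul, abs_pow]; gcongr
  have a3 : |2 * (s.c2 - f.c2) * (U - v)| ≤ 2 * (1 / 2) * ρ := by
    rw [abs_mul, abs_mul, abs_two]; gcongr
  have hr := sq_pos_of_pos hρ
  constructor
  · rw [e1]
    refine (abs_add_le _ _).trans ?_
    have := (abs_add_le ((s.ev v - f.ev v) + (s.der v - f.der v) * (U - v)) ((s.c2 - f.c2) * (U - v) ^ 2))
    have := (abs_add_le (s.ev v - f.ev v) ((s.der v - f.der v) * (U - v)))
    have := hf.1
    nlinarith
  · rw [e2]
    refine (abs_add_le _ _).trans ?_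
    have := abs_add_le (s.der v - f.der v) (2 * (s.c2 - f.c2) * (U - v))
    have := hf.2
    linarith
set_option maxHeartbeats 1000000 in
theorem QT {ι : Type*} [DecidableEq ι] (R : Finset ι) (U c c' : ι → ℝ) (W B : Finset Quad) (ρ M N X Λ : ℝ) (Lv : ℕ)
    (hρ : 0 < ρ) (hρ1 : ρ ≤ 1) (hU : ∀ i ∈ R, |U i| ≤ 1)
    (lW : ∀ f ∈ W, ∀ f' ∈ W, |f.c2 - f'.c2| ≤ 1 / 2)
    (lB : ∀ f ∈ B, ∀ f' ∈ B, |f.c2 - f'.c2| ≤ 1 / 2)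
    (lWB : ∀ f ∈ W, ∀ g ∈ B, 1 ≤ g.c2 - f.c2 ∧ g.c2 - f.c2 ≤ 2)
    (hM : 1 ≤ M) (hN : 1 ≤ N) (hX : 1 ≤ X)
    (hW1 : ∀ i ∈ R, M ≤ (W.filter (In ρ (U i) (c i) (c' i))).card)
    (hW2 : ∀ i ∈ R, ((W.filter (In (112 * ρ) (U i) (c i) (c' i))).card : ℝ) ≤ M * X)
    (hB1 : ∀ i ∈ R, N ≤ (B.filter (In ρ (U i) (c i) (c' i))).card)
    (hB2 : ∀ i ∈ R, ((B.filter (In (112 * ρ) (U i) (c i) (c' i))).card : ℝ) ≤ N * X)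
    (hnc : ∀ i ∈ R, ∀ j ∈ R, i ≠ j → ∀ f ∈ W ∪ B, In ρ (U i) (c i) (c' i) f →
      In ρ (U j) (c j) (c' j) f → 13 * ρ ≤ |U i - U j|)
    (hΛ : 100 ≤ Λ) (hXΛ : 36 * X ≤ Λ) (hLv : (Lv : ℝ) ≤ Λ) (hLvρ : 5 ≤ 2 ^ Lv * (11 * ρ))
    (hlog : 8 * ((W.card : ℝ) * B.card) * W.card ≤ Real.exp Λ)
    (hlog' : 8 * ((W.card : ℝ) * B.card) * B.card ≤ Real.exp Λ) :
    (R.card : ℝ) ≤ 36 * Λ ^ 7 * (((W.card : ℝ) * B.card / (M * N)) ^ ((3:ℝ)/4) + W.card / M + B.card / N) := by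
  rcases R.eq_empty_or_nonempty with hR | hR
  · rw [hR]; simp; positivity
  obtain ⟨SW, hSW, hSWc, R1, hR1, hR1c, hR1p⟩ := sample R W (fun i => W.filter (In ρ (U i) (c i) (c' i)))
    (fun i => W.filter (In (112 * ρ) (U i) (c i) (c' i))) M X hM hX hR
    (fun i hi => ⟨filter_subset _ _, hW1 i hi⟩) (fun i hi => ⟨filter_subset _ _, hW2 i hi⟩)
  have hR0 : (0:ℝ) < R.card := by exact_mod_cast hR.card_pos
  have hR1ne : R1.Nonempty := by
    rw [← card_pos]
    have : (0:ℝ) < R1.card := by linarith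
    exact_mod_cast this
  obtain ⟨SB, hSB, hSBc, R2, hR2, hR2c, hR2p⟩ := sample R1 B (fun i => B.filter (In ρ (U i) (c i) (c' i)))
    (fun i => B.filter (In (112 * ρ) (U i) (c i) (c' i))) N X hN hX hR1ne
    (fun i hi => ⟨filter_subset _ _, hB1 i (hR1 hi)⟩)
    (fun i hi => ⟨filter_subset _ _, hB2 i (hR1 hi)⟩)
  have hex : ∀ i, ∃ f g, i ∈ R2 → (f ∈ SW ∧ In ρ (U i) (c i) (c' i) f) ∧ (g ∈ SB ∧ In ρ (U i) (c i) (c' i) g) := by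
    intro i
    by_cases hi : i ∈ R2
    · grind
    · exact ⟨⟨0,0,0⟩, ⟨0,0,0⟩, fun h => absurd h hi⟩
  choose F G hFG using hex
  have hFW : ∀ i ∈ R2, F i ∈ W := fun i hi => hSW (hFG i hi).1.1
  have hGB : ∀ i ∈ R2, G i ∈ B := fun i hi => hSB (hFG i hi).2.1
  have hv : ∀ i ∈ R2, |vx (F i) (G i) - U i| ≤ ρ := fun i hi =>
    vx_near (hFG i hi).1.2 (hFG i hi).2.2 (lWB _ (hFW i hi) _ (hGB i hi)).1
  set a := 4 * ρ ^ 2 with ha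
  have hvsep : ∀ i ∈ R2, ∀ j ∈ R2, i ≠ j → (F i = F j ∨ G i = G j) →
      11 * ρ ≤ |vx (F i) (G i) - vx (F j) (G j)| := by
    intro i hi j hj hij hor
    have h1 : 13 * ρ ≤ |U i - U j| := by
      grind
    have h2 := abs_sub_le (U i) (vx (F i) (G i)) (U j)
    have h3 := abs_sub_le (vx (F i) (G i)) (vx (F j) (G j)) (U j)
    have h4 := hv i hi
    rw [abs_sub_comm] at h4
    have h5 := hv j hj
    linarith
  have hush : ∀ f g, vx (sh (-a) (sh a f)) g = vx f g := by
    intro f g; simp [vx, sh]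
  let C : Cfg :=
    { W := SW.image (sh a)
      B := SB
      H := R2.image (fun i => (sh a (F i), G i))
      u := fun f g => vx (sh (-a) f) g
      ρ := 11 * ρ
      hρ := by positivity
      sub := by
        grind
      tan := by
        intro f g h
        obtain ⟨i, hi, he⟩ := Finset.mem_image.1 h
        simp only [Prod.mk.injEq] at he
        obtain ⟨rfl, rfl⟩ := he
        rw [hush]
        have := lWB _ (hFW i hi) _ (hGB i hi)
        exact tan_edge hρ (hFG i hi).1.2 (hFG i hi).2.2 this.1 this.2
      sepf := by
        intro f g g' h h' hne
        obtain ⟨i, hi, he⟩ := Finset.mem_image.1 h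
        simp only [Prod.mk.injEq] at he
        obtain ⟨rfl, rfl⟩ := he
        obtain ⟨j, hj, he⟩ := Finset.mem_image.1 h'
        simp only [Prod.mk.injEq] at he
        obtain ⟨he, rfl⟩ := he
        have he := sh_inj _ he
        grind
      sepg := by
        grind
      rng := by
        intro f g h
        obtain ⟨i, hi, he⟩ := Finset.mem_image.1 h
        simp only [Prod.mk.injEq] at he
        obtain ⟨rfl, rfl⟩ := he
        rw [hush]
        have h1 := hv i hi
        have h2 := hU i (hR1 (hR2 hi))
        have h3 := abs_sub_abs_le_abs_sub (vx (F i) (G i)) (U i)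
        linarith
      lW := by
        intro f hf f' hf'
        obtain ⟨p, hp, rfl⟩ := Finset.mem_image.1 hf
        obtain ⟨p', hp', rfl⟩ := Finset.mem_image.1 hf'
        exact lW p (hSW hp) p' (hSW hp') }
  have hWc : C.W.card = SW.card := Finset.card_image_of_injective _ (sh_inj a)
  have hBc : C.B.card = SB.card := rfl
  have hHc : C.H.card = R2.card := by
    apply card_image_of_injOn
    intro i hi j hj he
    simp only [Prod.mk.injEq] at he
    by_contra hij
    have h1 := sh_inj _ he.1
    have := hvsep i hi j hj hij (Or.inl h1)
    rw [h1, he.2] at this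
    simp at this
    linarith
  have hWle : (SW.card : ℝ) ≤ W.card := by exact_mod_cast Finset.card_le_card hSW
  have hBle : (SB.card : ℝ) ≤ B.card := by exact_mod_cast Finset.card_le_card hSB
  have hHle : (C.H.card : ℝ) ≤ (W.card : ℝ) * B.card := by
    have : C.H ⊆ C.W ×ˢ C.B := by
      rintro ⟨f, g⟩ h; exact mem_product.2 (C.sub f g h)
    have := Finset.card_le_card this
    rw [card_product, hWc, hBc] at this
    have h2 : (C.H.card : ℝ) ≤ (SW.card : ℝ) * SB.card := by exact_mod_cast this
    exact h2.trans (by gcongr)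
  have hX0 : 0 ≤ 36 * X := by linarith
  have hmain := Cfg.core3 (C := C) (Λ := Λ) (Lv := Lv) (μ := ⌊36 * X⌋₊) hΛ
    (fun f hf f' hf' => lB f (hSB hf) f' (hSB hf')) hLv ((Nat.floor_le hX0).trans hXΛ)
    (by rw [hWc]; refine le_trans ?_ hlog; gcongr) (by rw [hBc]; refine le_trans ?_ hlog'; gcongr)
    hLvρ ?_ ?_
  · rw [hWc, hBc, hHc] at hmain
    have hpw : ((SW.card : ℝ) * SB.card) ^ ((3:ℝ)/4) ≤ 9 * ((W.card : ℝ) * B.card / (M * N)) ^ ((3:ℝ)/4) := by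
      have h1 : (SW.card : ℝ) * SB.card ≤ 9 * ((W.card : ℝ) * B.card / (M * N)) := by
        calc (SW.card : ℝ) * SB.card ≤ (3 * (W.card / M)) * (3 * (B.card / N)) := by gcongr
          _ = _ := by field_simp; ring
      calc ((SW.card : ℝ) * SB.card) ^ ((3:ℝ)/4) ≤ (9 * ((W.card : ℝ) * B.card / (M * N))) ^ ((3:ℝ)/4) := by
            gcongr
        _ = 9 ^ ((3:ℝ)/4) * ((W.card : ℝ) * B.card / (M * N)) ^ ((3:ℝ)/4) := by
            rw [Real.mul_rpow (by norm_num) (by positivity)]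
        _ ≤ 9 * _ := by
          gcongr
          calc (9:ℝ) ^ ((3:ℝ)/4) ≤ 9 ^ (1:ℝ) := by
                apply Real.rpow_le_rpow_of_exponent_le <;> norm_num
            _ = 9 := by simp
    calc (R.card : ℝ) ≤ 4 * R2.card := by linarith
      _ ≤ 4 * (Λ ^ 7 * (9 * ((W.card : ℝ) * B.card / (M * N)) ^ ((3:ℝ)/4) + 3 * (W.card / M) + 3 * (B.card / N))) := by
        refine mul_le_mul_of_nonneg_left (hmain.trans ?_) (by norm_num)
        refine mul_le_mul_of_nonneg_left ?_ (by positivity)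
        linarith
      _ ≤ 4 * (Λ ^ 7 * (9 * (((W.card : ℝ) * B.card / (M * N)) ^ ((3:ℝ)/4) + W.card / M + B.card / N))) := by
        refine mul_le_mul_of_nonneg_left ?_ (by norm_num)
        refine mul_le_mul_of_nonneg_left ?_ (by positivity)
        linarith
      _ = _ := by ring
  · intro f g h
    obtain ⟨i, hi, he⟩ := Finset.mem_image.1 h
    simp only [Prod.mk.injEq] at he
    obtain ⟨rfl, rfl⟩ := he
    apply Nat.le_floor
    refine le_trans ?_ (hR1p i (hR2 hi)).2
    rw [Nat.cast_le, ← Finset.card_image_of_injective (_ ∩ SW) (sh_inj a)]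
    apply Finset.card_le_card
    intro s hs
    obtain ⟨hs1, hs2⟩ := mem_filter.1 hs
    obtain ⟨s', hs', rfl⟩ := Finset.mem_image.1 hs1
    apply Finset.mem_image_of_mem
    refine Finset.mem_inter.2 ⟨mem_filter.2 ⟨hSW hs', ?_⟩, hs'⟩
    change Nb (11 * ρ) (sh a (F i)) (vx (sh (-a) (sh a (F i))) (G i)) (sh a s') at hs2
    rw [hush] at hs2
    refine near_Nb hρ (hFG i hi).1.2 (hv i hi) (lW _ (hSW hs') _ (hFW i hi)) ?_
    simpa [Nb, sh_ev, sh_der] using hs2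
  · intro f g h
    obtain ⟨i, hi, he⟩ := Finset.mem_image.1 h
    simp only [Prod.mk.injEq] at he
    obtain ⟨rfl, rfl⟩ := he
    apply Nat.le_floor
    refine le_trans ?_ (hR2p i hi).2
    rw [Nat.cast_le]
    apply Finset.card_le_card
    intro s hs
    obtain ⟨hs1, hs2⟩ := mem_filter.1 hs
    refine Finset.mem_inter.2 ⟨mem_filter.2 ⟨hSB hs1, ?_⟩, hs1⟩
    change Nb (11 * ρ) (G i) (vx (sh (-a) (sh a (F i))) (G i)) s at hs2
    rw [hush] at hs2
    exact near_Nb hρ (hFG i hi).2.2 (hv i hi) (lB _ (hSB hs1) _ (hGB i hi)) hs2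
def indP {ι : Type*} (r : ι → ι → Prop) (T : Finset ι) : Prop := ∀ i ∈ T, ∀ j ∈ T, i ≠ j → ¬ r i j
lemma indep {ι : Type*} [DecidableEq ι] (R : Finset ι) (r : ι → ι → Prop) (hsym : ∀ i j, r i j → r j i) (Q : ℕ)
    (hQ : ∀ i ∈ R, (R.filter (fun j => i = j ∨ r i j)).card ≤ Q) :
    ∃ T ⊆ R, (∀ i ∈ T, ∀ j ∈ T, i ≠ j → ¬ r i j) ∧ R.card ≤ Q * T.card := by
  obtain ⟨T, hT, hmax⟩ := Finset.exists_max_image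
    (R.powerset.filter (fun T => indP r T)) Finset.card ⟨∅, mem_filter.2 ⟨Finset.empty_mem_powerset _, by intro i hi; simp at hi⟩⟩
  obtain ⟨hT1, hT2⟩ := mem_filter.1 hT
  rw [Finset.mem_powerset] at hT1
  refine ⟨T, hT1, hT2, ?_⟩
  have hcov : R ⊆ T.biUnion (fun i => R.filter (fun j => i = j ∨ r i j)) := by
    intro j hj
    rw [Finset.mem_biUnion]
    by_contra hno
    push Not at hno
    have hjT : j ∉ T := fun h => hno j h (mem_filter.2 ⟨hj, Or.inl rfl⟩)
    have hn : ∀ i ∈ T, ¬ r i j := fun i hi h => hno i hi (mem_filter.2 ⟨hj, Or.inr h⟩)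
    have := hmax (insert j T) (by
      rw [mem_filter, Finset.mem_powerset]
      refine ⟨Finset.insert_subset hj hT1, ?_⟩
      intro a ha b hb hab
      rcases Finset.mem_insert.1 ha with ha' | ha' <;> rcases Finset.mem_insert.1 hb with hb' | hb'
      · grind
      · grind
      · grind
      · exact hT2 a ha' b hb' hab)
    grind
  calc R.card ≤ _ := Finset.card_le_card hcov
    _ ≤ ∑ i ∈ T, (R.filter (fun j => i = j ∨ r i j)).card := card_biUnion_le
    _ ≤ ∑ i ∈ T, Q := sum_le_sum (fun i hi => hQ i (hT1 hi))
    _ = _ := by simp [mul_comm]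
lemma pigeon {ι κ : Type*} [DecidableEq κ] (R : Finset ι) (T : Finset κ) (F : ι → κ) (hF : ∀ i ∈ R, F i ∈ T)
    (hR : R.Nonempty) : ∃ t ∈ T, R.card ≤ T.card * (R.filter (fun i => F i = t)).card := by
  have hT : T.Nonempty := by grind
  by_contra hno
  push Not at hno
  have h1 := card_eq_sum_card_fiberwise hF
  have h2 : T.card * R.card = ∑ t ∈ T, T.card * (R.filter (fun i => F i = t)).card := by
    rw [← mul_sum, ← h1]
  have h3 : ∑ t ∈ T, T.card * (R.filter (fun i => F i = t)).card < ∑ t ∈ T, R.card :=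
    Finset.sum_lt_sum_of_nonempty hT hno
  simp only [sum_const, smul_eq_mul] at h3
  omega
lemma growth {P : ℕ → ℝ} {Z T : ℝ} {I : ℕ} (hI : 0 < I) (hZ : 1 ≤ Z) (h0 : 1 ≤ P 0) (hT : P I ≤ T)
    (hTZ : T ≤ Z ^ I) : ∃ j < I, P (j + 1) ≤ Z * P j := by
  by_contra hno
  push Not at hno
  have : ∀ j ≤ I, Z ^ j ≤ P j ∧ (0 < j → Z ^ j < P j) := by
    intro j
    induction j with
    | zero => intro _; simpa using h0
    | succ j ih =>
      intro hj
      have h1 := (ih (by omega)).1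
      have h2 := hno j (by omega)
      have h3 : Z ^ (j + 1) ≤ Z * P j := by rw [pow_succ, mul_comm]; gcongr
      grind
  grind
lemma In_mono {ρ ρ' U c c' : ℝ} {f : Quad} (h0 : 0 ≤ ρ) (h : ρ ≤ ρ') (hf : In ρ U c c' f) : In ρ' U c c' f :=
  ⟨hf.1.trans (by gcongr), hf.2.trans h⟩
def Cfl {ι : Type*} (U c c' : ι → ℝ) (S : Finset Quad) (ρ' : ℝ) (i j : ι) : Prop :=
  ∃ f ∈ S, In ρ' (U i) (c i) (c' i) f ∧ In ρ' (U j) (c j) (c' j) f ∧ |U i - U j| < 13 * ρ'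
set_option maxHeartbeats 1000000 in
theorem QH {ι : Type*} [DecidableEq ι] (R : Finset ι) (U c c' : ι → ℝ) (W B : Finset Quad) (ρ m n Z Λ : ℝ)
    (I Lc Lv Q : ℕ) (hI : 0 < I)
    (hρ : 0 < ρ) (hρ1 : 112 ^ I * ρ ≤ 1) (hU : ∀ i ∈ R, |U i| ≤ 1)
    (lW : ∀ f ∈ W, ∀ f' ∈ W, |f.c2 - f'.c2| ≤ 1 / 2)
    (lB : ∀ f ∈ B, ∀ f' ∈ B, |f.c2 - f'.c2| ≤ 1 / 2)
    (lWB : ∀ f ∈ W, ∀ g ∈ B, 1 ≤ g.c2 - f.c2 ∧ g.c2 - f.c2 ≤ 2)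
    (hm : 0 < m) (hn : 0 < n) (hZ : 1 ≤ Z) (hWB : (W.card : ℝ) * B.card ≤ Z ^ I)
    (hWL : W.card < 2 ^ Lc) (hBL : B.card < 2 ^ Lc)
    (hW1 : ∀ i ∈ R, m ≤ (W.filter (In ρ (U i) (c i) (c' i))).card)
    (hB1 : ∀ i ∈ R, n ≤ (B.filter (In ρ (U i) (c i) (c' i))).card)
    (hnc : ∀ ρ', ρ ≤ ρ' → ρ' ≤ 112 ^ I * ρ → ∀ i ∈ R, (R.filter (fun j => i = j ∨ Cfl U c c' (W ∪ B) ρ' i j)).card ≤ Q)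
    (hΛ : 100 ≤ Λ) (hZΛ : 72 * Z ≤ Λ) (hLv : (Lv : ℝ) ≤ Λ) (hLvρ : 5 ≤ 2 ^ Lv * (11 * ρ))
    (hlog : 8 * ((W.card : ℝ) * B.card) * W.card ≤ Real.exp Λ)
    (hlog' : 8 * ((W.card : ℝ) * B.card) * B.card ≤ Real.exp Λ) :
    (R.card : ℝ) ≤ (I * Lc * Lc * Q) * (144 * Λ ^ 7) *
      (((W.card : ℝ) * B.card / (m * n)) ^ ((3:ℝ)/4) + W.card / m + B.card / n) := by
  rcases R.eq_empty_or_nonempty with hR | hR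
  · rw [hR, Finset.card_empty, Nat.cast_zero]
    positivity
  set Mc : ℕ → ι → ℕ := fun j i => (W.filter (In (112 ^ j * ρ) (U i) (c i) (c' i))).card with hMc
  set Nc : ℕ → ι → ℕ := fun j i => (B.filter (In (112 ^ j * ρ) (U i) (c i) (c' i))).card with hNc
  have h112 : ∀ j : ℕ, ∀ k ≤ j, (112:ℝ) ^ k * ρ ≤ 112 ^ j * ρ := by
    intro j k hk
    gcongr
    norm_num
  have hMmono : ∀ i, ∀ j k, k ≤ j → Mc k i ≤ Mc j i := by
    intro i j k hk
    apply Finset.card_le_card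
    intro f hf
    rw [mem_filter] at hf ⊢
    exact ⟨hf.1, In_mono (by positivity) (h112 j k hk) hf.2⟩
  have hNmono : ∀ i, ∀ j k, k ≤ j → Nc k i ≤ Nc j i := by
    intro i j k hk
    apply Finset.card_le_card
    intro f hf
    rw [mem_filter] at hf ⊢
    exact ⟨hf.1, In_mono (by positivity) (h112 j k hk) hf.2⟩
  have hM0 : ∀ i ∈ R, m ≤ Mc 0 i := by
    intro i hi; simpa [hMc] using hW1 i hi
  have hN0 : ∀ i ∈ R, n ≤ Nc 0 i := by
    intro i hi; simpa [hNc] using hB1 i hi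
  have hMp : ∀ i ∈ R, ∀ j, 0 < Mc j i := by
    intro i hi j
    have h1 : (0:ℝ) < Mc 0 i := hm.trans_le (hM0 i hi)
    exact lt_of_lt_of_le (by exact_mod_cast h1) (hMmono i j 0 (Nat.zero_le _))
  have hNp : ∀ i ∈ R, ∀ j, 0 < Nc j i := by
    intro i hi j
    have h1 : (0:ℝ) < Nc 0 i := hn.trans_le (hN0 i hi)
    exact lt_of_lt_of_le (by exact_mod_cast h1) (hNmono i j 0 (Nat.zero_le _))
  have hMW : ∀ i j, Mc j i ≤ W.card := fun i j => Finset.card_le_card (filter_subset _ _)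
  have hNB : ∀ i j, Nc j i ≤ B.card := fun i j => Finset.card_le_card (filter_subset _ _)
  have hex : ∀ i, ∃ j, i ∈ R → j < I ∧ (Mc (j + 1) i : ℝ) ≤ Z * Mc j i ∧ (Nc (j + 1) i : ℝ) ≤ Z * Nc j i := by
    intro i
    by_cases hi : i ∈ R
    · have hPI : (Mc I i : ℝ) * Nc I i ≤ (W.card : ℝ) * B.card := by
        have := hMW i I
        have := hNB i I
        gcongr
      have hP0 : (1:ℝ) ≤ (Mc 0 i : ℝ) * Nc 0 i := by
        have := Nat.mul_pos (hMp i hi 0) (hNp i hi 0)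
        exact_mod_cast this
      obtain ⟨j, hj, hle⟩ := growth (P := fun j => (Mc j i : ℝ) * Nc j i) hI hZ hP0 hPI hWB
      refine ⟨j, fun _ => ⟨hj, ?_, ?_⟩⟩
      · have h1 : (Nc j i : ℝ) ≤ Nc (j+1) i := by exact_mod_cast hNmono i (j+1) j (by omega)
        have h2 : (0:ℝ) < Nc j i := by exact_mod_cast hNp i hi j
        have : (Mc (j+1) i : ℝ) * Nc j i ≤ (Z * Mc j i) * Nc j i := by
          calc (Mc (j+1) i : ℝ) * Nc j i ≤ Mc (j+1) i * Nc (j+1) i := by gcongr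
            _ ≤ _ := hle
            _ = _ := by ring
        exact le_of_mul_le_mul_right this h2
      · have h1 : (Mc j i : ℝ) ≤ Mc (j+1) i := by exact_mod_cast hMmono i (j+1) j (by omega)
        have h2 : (0:ℝ) < Mc j i := by exact_mod_cast hMp i hi j
        have : (Nc (j+1) i : ℝ) * Mc j i ≤ (Z * Nc j i) * Mc j i := by
          calc (Nc (j+1) i : ℝ) * Mc j i ≤ Nc (j+1) i * Mc (j+1) i := by gcongr
            _ = Mc (j+1) i * Nc (j+1) i := by ring
            _ ≤ _ := hle
            _ = _ := by ring
        exact le_of_mul_le_mul_right this h2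
    · exact ⟨0, fun h => absurd h hi⟩
  choose J hJ using hex
  have hlogl : ∀ a : ℕ, 0 < a → a < 2 ^ Lc → Nat.log 2 a < Lc := fun a ha h =>
    Nat.log_lt_of_lt_pow ha.ne' h
  obtain ⟨⟨j, l, l'⟩, -, hpig⟩ := pigeon R (Finset.range I ×ˢ Finset.range Lc ×ˢ Finset.range Lc)
    (fun i => (J i, Nat.log 2 (Mc (J i) i), Nat.log 2 (Nc (J i) i))) (by
      intro i hi
      simp only [mem_product, Finset.mem_range]
      exact ⟨(hJ i hi).1, hlogl _ (hMp i hi _) ((hMW i _).trans_lt hWL),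
        hlogl _ (hNp i hi _) ((hNB i _).trans_lt hBL)⟩) hR
  simp only [card_product, card_range, Prod.mk.injEq] at hpig
  set R1 := R.filter (fun i => J i = j ∧ Nat.log 2 (Mc (J i) i) = l ∧ Nat.log 2 (Nc (J i) i) = l') with hR1
  have hR1R : R1 ⊆ R := filter_subset _ _
  have hR1ne : R1.Nonempty := by
    rw [← card_pos]
    by_contra h
    have h0 : R1.card = 0 := by omega
    rw [h0] at hpig
    have := hR.card_pos
    omega
  have hjI : j < I := by
    obtain ⟨i, hi⟩ := hR1ne
    have := mem_filter.1 hi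
    rw [← this.2.1]; exact (hJ i this.1).1
  set ρ' := (112:ℝ) ^ j * ρ with hρ'
  have hρ'0 : 0 < ρ' := by positivity
  have hρρ' : ρ ≤ ρ' := by simpa using h112 j 0 (Nat.zero_le _)
  have hρ'I : ρ' ≤ 112 ^ I * ρ := h112 I j hjI.le
  obtain ⟨T, hT, hTi, hTc⟩ := indep R1 (Cfl U c c' (W ∪ B) ρ')
      (by rintro a b ⟨f, h1, h2, h3, h4⟩; exact ⟨f, h1, h3, h2, by rwa [abs_sub_comm]⟩) Q (by
        intro i hi
        refine le_trans ?_ (hnc ρ' hρρ' hρ'I i (hR1R hi))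
        apply Finset.card_le_card
        intro x hx
        rw [mem_filter] at hx ⊢
        exact ⟨hR1R hx.1, hx.2⟩)
  have hTp : ∀ i ∈ T, i ∈ R ∧ J i = j ∧ Nat.log 2 (Mc j i) = l ∧ Nat.log 2 (Nc j i) = l' := by
    intro i hi
    have := mem_filter.1 (hT hi)
    have h2 := this.2.1
    rw [h2] at this
    exact ⟨this.1, h2, this.2.2⟩
  have hMl : ∀ i ∈ T, (2:ℝ) ^ l ≤ Mc j i ∧ (Mc j i : ℝ) ≤ 2 * 2 ^ l := by
    intro i hi
    obtain ⟨h1, h2, h3, h4⟩ := hTp i hi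
    have a1 := Nat.pow_log_le_self 2 (hMp i h1 j).ne'
    have a2 := (Nat.lt_pow_succ_log_self one_lt_two (Mc j i)).le
    rw [h3] at a1 a2
    constructor
    · exact_mod_cast a1
    · rw [Nat.succ_eq_add_one, pow_succ, mul_comm] at a2; exact_mod_cast a2
  have hNl : ∀ i ∈ T, (2:ℝ) ^ l' ≤ Nc j i ∧ (Nc j i : ℝ) ≤ 2 * 2 ^ l' := by
    intro i hi
    obtain ⟨h1, h2, h3, h4⟩ := hTp i hi
    have a1 := Nat.pow_log_le_self 2 (hNp i h1 j).ne'
    have a2 := (Nat.lt_pow_succ_log_self one_lt_two (Nc j i)).le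
    rw [h4] at a1 a2
    constructor
    · exact_mod_cast a1
    · rw [Nat.succ_eq_add_one, pow_succ, mul_comm] at a2; exact_mod_cast a2
  have h112ρ : 112 * ρ' = 112 ^ (j + 1) * ρ := by rw [hρ', pow_succ]; ring
  have key := QT T U c c' W B ρ' (2 ^ l) (2 ^ l') (2 * Z) Λ Lv hρ'0 (hρ'I.trans hρ1)
    (fun i hi => hU i (hTp i hi).1) lW lB lWB (one_le_pow₀ (by norm_num)) (one_le_pow₀ (by norm_num))
    (by linarith) (fun i hi => (hMl i hi).1)
    (by
      intro i hi
      rw [h112ρ]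
      have h1 := (hJ i (hTp i hi).1).2.1
      rw [(hTp i hi).2.1] at h1
      refine h1.trans ?_
      linarith only [mul_le_mul_of_nonneg_left (hMl i hi).2 (show 0 ≤ Z by linarith)])
    (fun i hi => (hNl i hi).1)
    (by
      intro i hi
      rw [h112ρ]
      have h1 := (hJ i (hTp i hi).1).2.2
      rw [(hTp i hi).2.1] at h1
      refine h1.trans ?_
      linarith only [mul_le_mul_of_nonneg_left (hNl i hi).2 (show 0 ≤ Z by linarith)])
    (by
      intro i hi k hk hik f hf h1 h2
      by_contra hlt
      push Not at hlt
      exact hTi i hi k hk hik ⟨f, hf, h1, h2, hlt⟩)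
    hΛ (by linarith) hLv (hLvρ.trans (by gcongr)) hlog hlog'
  have hTne : T.Nonempty := by
    rw [← card_pos]
    by_contra h
    have h0 : T.card = 0 := by omega
    rw [h0] at hTc
    have := hR1ne.card_pos
    omega
  obtain ⟨i0, hi0⟩ := hTne
  have hml : m ≤ 2 * 2 ^ l := by
    refine ((hM0 i0 (hTp i0 hi0).1).trans ?_).trans (hMl i0 hi0).2
    exact_mod_cast hMmono i0 j 0 (Nat.zero_le _)
  have hnl : n ≤ 2 * 2 ^ l' := by
    refine ((hN0 i0 (hTp i0 hi0).1).trans ?_).trans (hNl i0 hi0).2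
    exact_mod_cast hNmono i0 j 0 (Nat.zero_le _)
  have hw0 : (0:ℝ) ≤ W.card := Nat.cast_nonneg _
  have hb0 : (0:ℝ) ≤ B.card := Nat.cast_nonneg _
  have h1 : (0:ℝ) ≤ W.card / m := div_nonneg hw0 hm.le
  have h2 : (0:ℝ) ≤ B.card / n := div_nonneg hb0 hn.le
  have h3 : 0 ≤ (W.card : ℝ) * B.card / (m * n) := div_nonneg (mul_nonneg hw0 hb0) (mul_pos hm hn).le
  have hWM : (W.card : ℝ) / 2 ^ l ≤ 2 * (W.card / m) := by
    rw [← mul_div_assoc, div_le_div_iff₀ (by positivity) hm]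
    linarith only [mul_le_mul_of_nonneg_left hml hw0]
  have hBN : (B.card : ℝ) / 2 ^ l' ≤ 2 * (B.card / n) := by
    rw [← mul_div_assoc, div_le_div_iff₀ (by positivity) hn]
    linarith only [mul_le_mul_of_nonneg_left hnl hb0]
  have hpw : ((W.card : ℝ) * B.card / (2 ^ l * 2 ^ l')) ^ ((3:ℝ)/4) ≤
      4 * ((W.card : ℝ) * B.card / (m * n)) ^ ((3:ℝ)/4) := by
    have h1 : (W.card : ℝ) * B.card / (2 ^ l * 2 ^ l') ≤ 4 * ((W.card : ℝ) * B.card / (m * n)) := by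
      calc (W.card : ℝ) * B.card / (2 ^ l * 2 ^ l') = (W.card / 2 ^ l) * (B.card / 2 ^ l') := by
            rw [div_mul_div_comm]
        _ ≤ (2 * (W.card / m)) * (2 * (B.card / n)) := mul_le_mul hWM hBN (div_nonneg hb0 (by positivity)) (by linarith)
        _ = 4 * ((W.card : ℝ) * B.card / (m * n)) := by rw [← div_mul_div_comm]; ring
    calc _ ≤ (4 * ((W.card : ℝ) * B.card / (m * n))) ^ ((3:ℝ)/4) :=
          Real.rpow_le_rpow (div_nonneg (mul_nonneg hw0 hb0) (by positivity)) h1 (by norm_num)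
      _ = 4 ^ ((3:ℝ)/4) * ((W.card : ℝ) * B.card / (m * n)) ^ ((3:ℝ)/4) := by
          rw [Real.mul_rpow (by norm_num) h3]
      _ ≤ 4 * _ := by
        refine mul_le_mul_of_nonneg_right ?_ (Real.rpow_nonneg h3 _)
        calc (4:ℝ) ^ ((3:ℝ)/4) ≤ 4 ^ (1:ℝ) := by
              apply Real.rpow_le_rpow_of_exponent_le <;> norm_num
          _ = 4 := by simp
  have hTb : (T.card : ℝ) ≤ 144 * Λ ^ 7 * (((W.card : ℝ) * B.card / (m * n)) ^ ((3:ℝ)/4) + W.card / m + B.card / n) := by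
    calc (T.card : ℝ) ≤ 36 * Λ ^ 7 * (4 * (((W.card : ℝ) * B.card / (m * n)) ^ ((3:ℝ)/4) + W.card / m + B.card / n)) := by
          refine key.trans ?_
          refine mul_le_mul_of_nonneg_left ?_ (by positivity)
          linarith
      _ = _ := by ring
  have hRT : (R.card : ℝ) ≤ (I * Lc * Lc * Q) * T.card := by
    have : R.card ≤ (I * (Lc * Lc)) * (Q * T.card) := hpig.trans (Nat.mul_le_mul_left _ hTc)
    calc (R.card : ℝ) ≤ (((I * (Lc * Lc)) * (Q * T.card) : ℕ) : ℝ) := by exact_mod_cast this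
      _ = _ := by push_cast; ring
  calc (R.card : ℝ) ≤ (I * Lc * Lc * Q) * T.card := hRT
    _ ≤ (I * Lc * Lc * Q) * (144 * Λ ^ 7 * (((W.card : ℝ) * B.card / (m * n)) ^ ((3:ℝ)/4) + W.card / m + B.card / n)) := by
      refine mul_le_mul_of_nonneg_left hTb (by positivity)
    _ = _ := by ring
lemma dist_sq2 (v w : Plane) : dist v w ^ 2 = (v 0 - w 0) ^ 2 + (v 1 - w 1) ^ 2 := by
  rw [EuclideanSpace.dist_eq, Real.sq_sqrt (by positivity)]; simp [Fin.sum_univ_two, Real.dist_eq]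
lemma mem_ann {δ : ℝ} {p : Param} (hr : 0 < p.2) (w : Plane) :
    w ∈ annulus δ p ↔ |dist w p.1 - p.2| ≤ δ := by
  have hne : (circ p).Nonempty := by
    unfold circ; exact NormedSpace.sphere_nonempty.2 hr.le
  have key : Metric.infDist w (circ p) = |dist w p.1 - p.2| := by
    apply le_antisymm
    · by_cases hw : w = p.1
      · obtain ⟨z, hz⟩ := hne
        refine (Metric.infDist_le_dist_of_mem hz).trans ?_
        have : dist z p.1 = p.2 := hz
        rw [hw, dist_self, zero_sub, abs_neg, abs_of_pos hr, dist_comm, this]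
      · have hd : 0 < ‖w - p.1‖ := norm_pos_iff.2 (sub_ne_zero.2 hw)
        have hz : p.1 + (p.2 / ‖w - p.1‖) • (w - p.1) ∈ circ p := by
          unfold circ
          rw [mem_sphere, dist_eq_norm, add_sub_cancel_left, norm_smul, Real.norm_eq_abs,
            abs_of_pos (by positivity)]
          field_simp
        refine (Metric.infDist_le_dist_of_mem hz).trans ?_
        rw [dist_eq_norm, dist_eq_norm]
        have : w - (p.1 + (p.2 / ‖w - p.1‖) • (w - p.1)) = (1 - p.2 / ‖w - p.1‖) • (w - p.1) := by
          rw [sub_smul, one_smul]; abel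
        rw [this, norm_smul, Real.norm_eq_abs]
        conv_lhs => rw [← abs_of_pos hd]
        rw [← abs_mul, sub_mul, abs_of_pos hd, div_mul_cancel₀ _ hd.ne', one_mul]
    · apply (Metric.le_infDist hne).2
      intro z hz
      have : dist z p.1 = p.2 := hz
      rw [← this]
      exact abs_dist_sub_le w z p.1
  unfold annulus
  rw [mem_ofPred_eq, key]
def Ch (σ u : ℝ) (r : Param × Plane) : Prop :=
  |u| ≤ 1 ∧ r.2 0 = r.1.1 0 + r.1.2 * (σ * (1 - u ^ 2) / (1 + u ^ 2)) ∧
    r.2 1 = r.1.1 1 + r.1.2 * (2 * u / (1 + u ^ 2))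
def Qd (σ : ℝ) (p : Param) : Quad := ⟨p.2 + σ * p.1 0, 2 * p.1 1, p.2 - σ * p.1 0⟩
lemma unit_chart {e0 e1 : ℝ} (h : e0 ^ 2 + e1 ^ 2 = 1) : ∃ σ, (σ = 1 ∨ σ = -1) ∧ ∃ u : ℝ, |u| ≤ 1 ∧
    e0 = σ * (1 - u ^ 2) / (1 + u ^ 2) ∧ e1 = 2 * u / (1 + u ^ 2) := by
  have : ∃ σ : ℝ, (σ = 1 ∨ σ = -1) ∧ 0 ≤ σ * e0 := by
    grind
  obtain ⟨σ, hσ, h0⟩ := this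
  have hs : σ ^ 2 = 1 := by grind
  have hp : 0 < 1 + σ * e0 := by linarith
  have e1' : |e1| ≤ 1 := abs_le_one_iff_mul_self_le_one.2 (by linarith [sq_nonneg e0])
  have hu2 : 1 + (e1 / (1 + σ * e0)) ^ 2 = 2 / (1 + σ * e0) := by
    rw [div_pow]
    field_simp
    linear_combination h + e0 ^ 2 * hs
  have hu3 : 1 - (e1 / (1 + σ * e0)) ^ 2 = 2 * (σ * e0) / (1 + σ * e0) := by
    grind
  refine ⟨σ, hσ, e1 / (1 + σ * e0), ?_, ?_, ?_⟩
  · rw [abs_div, abs_of_pos hp, div_le_one hp]; linarith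
  · grind
  · rw [hu2]; field_simp
lemma domD_r {p : Param} (h : p ∈ domD) : 1 / 2 ≤ p.2 ∧ p.2 ≤ 1 := h.2
lemma norm_sq2 (v : Plane) : ‖v‖ ^ 2 = v 0 ^ 2 + v 1 ^ 2 := by
  have := dist_sq2 v 0
  simpa using this
lemma domD_x {p : Param} (h : p ∈ domD) : p.1 0 ^ 2 + p.1 1 ^ 2 ≤ 1 / 16 := by
  rw [← norm_sq2]
  have h1 := h.1
  have := norm_nonneg p.1
  nlinarith
lemma chart_ex {r : Param × Plane} (h : IsRectData r) : ∃ σ, (σ = 1 ∨ σ = -1) ∧ ∃ u, Ch σ u r := by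
  obtain ⟨hd, hv⟩ := h
  obtain ⟨hr, -⟩ := domD_r hd
  have hv' : dist r.2 r.1.1 = r.1.2 := hv
  have h2 := dist_sq2 r.2 r.1.1
  rw [hv'] at h2
  obtain ⟨σ, hσ, u, hu, h0, h1⟩ := unit_chart (e0 := (r.2 0 - r.1.1 0) / r.1.2)
    (e1 := (r.2 1 - r.1.1 1) / r.1.2) (by
      rw [div_pow, div_pow, ← add_div, ← h2]
      apply div_self; positivity)
  refine ⟨σ, hσ, u, hu, ?_, ?_⟩
  · rw [← h0]; field_simp; ring
  · rw [← h1]; field_simp; ring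
lemma mk2_0 (a b : ℝ) : (mk2 a b) 0 = a := by simp [mk2]
lemma mk2_1 (a b : ℝ) : (mk2 a b) 1 = b := by simp [mk2]
lemma eE {σ u : ℝ} (hσ : σ = 1 ∨ σ = -1) :
    (σ * (1 - u ^ 2) / (1 + u ^ 2)) ^ 2 + (2 * u / (1 + u ^ 2)) ^ 2 = 1 := by
  have hs : σ ^ 2 = 1 := by grind
  have : (1 + u ^ 2) ≠ 0 := by positivity
  grind
lemma close_real {r0 r a b h s Sg δ' N Np Nm : ℝ} (hr0 : 1/2 ≤ r0) (hr0' : r0 ≤ 1)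
    (hr : 1/2 ≤ r) (hr' : r ≤ 1)
    (ha : |a| ≤ 1/2) (hS : 0 < Sg) (hS1 : Sg ≤ 1) (hδ : 0 < δ') (hδ' : δ' ≤ 1/4)
    (hh : h = (Sg/2)^2 / (2*r0)) (hs0 : 0 ≤ s) (hs : s^2 = (Sg/2)^2 - h^2)
    (hN : N^2 = (r0 - a)^2 + b^2) (hNp : Np^2 = (r0-h-a)^2 + (s-b)^2) (hNm : Nm^2 = (r0-h-a)^2 + (-s-b)^2)
    (h0 : |N - r| ≤ δ') (h1 : |Np - r| ≤ δ') (h2 : |Nm - r| ≤ δ') :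
    |b| * Sg ≤ 8 * δ' ∧ |a| * Sg^2 ≤ 20 * δ' ∧ |r - r0 + a| ≤ δ' + 4 * b^2 := by
  rw [abs_le] at h0 h1 h2
  have hhr : h * (2 * r0) = (Sg/2)^2 := by rw [hh]; field_simp
  have hh0 : 0 < h := by rw [hh]; positivity
  have hhlo : Sg^2 ≤ 8 * h := by nlinarith
  have hhhi : h ≤ Sg / 4 := by nlinarith
  have hslo : 2 / 5 * Sg ≤ s := by
    apply le_of_sq_le_sq _ hs0
    nlinarith
  have hr2 : 2 * r0 * h = h^2 + s^2 := by rw [hs]; linarith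
  have d1 : Np^2 - N^2 = 2*h*a - 2*s*b := by linear_combination hNp - hN - hr2
  have d2 : Nm^2 - N^2 = 2*h*a + 2*s*b := by linear_combination hNm - hN - hr2
  have f1 : |Np^2 - N^2| ≤ 5 * δ' := by
    have : Np^2 - N^2 = (Np - N) * (Np + N) := by ring
    rw [this, abs_mul]
    calc |Np - N| * |Np + N| ≤ (2 * δ') * (5/2) := by
          gcongr
          · rw [abs_le]; constructor <;> linarith
          · rw [abs_le]; constructor <;> linarith
      _ = _ := by ring
  have f2 : |Nm^2 - N^2| ≤ 5 * δ' := by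
    have : Nm^2 - N^2 = (Nm - N) * (Nm + N) := by ring
    rw [this, abs_mul]
    calc |Nm - N| * |Nm + N| ≤ (2 * δ') * (5/2) := by
          gcongr
          · rw [abs_le]; constructor <;> linarith
          · rw [abs_le]; constructor <;> linarith
      _ = _ := by ring
  rw [d1, abs_le] at f1
  rw [d2, abs_le] at f2
  have g1 : h * |a| ≤ 5/2 * δ' := by
    rw [← abs_of_pos hh0, ← abs_mul, abs_le]; constructor <;> linarith
  have g2 : s * |b| ≤ 5/2 * δ' := by
    rw [← abs_of_nonneg hs0, ← abs_mul, abs_le]; constructor <;> linarith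
  have hb0 := abs_nonneg b
  have ha0 := abs_nonneg a
  refine ⟨?_, ?_, ?_⟩
  · linarith [mul_le_mul_of_nonneg_right hslo hb0]
  · linarith [mul_le_mul_of_nonneg_right hhlo ha0]
  · rw [abs_le] at ha
    have hNc : r0 - a ≤ N := le_of_sq_le_sq (by rw [hN]; linarith [sq_nonneg b]) (by linarith)
    have hNc2 : N - (r0 - a) ≤ 4 * b^2 := by
      have q1 := mul_le_mul_of_nonneg_left (show 1/4 ≤ N + (r0 - a) by linarith) (sub_nonneg.2 hNc)
      linarith
    rw [abs_le]; constructor <;> linarith [sq_nonneg b]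
lemma dot_le {x y e f : ℝ} {c : ℝ} (hc : 0 ≤ c) (hx : x ^ 2 + y ^ 2 ≤ c ^ 2) (he : e ^ 2 + f ^ 2 = 1) :
    |x * e + y * f| ≤ c := by
  apply abs_le_of_sq_le_sq _ hc
  nlinarith [sq_nonneg (x * f - y * e)]
set_option maxHeartbeats 1000000 in
lemma close_rect {δ Sg δ' σ u : ℝ} {r : Param × Plane} {p : Param} (hσ : σ = 1 ∨ σ = -1)
    (hr : IsRectData r) (hc : Ch σ u r) (hp : p ∈ domD) (hS : 0 < Sg) (hS1 : Sg ≤ 1) (hδ : 0 < δ)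
    (hδ0 : 0 < δ') (hδ' : δ' ≤ 1/4) (hsub : rect δ Sg r.1 r.2 ⊆ annulus δ' p) :
    ∃ g a b : ℝ, |b| * Sg ≤ 8 * δ' ∧ |a| * Sg^2 ≤ 20 * δ' ∧ |g| ≤ δ' + 4 * b^2 ∧
      (Qd σ p).ev u - (Qd σ r.1).ev u = (1 + u^2) * g ∧
      (Qd σ p).der u - (Qd σ r.1).der u = 2 * u * g + 2 * σ * b ∧
      |(Qd σ p).c2 - (Qd σ r.1).c2| ≤ |g| + 2 * |a| + |b| := by
  obtain ⟨⟨x, r0⟩, v⟩ := r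
  obtain ⟨y, r1⟩ := p
  obtain ⟨hu, hv0, hv1⟩ := hc
  have hrd := domD_r hr.1
  have hpd := domD_r hp
  have hrx := domD_x hr.1
  have hpx := domD_x hp
  simp only at hv0 hv1 hrd hpd hrx hpx
  have hs : σ ^ 2 = 1 := by rcases hσ with h | h <;> rw [h] <;> norm_num
  have hE := eE (u := u) hσ
  set E0 := σ * (1 - u ^ 2) / (1 + u ^ 2) with hE0
  set E1 := 2 * u / (1 + u ^ 2) with hE1
  have hk : (1 + u^2) ≠ 0 := by positivity
  have kE0 : (1 + u^2) * E0 = σ * (1 - u^2) := by rw [hE0]; field_simp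
  have kE1 : (1 + u^2) * E1 = 2 * u := by rw [hE1]; field_simp
  set a := (y 0 - x 0) * E0 + (y 1 - x 1) * E1 with ha
  set b := (y 0 - x 0) * (-E1) + (y 1 - x 1) * E0 with hb
  set h := (Sg/2)^2 / (2*r0) with hh
  have hr0 : 0 < r0 := by linarith
  have hr1 : 0 < r1 := by linarith
  have hhr : h * (2 * r0) = (Sg/2)^2 := by rw [hh]; field_simp
  have hh0 : 0 < h := by positivity
  have hhhi : h ≤ Sg / 4 := by
    have q1 := mul_le_mul_of_nonneg_left (show 1 ≤ 2 * r0 by linarith) hh0.le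
    have q2 := mul_le_mul_of_nonneg_left hS1 hS.le
    linarith
  have hs2 : 0 ≤ (Sg/2)^2 - h^2 := by
    have q1 := pow_le_pow_left₀ hh0.le hhhi 2
    linarith [sq_nonneg Sg]
  set s := Real.sqrt ((Sg/2)^2 - h^2) with hsd
  have hs0 : 0 ≤ s := Real.sqrt_nonneg _
  have hsq : s^2 = (Sg/2)^2 - h^2 := Real.sq_sqrt hs2
  have hmem : ∀ s' : ℝ, ∀ h' : ℝ, (r0 - h')^2 + s'^2 = r0^2 → h'^2 + s'^2 ≤ Sg^2 →
      |dist (mk2 (x 0 + (r0 - h') * E0 - s' * E1) (x 1 + (r0 - h') * E1 + s' * E0)) y - r1| ≤ δ' := by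
    intro s' h' hs' hs''
    have : mk2 (x 0 + (r0 - h') * E0 - s' * E1) (x 1 + (r0 - h') * E1 + s' * E0) ∈ annulus δ' (y, r1) := by
      apply hsub
      refine ⟨?_, ?_⟩
      · rw [mem_ann hr0]
        have : dist (mk2 (x 0 + (r0 - h') * E0 - s' * E1) (x 1 + (r0 - h') * E1 + s' * E0)) x = r0 := by
          rw [← sq_eq_sq₀ dist_nonneg hr0.le, dist_sq2, mk2_0, mk2_1]
          linear_combination hs' + ((r0 - h')^2 + s'^2) * hE
        simp only [this, sub_self, abs_zero]; exact hδ.le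
      · rw [mem_closedBall]
        apply le_of_sq_le_sq _ hS.le
        rw [dist_sq2, mk2_0, mk2_1]
        simp only
        rw [hv0, hv1]
        refine le_trans (le_of_eq ?_) hs''
        linear_combination (h'^2 + s'^2) * hE
    rw [mem_ann (p := (y, r1)) hr1] at this
    exact this
  have hd : ∀ s' h' : ℝ, dist (mk2 (x 0 + (r0 - h') * E0 - s' * E1) (x 1 + (r0 - h') * E1 + s' * E0)) y ^ 2
      = (r0 - h' - a)^2 + (s' - b)^2 := by
    intro s' h'
    rw [dist_sq2, mk2_0, mk2_1, ha, hb]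
    linear_combination ((r0 - h')^2 + s'^2 - (y 0 - x 0)^2 - (y 1 - x 1)^2) * hE
  have hdx : (y 0 - x 0)^2 + (y 1 - x 1)^2 ≤ (1/2)^2 := by
    linarith [sq_nonneg (y 0 + x 0), sq_nonneg (y 1 + x 1)]
  have key := close_real (r0 := r0) (r := r1) (a := a) (b := b) (h := h) (s := s) (Sg := Sg) (δ' := δ')
    hrd.1 hrd.2 hpd.1 hpd.2 (dot_le (by norm_num) hdx hE) hS hS1 hδ0 hδ' hh hs0 hsq
    (by rw [hd 0 0]; ring) (by rw [hd s h]) (by rw [hd (-s) h])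
    (hmem 0 0 (by ring) (by linarith [sq_nonneg Sg])) (hmem s h (by rw [hsq]; linarith) (by rw [hsq]; linarith [sq_nonneg Sg]))
    (hmem (-s) h (by rw [neg_sq, hsq]; linarith) (by rw [neg_sq, hsq]; linarith [sq_nonneg Sg]))
  have hx0 : y 0 - x 0 = a * E0 - b * E1 := by rw [ha, hb]; linear_combination (-(y 0 - x 0)) * hE
  refine ⟨r1 - r0 + a, a, b, key.1, key.2.1, key.2.2, ?_, ?_, ?_⟩
  · simp only [Qd, ev, ha]
    linear_combination (-(y 0 - x 0)) * kE0 - (y 1 - x 1) * kE1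
  · simp only [Qd, der, ha, hb]
    grind
  · simp only [Qd]
    have hE0' : |E0| ≤ 1 := abs_le_of_sq_le_sq (by rw [one_pow]; linarith [sq_nonneg E1]) zero_le_one
    have hE1' : |E1| ≤ 1 := abs_le_of_sq_le_sq (by rw [one_pow]; linarith [sq_nonneg E0]) zero_le_one
    have hσ1 : |σ| = 1 := by rcases hσ with h | h <;> rw [h] <;> norm_num
    have e : r1 - σ * y 0 - (r0 - σ * x 0) = (r1 - r0 + a) - a - σ * (a * E0 - b * E1) := by
      rw [← hx0]; ring
    rw [e]
    have t1 : |σ * (a * E0 - b * E1)| ≤ |a| + |b| := by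
      rw [abs_mul, hσ1, one_mul]
      refine (abs_sub _ _).trans ?_
      rw [abs_mul, abs_mul]
      exact add_le_add (mul_le_of_le_one_right (abs_nonneg a) hE0') (mul_le_of_le_one_right (abs_nonneg b) hE1')
    have t2 := abs_sub ((r1 - r0 + a) - a) (σ * (a * E0 - b * E1))
    have t3 := abs_sub (r1 - r0 + a) a
    linarith
lemma closeA_num {δ Sg t A a b g : ℝ} (hS : 0 < Sg) (hS1 : Sg ≤ 1) (ht : 0 < t) (ht1 : t ≤ 1) (hA : 1 ≤ A)
    (hSt : Sg ^ 2 * t = δ) (hb : |b| * Sg ≤ 8 * (A * δ)) (ha : |a| * Sg^2 ≤ 20 * (A * δ))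
    (hg : |g| ≤ A * δ + 4 * b^2) :
    |b| ≤ 8 * (A^2 * (Sg * t)) ∧ |a| ≤ 20 * (A^2 * t) ∧ |g| ≤ 257 * (A^2 * δ) := by
  have hAA : A ≤ A^2 := le_self_pow₀ hA two_ne_zero
  have b1 : |b| ≤ 8 * (A * (Sg * t)) := by
    have : |b| * Sg ≤ (8 * (A * (Sg * t))) * Sg := by rw [← hSt] at hb; linarith
    exact le_of_mul_le_mul_right this hS
  have a1 : |a| ≤ 20 * (A * t) := by
    have : |a| * Sg^2 ≤ (20 * (A * t)) * Sg^2 := by rw [← hSt] at ha; linarith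
    exact le_of_mul_le_mul_right this (by positivity)
  have hδ0 : 0 < δ := by rw [← hSt]; positivity
  refine ⟨b1.trans ?_, a1.trans ?_, hg.trans ?_⟩
  · gcongr
  · gcongr
  · have : b^2 ≤ 64 * (A^2 * δ) := by
      calc b^2 = |b|^2 := (sq_abs b).symm
        _ ≤ (8 * (A * (Sg * t)))^2 := by gcongr
        _ = 64 * (A^2 * (Sg^2 * t * t)) := by ring
        _ ≤ 64 * (A^2 * (Sg^2 * t * 1)) := by gcongr
        _ = _ := by rw [mul_one, hSt]
    have : A * δ ≤ A^2 * δ := by gcongr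
    linarith
lemma closeA {δ Sg t A σ u : ℝ} {r : Param × Plane} {p : Param} (hσ : σ = 1 ∨ σ = -1)
    (hr : IsRectData r) (hc : Ch σ u r) (hp : p ∈ domD) (hS : 0 < Sg) (hS1 : Sg ≤ 1)
    (ht : 0 < t) (ht1 : t ≤ 1) (hA : 1 ≤ A) (hSt : Sg ^ 2 * t = δ)
    (hδ' : A * δ ≤ 1/4) (hsub : rect δ Sg r.1 r.2 ⊆ annulus (A * δ) p) :
    |(Qd σ p).ev u - (Qd σ r.1).ev u| ≤ 600 * (A^2 * δ) ∧
    |(Qd σ p).der u - (Qd σ r.1).der u| ≤ 600 * (A^2 * (Sg * t)) ∧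
    |(Qd σ p).c2 - (Qd σ r.1).c2| ≤ 600 * (A^2 * t) := by
  have hδ0 : 0 < δ := by rw [← hSt]; positivity
  obtain ⟨g, a, b, hb, ha, hg, h1, h2, h3⟩ := close_rect hσ hr hc hp hS hS1 hδ0 (by positivity) hδ' hsub
  obtain ⟨hb, ha, hg⟩ := closeA_num hS hS1 ht ht1 hA hSt hb ha hg
  have hu := hc.1
  have hu2 : u^2 ≤ 1 := (sq_le_one_iff_abs_le_one u).2 hu
  have hσ1 : |σ| = 1 := by rcases hσ with h | h <;> rw [h] <;> norm_num
  have hδS : A^2 * δ ≤ A^2 * (Sg * t) := by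
    rw [← hSt]; gcongr; exact pow_le_of_le_one hS.le hS1 two_ne_zero
  have hSt' : A^2 * (Sg * t) ≤ A^2 * t := by
    gcongr; exact mul_le_of_le_one_left ht.le hS1
  have hg0 := abs_nonneg g
  have : 0 < A^2 * δ := by positivity
  refine ⟨?_, ?_, ?_⟩
  · rw [h1, abs_mul, abs_of_pos (by positivity : 0 < 1 + u^2)]
    linarith [mul_le_mul_of_nonneg_right hu2 hg0]
  · rw [h2]
    have t1 := abs_add_le (2 * u * g) (2 * σ * b)
    have t2 : |2 * u * g| ≤ 2 * |g| := by
      rw [abs_mul, abs_mul, abs_two]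
      linarith [mul_le_mul_of_nonneg_right hu hg0]
    have t3 : |2 * σ * b| = 2 * |b| := by
      rw [abs_mul, abs_mul, abs_two, hσ1]; ring
    linarith
  · linarith
lemma comp_num {δ Sg t r1 r2 g b Δ ϱ α β N : ℝ} (hS : 0 < Sg) (hS1 : Sg ≤ 1) (ht : 0 < t) (ht1 : t ≤ 1)
    (hSt : Sg ^ 2 * t = δ) (hr1 : 1/2 ≤ r1) (hr1' : r1 ≤ 1) (hr2 : 1/2 ≤ r2) (hr2' : r2 ≤ 1)
    (hg : |g| ≤ δ / 100) (hb : |b| ≤ 3 / 200 * (Sg * t)) (hΔ : |Δ| ≤ t / 50)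
    (hϱ0 : 0 ≤ ϱ) (hϱ : |ϱ - r2| ≤ δ) (hϱ2 : ϱ^2 = α^2 + β^2) (hβ : |β| ≤ 11/10 * Sg)
    (hα : |r2 - α| ≤ 3 ∧ (Sg < 1/10 → 0 ≤ α)) (hN0 : 0 ≤ N)
    (hΔr : Δ = r2 - r1) (hN : N^2 = (α + (g - Δ))^2 + (β + b)^2) : |N - r1| ≤ 100 * δ := by
  have hδ0 : 0 < δ := by rw [← hSt]; positivity
  have hδt : δ ≤ t := by rw [← hSt]; exact mul_le_of_le_one_left ht.le (pow_le_one₀ hS.le hS1)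
  have hδS : δ ≤ Sg * t := by
    have := mul_le_mul_of_nonneg_right hS1 (by positivity : 0 ≤ Sg*t)
    rw [← hSt]; linarith
  rw [abs_le] at hϱ
  have hϱ2' : ϱ ≤ 2 := by linarith
  have hαϱ : |α| ≤ ϱ := abs_le_of_sq_le_sq (by rw [hϱ2]; linarith [sq_nonneg β]) hϱ0
  have hr2α : |r2 - α| ≤ δ + 300 * Sg^2 := by
    rcases le_or_gt (1/10) Sg with h | h
    · refine hα.1.trans ?_
      have := pow_le_pow_left₀ (by norm_num) h 2
      linarith
    · have hα0 := hα.2 h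
      have hδ' : δ ≤ 1/100 := by
        have : Sg^2*t ≤ (1/10)^2*1 := by gcongr
        rw [← hSt]; linarith
      have h1 : α ≤ ϱ := (le_abs_self _).trans hαϱ
      have h3 : β^2 ≤ (11/10 * Sg)^2 := by rw [← sq_abs]; gcongr
      have h4 := mul_le_mul_of_nonneg_left (show 2/5 ≤ ϱ + α by linarith) (sub_nonneg.2 h1)
      have := sq_nonneg Sg
      rw [abs_le]; constructor <;> linarith
  have id : N^2 - r1^2 = (ϱ^2 - r2^2) + 2*α*g + 2*Δ*(r2-α) + 2*β*b + (g - 2*Δ)*g + b^2 := by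
    rw [hN, hϱ2, hΔr]; ring
  have t1 : |ϱ^2 - r2^2| ≤ 3 * δ := by
    have : ϱ^2 - r2^2 = (ϱ - r2) * (ϱ + r2) := by ring
    rw [this, abs_mul, mul_comm]
    gcongr
    · rw [abs_le]; constructor <;> linarith
    · rw [abs_le]; exact hϱ
  have t2 : |2*α*g| ≤ δ / 25 := by
    rw [abs_mul, abs_mul, abs_two]
    calc 2 * |α| * |g| ≤ 2 * 2 * (δ / 100) := by
          gcongr; exact hαϱ.trans hϱ2'
      _ = _ := by ring
  have t3 : |2*Δ*(r2-α)| ≤ 13 * δ := by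
    rw [abs_mul, abs_mul, abs_two]
    calc 2 * |Δ| * |r2 - α| ≤ 2 * (t / 50) * (δ + 300 * Sg^2) := by gcongr
      _ = (t * δ + 300 * (Sg^2 * t)) / 25 := by ring
      _ ≤ (1 * δ + 300 * (Sg^2 * t)) / 25 := by gcongr
      _ ≤ _ := by rw [hSt]; linarith
  have t4 : |2*β*b| ≤ δ := by
    rw [abs_mul, abs_mul, abs_two]
    calc 2 * |β| * |b| ≤ 2 * (11/10 * Sg) * (3 / 200 * (Sg * t)) := by gcongr
      _ = 33/1000 * (Sg^2 * t) := by ring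
      _ ≤ _ := by rw [hSt]; linarith
  have t5 : |(g - 2*Δ)*g| ≤ δ := by
    rw [abs_mul]
    have : |g - 2 * Δ| ≤ 1 := by
      have := abs_sub g (2 * Δ)
      rw [abs_mul, abs_two] at this
      linarith
    calc |g - 2*Δ| * |g| ≤ 1 * (δ/100) := by gcongr
      _ ≤ _ := by linarith
  have t6 : b^2 ≤ δ := by
    rw [← sq_abs]
    calc |b|^2 ≤ (3 / 200 * (Sg * t))^2 := by gcongr
      _ = 9/40000 * (Sg^2 * t * t) := by ring
      _ ≤ 9/40000 * (Sg^2 * t * 1) := by gcongr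
      _ ≤ _ := by rw [mul_one, hSt]; linarith
  have t7 : |N^2 - r1^2| ≤ 20 * δ := by
    rw [id]
    have := sq_nonneg b
    rw [abs_le] at t1 t2 t3 t4 t5 ⊢
    constructor <;> linarith
  have t8 : |N - r1| * (N + r1) = |N^2 - r1^2| := by
    rw [← abs_of_nonneg (by linarith : 0 ≤ N + r1), ← abs_mul]
    congr 1; ring
  have t9 := mul_le_mul_of_nonneg_left (show 1/2 ≤ N + r1 by linarith) (abs_nonneg (N - r1))
  linarith
lemma qd_id {σ u : ℝ} (hσ : σ = 1 ∨ σ = -1) (p q : Param) :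
    (Qd σ q).ev u - (Qd σ p).ev u = (1 + u^2) * (q.2 - p.2 + ((q.1 0 - p.1 0) * (σ * (1 - u ^ 2) / (1 + u ^ 2))
      + (q.1 1 - p.1 1) * (2 * u / (1 + u ^ 2)))) ∧
    (Qd σ q).der u - (Qd σ p).der u = 2 * u * (q.2 - p.2 + ((q.1 0 - p.1 0) * (σ * (1 - u ^ 2) / (1 + u ^ 2))
      + (q.1 1 - p.1 1) * (2 * u / (1 + u ^ 2)))) + 2 * σ * ((q.1 0 - p.1 0) * (-(2 * u / (1 + u ^ 2))) +
        (q.1 1 - p.1 1) * (σ * (1 - u ^ 2) / (1 + u ^ 2))) := by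
  have hs : σ ^ 2 = 1 := by grind
  set E0 := σ * (1 - u ^ 2) / (1 + u ^ 2) with hE0
  set E1 := 2 * u / (1 + u ^ 2) with hE1
  have hk : (1 + u^2) ≠ 0 := by positivity
  have kE0 : (1 + u^2) * E0 = σ * (1 - u^2) := by rw [hE0]; field_simp
  have kE1 : (1 + u^2) * E1 = 2 * u := by rw [hE1]; field_simp
  constructor
  · simp only [Qd, ev]
    grind
  · simp only [Qd, der]
    grind
lemma e_diff {σ u w : ℝ} (hσ : σ = 1 ∨ σ = -1) :
    (σ * (1 - w ^ 2) / (1 + w ^ 2) - σ * (1 - u ^ 2) / (1 + u ^ 2)) ^ 2 +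
    (2 * w / (1 + w ^ 2) - 2 * u / (1 + u ^ 2)) ^ 2 ≤ (2 * (u - w)) ^ 2 := by
  have hs : σ ^ 2 = 1 := by grind
  have : (σ * (1 - w ^ 2) / (1 + w ^ 2) - σ * (1 - u ^ 2) / (1 + u ^ 2)) ^ 2 +
    (2 * w / (1 + w ^ 2) - 2 * u / (1 + u ^ 2)) ^ 2 = (2 * (u - w)) ^ 2 / ((1 + u^2) * (1 + w^2)) := by
    have : 1 + u^2 ≠ 0 := by positivity
    have : 1 + w^2 ≠ 0 := by positivity
    grind
  rw [this]
  apply div_le_self (by positivity)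
  nlinarith [sq_nonneg u, sq_nonneg w, mul_nonneg (sq_nonneg u) (sq_nonneg w)]
lemma comp_coef {δ Sg t σ u c0 c1 c2 g b Δ : ℝ} (hσ : σ = 1 ∨ σ = -1) (hu : |u| ≤ 1)
    (hS : 0 < Sg) (hS1 : Sg ≤ 1) (ht : 0 < t)
    (hSt : Sg ^ 2 * t = δ)
    (h1 : |c0 + c1 * u + c2 * u^2| ≤ δ / 100) (h2 : |c1 + 2 * c2 * u| ≤ Sg * t / 100) (h3 : |c2| ≤ t / 100)
    (e1 : c0 + c1 * u + c2 * u^2 = (1 + u^2) * g) (e2 : c1 + 2 * c2 * u = 2 * u * g + 2 * σ * b)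
    (e3 : c0 + c2 = 2 * Δ) : |g| ≤ δ / 100 ∧ |b| ≤ 3 / 200 * (Sg * t) ∧ |Δ| ≤ t / 50 := by
  have hu2 : u^2 ≤ 1 := by rw [abs_le] at hu; nlinarith
  have hδ0 : 0 < δ := by rw [← hSt]; positivity
  have hδS : δ ≤ Sg * t := by
    have := mul_le_mul_of_nonneg_right hS1 (by positivity : 0 ≤ Sg*t)
    rw [← hSt]; linarith
  have hSt1 : Sg * t ≤ t := mul_le_of_le_one_left ht.le hS1
  have hg : |g| ≤ δ / 100 := by
    rw [e1, abs_mul, abs_of_pos (by positivity : 0 < 1 + u^2)] at h1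
    have := mul_nonneg (sq_nonneg u) (abs_nonneg g)
    linarith
  have hσ1 : |σ| = 1 := by grind
  have hug : |u * g| ≤ |g| := by rw [abs_mul]; exact mul_le_of_le_one_left (abs_nonneg _) hu
  refine ⟨hg, ?_, ?_⟩
  · have : |b| = |σ * b| := by rw [abs_mul, hσ1, one_mul]
    rw [this]
    have h : σ * b = ((c1 + 2 * c2 * u) - 2 * (u * g)) / 2 := by rw [e2]; ring
    rw [h]
    rw [abs_le] at h2 hug ⊢
    constructor <;> linarith
  · have h : Δ = ((c0 + c1 * u + c2 * u^2) - (c1 + 2 * c2 * u) * u + c2 * u^2 + c2) / 2 := by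
      linear_combination (-1/2) * e3
    have k1 : |(c1 + 2 * c2 * u) * u| ≤ Sg * t / 100 := by
      rw [abs_mul]; exact (mul_le_of_le_one_right (abs_nonneg _) hu).trans h2
    have k2 : |c2 * u^2| ≤ t / 100 := by
      rw [abs_mul, abs_of_nonneg (sq_nonneg u)]
      exact (mul_le_of_le_one_right (abs_nonneg _) hu2).trans h3
    rw [h]
    rw [abs_le] at h1 k1 k2 h3 ⊢
    constructor <;> linarith
lemma comp_pt {Sg d E0 E1 F0 F1 r2 z0 z1 : ℝ} (hS : 0 < Sg) (hS1 : Sg ≤ 1) (hd : |d| ≤ Sg / 50)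
    (hE : E0^2 + E1^2 = 1) (hF : F0^2 + F1^2 = 1) (hEF : (F0 - E0)^2 + (F1 - E1)^2 ≤ d^2)
    (hr2 : 1/2 ≤ r2) (hr2' : r2 ≤ 1) (hz : (z0 - r2 * F0)^2 + (z1 - r2 * F1)^2 ≤ Sg^2) :
    |z0 * (-E1) + z1 * E0| ≤ 11/10 * Sg ∧ |r2 - (z0 * E0 + z1 * E1)| ≤ 3 ∧
      (Sg < 1/10 → 0 ≤ z0 * E0 + z1 * E1) := by
  have hE' : (-E1)^2 + E0^2 = 1 := by linarith
  have k1 := dot_le hS.le hz hE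
  have k2 := dot_le hS.le hz hE'
  have k3 := dot_le (c := |d|) (abs_nonneg d) (hEF.trans (sq_abs d).ge) hE'
  have hd2 : d^2 ≤ (Sg/50)^2 := by rw [← sq_abs]; gcongr
  have hS2 : Sg^2 ≤ 1 := pow_le_one₀ hS.le hS1
  have k4 : F0 * E0 + F1 * E1 = 1 - ((F0 - E0)^2 + (F1 - E1)^2)/2 := by
    linear_combination (1/2) * hE + (1/2) * hF
  set q := (F0 - E0)^2 + (F1 - E1)^2 with hq
  have hq1 : q ≤ 1/2500 := by linarith
  have k5 : z0 * E0 + z1 * E1 = r2 * (1 - q/2) + ((z0 - r2 * F0) * E0 + (z1 - r2 * F1) * E1) := by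
    rw [← k4]; ring
  have k6 : z0 * (-E1) + z1 * E0 = r2 * ((F0 - E0) * (-E1) + (F1 - E1) * E0) + ((z0 - r2 * F0) * (-E1) + (z1 - r2 * F1) * E0) := by
    ring
  have hr20 : 0 ≤ r2 := by linarith
  have k7 : r2 * q ≤ 1/2500 := by
    calc r2 * q ≤ 1 * (1/2500) := by gcongr
      _ = _ := by ring
  have k8 : 0 ≤ r2 * q := by positivity
  refine ⟨?_, ?_, ?_⟩
  · rw [k6]
    refine (abs_add_le _ _).trans ?_
    rw [abs_mul, abs_of_nonneg hr20]
    have : r2 * |(F0 - E0) * (-E1) + (F1 - E1) * E0| ≤ 1 * (Sg / 50) := by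
      gcongr; exact k3.trans hd
    linarith
  · rw [k5]
    rw [abs_le] at k1 ⊢
    constructor <;> linarith
  · intro hS3
    rw [k5]
    rw [abs_le] at k1
    linarith
lemma comp_v {Sg d E0 E1 F0 F1 g b Δ r2 a0 a1 : ℝ} (hS : 0 < Sg) (hd : |d| ≤ Sg / 50)
    (hE : E0^2 + E1^2 = 1) (hEF : (F0 - E0)^2 + (F1 - E1)^2 ≤ d^2) (hr2 : 1/2 ≤ r2) (hr2' : r2 ≤ 1)
    (hg : |g| ≤ Sg / 10) (hb : |b| ≤ Sg / 10)
    (h0 : a0 = g * E0 - b * E1 - Δ * E0) (h1 : a1 = g * E1 + b * E0 - Δ * E1) :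
    (a0 + r2 * F0 - (r2 - Δ) * E0)^2 + (a1 + r2 * F1 - (r2 - Δ) * E1)^2 ≤ Sg^2 := by
  have e0 : a0 + r2 * F0 - (r2 - Δ) * E0 = (g * E0 - b * E1) + r2 * (F0 - E0) := by rw [h0]; ring
  have e1 : a1 + r2 * F1 - (r2 - Δ) * E1 = (g * E1 + b * E0) + r2 * (F1 - E1) := by rw [h1]; ring
  rw [e0, e1]
  have hg2 : g^2 ≤ (Sg/10)^2 := by rw [← sq_abs]; gcongr
  have hb2 : b^2 ≤ (Sg/10)^2 := by rw [← sq_abs]; gcongr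
  have hd2 : d^2 ≤ (Sg/50)^2 := by rw [← sq_abs]; gcongr
  have k1 : (g * E0 - b * E1)^2 + (g * E1 + b * E0)^2 = g^2 + b^2 := by linear_combination (g^2+b^2) * hE
  have k2 : (r2 * (F0 - E0))^2 + (r2 * (F1 - E1))^2 ≤ d^2 := by
    have hr : r2^2 ≤ 1 := pow_le_one₀ (by linarith) hr2'
    have : (r2 * (F0 - E0))^2 + (r2 * (F1 - E1))^2 = r2^2 * ((F0 - E0)^2 + (F1 - E1)^2) := by ring
    rw [this]
    exact (mul_le_of_le_one_left (by positivity) hr).trans hEF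
  have k3 : ∀ x y : ℝ, (x + y)^2 ≤ 2 * x^2 + 2 * y^2 := fun x y => by linarith only [sq_nonneg (x - y)]
  have k4 := k3 (g * E0 - b * E1) (r2 * (F0 - E0))
  have k5 := k3 (g * E1 + b * E0) (r2 * (F1 - E1))
  have := sq_nonneg Sg
  linarith
lemma comp_rect {δ Sg t σ u1 u2 : ℝ} {R1 R2 : Param × Plane} (hσ : σ = 1 ∨ σ = -1)
    (hR1 : IsRectData R1) (hR2 : IsRectData R2) (hc1 : Ch σ u1 R1) (hc2 : Ch σ u2 R2)
    (hS : 0 < Sg) (hS1 : Sg ≤ 1) (ht : 0 < t) (ht1 : t ≤ 1) (hSt : Sg ^ 2 * t = δ)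
    (hu : |u1 - u2| ≤ Sg / 100)
    (h1 : |(Qd σ R2.1).ev u1 - (Qd σ R1.1).ev u1| ≤ δ / 100)
    (h2 : |(Qd σ R2.1).der u1 - (Qd σ R1.1).der u1| ≤ Sg * t / 100)
    (h3 : |(Qd σ R2.1).c2 - (Qd σ R1.1).c2| ≤ t / 100) : Comp δ Sg 100 R1 R2 := by
  have hδ0 : 0 < δ := by rw [← hSt]; positivity
  have hδS : δ ≤ Sg := by
    nlinarith
  refine ⟨R1, hR1, ?_⟩
  obtain ⟨i1, i2⟩ := qd_id (u := u1) hσ R1.1 R2.1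
  have ha1 : (Qd σ R2.1).ev u1 - (Qd σ R1.1).ev u1 = ((Qd σ R2.1).c0 - (Qd σ R1.1).c0) + ((Qd σ R2.1).c1 - (Qd σ R1.1).c1) * u1 + ((Qd σ R2.1).c2 - (Qd σ R1.1).c2) * u1^2 := by
    simp only [ev]; ring
  have ha2 : (Qd σ R2.1).der u1 - (Qd σ R1.1).der u1 = ((Qd σ R2.1).c1 - (Qd σ R1.1).c1) + 2 * ((Qd σ R2.1).c2 - (Qd σ R1.1).c2) * u1 := by
    simp only [der]; ring
  have ha3 : ((Qd σ R2.1).c0 - (Qd σ R1.1).c0) + ((Qd σ R2.1).c2 - (Qd σ R1.1).c2) = 2 * (R2.1.2 - R1.1.2) := by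
    simp only [Qd]; ring
  rw [ha1] at h1 i1
  rw [ha2] at h2 i2
  obtain ⟨hg, hb, hΔ⟩ := comp_coef hσ hc1.1 hS hS1 ht hSt h1 h2 h3 i1 i2 ha3
  clear ha1 ha2 ha3 i1 i2 h1 h2 h3
  have hE := eE (u := u1) hσ
  have hF := eE (u := u2) hσ
  have hEF := e_diff (u := u1) (w := u2) hσ
  obtain ⟨hu1, hv10, hv11⟩ := hc1
  obtain ⟨hu2, hv20, hv21⟩ := hc2
  obtain ⟨hr1, hr1'⟩ := domD_r hR1.1
  obtain ⟨hr2, hr2'⟩ := domD_r hR2.1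
  set E0 := σ * (1 - u1 ^ 2) / (1 + u1 ^ 2)
  set E1 := 2 * u1 / (1 + u1 ^ 2)
  set F0 := σ * (1 - u2 ^ 2) / (1 + u2 ^ 2)
  set F1 := 2 * u2 / (1 + u2 ^ 2)
  have hd : |2 * (u1 - u2)| ≤ Sg / 50 := by rw [abs_mul, abs_two]; linarith
  set d := 2 * (u1 - u2)
  set Δ := R2.1.2 - R1.1.2 with hΔd
  set g := Δ + ((R2.1.1 0 - R1.1.1 0) * E0 + (R2.1.1 1 - R1.1.1 1) * E1) with hgd
  set b := (R2.1.1 0 - R1.1.1 0) * (-E1) + (R2.1.1 1 - R1.1.1 1) * E0 with hbd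
  have hx0 : R2.1.1 0 - R1.1.1 0 = g * E0 - b * E1 - Δ * E0 := by
    rw [hgd, hbd]; grind
  have hx1 : R2.1.1 1 - R1.1.1 1 = g * E1 + b * E0 - Δ * E1 := by
    rw [hgd, hbd]; linear_combination (-(R2.1.1 1 - R1.1.1 1)) * hE
  have hvv : dist R2.2 R1.2 ≤ Sg := by
    apply le_of_sq_le_sq _ hS.le
    rw [dist_sq2, hv10, hv11, hv20, hv21]
    refine le_trans (le_of_eq ?_) (comp_v hS hd hE hEF hr2 hr2' (hg.trans (by linarith)) (hb.trans ?_) hx0 hx1)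
    · rw [hΔd]; ring
    · have := mul_le_mul_of_nonneg_left ht1 hS.le
      linarith
  have hsub1 : rect δ Sg R1.1 R1.2 ⊆ rect (100 * δ) (100 * Sg) R1.1 R1.2 := by
    intro w hw
    exact ⟨le_trans hw.1 (by linarith : δ ≤ 100 * δ), Metric.closedBall_subset_closedBall (by linarith) hw.2⟩
  refine Set.union_subset hsub1 ?_
  intro w hw
  obtain ⟨hw1, hw2⟩ := hw
  rw [mem_ann (by linarith)] at hw1
  rw [mem_closedBall] at hw2
  refine ⟨?_, ?_⟩
  · rw [mem_ann (by linarith)]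
    have hz : ((w 0 - R2.1.1 0) - R2.1.2 * F0)^2 + ((w 1 - R2.1.1 1) - R2.1.2 * F1)^2 ≤ Sg^2 := by
      have := pow_le_pow_left₀ dist_nonneg hw2 2
      rw [dist_sq2, hv20, hv21] at this
      refine le_trans (le_of_eq ?_) this
      ring
    obtain ⟨k1, k2, k3⟩ := comp_pt hS hS1 hd hE hF hEF hr2 hr2' hz
    refine comp_num (r2 := R2.1.2) (g := g) (b := b) (Δ := Δ) (ϱ := dist w R2.1.1) hS hS1 ht ht1 hSt hr1 hr1' hr2 hr2' hg hb hΔ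
      dist_nonneg hw1 ?_ k1 ⟨k2, k3⟩ dist_nonneg hΔd ?_
    · rw [dist_sq2]
      linear_combination (-((w 0 - R2.1.1 0)^2 + (w 1 - R2.1.1 1)^2)) * hE
    · rw [dist_sq2]
      have y0 : w 0 - R1.1.1 0 = (w 0 - R2.1.1 0) + (g * E0 - b * E1 - Δ * E0) := by rw [← hx0]; ring
      have y1 : w 1 - R1.1.1 1 = (w 1 - R2.1.1 1) + (g * E1 + b * E0 - Δ * E1) := by rw [← hx1]; ring
      rw [y0, y1]
      linear_combination (-(w 0 - R2.1.1 0)^2 - (w 1 - R2.1.1 1)^2 + (g - Δ)^2 + b^2) * hE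
  · rw [mem_closedBall]
    have := dist_triangle w R2.2 R1.2
    linarith
lemma cells {ι : Type*} (a : Fin 4 → ι → ℝ) (Y : ℝ) (hY : 0 ≤ Y) : ∃ (T : Finset (Fin 4 → ℕ)) (F : ι → Fin 4 → ℕ),
    (T.card : ℝ) ≤ (2 * Y + 1) ^ 4 ∧ (∀ i, (∀ k, |a k i| ≤ Y) → F i ∈ T) ∧
    ∀ i j, (∀ k, |a k i| ≤ Y) → (∀ k, |a k j| ≤ Y) → F i = F j → ∀ k, |a k i - a k j| < 1 := by
  refine ⟨Fintype.piFinset (fun _ : Fin 4 => Finset.range (⌊2 * Y⌋₊ + 1)), fun i k => ⌊a k i + Y⌋₊, ?_, ?_, ?_⟩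
  · rw [Fintype.card_piFinset]
    simp only [card_range, Finset.prod_const, Finset.card_univ, Fintype.card_fin]
    push_cast
    gcongr
    exact Nat.floor_le (by linarith)
  · intro i hi
    simp only [Fintype.mem_piFinset, Finset.mem_range]
    intro k
    have := abs_le.1 (hi k)
    exact Nat.lt_succ_of_le (Nat.floor_mono (by linarith))
  · intro i j hi hj hij k
    have e : ⌊a k i + Y⌋₊ = ⌊a k j + Y⌋₊ := congrFun hij k
    have p1 := abs_le.1 (hi k)
    have p2 := abs_le.1 (hj k)
    have q1 := Nat.floor_le (show 0 ≤ a k i + Y by linarith)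
    have q2 := Nat.floor_le (show 0 ≤ a k j + Y by linarith)
    have q3 := Nat.lt_floor_add_one (a k i + Y)
    have q4 := Nat.lt_floor_add_one (a k j + Y)
    grind
lemma box4 {ι : Type*} (R : Finset ι) (a : Fin 4 → ι → ℝ) (Y : ℝ) (hY : 0 ≤ Y)
    (ha : ∀ k, ∀ i ∈ R, |a k i| ≤ Y) (hd : ∀ i ∈ R, ∀ j ∈ R, (∀ k, |a k i - a k j| < 1) → i = j) :
    (R.card : ℝ) ≤ (2 * Y + 1) ^ 4 := by
  obtain ⟨T, F, h1, h2, h3⟩ := cells a Y hY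
  refine le_trans ?_ h1
  exact_mod_cast card_le_card_of_injOn F (fun i hi => h2 i fun k => ha k i hi)
    (fun i hi j hj hij => hd i hi j hj (h3 i j (fun k => ha k i hi) (fun k => ha k j hj) hij))
lemma box_num {δ Sg t X θ d0 d1 d2 x : ℝ} (hX : 1 ≤ X) (hS : 0 < Sg) (ht : 0 < t) (hSt : Sg ^ 2 * t = δ)
    (hθ : θ * (300 * X ^ 2) = 1) (hx : |x| ≤ X * Sg) (h0 : |d0| ≤ θ * δ) (h1 : |d1| ≤ θ * (Sg * t))
    (h2 : |d2| ≤ θ * t) : |d0 + d1 * x + d2 * x^2| ≤ δ / 100 ∧ |d1 + 2 * d2 * x| ≤ Sg * t / 100 ∧ |d2| ≤ t / 100 := by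
  have hδ0 : 0 < δ := by rw [← hSt]; positivity
  have hX2 : 1 ≤ X^2 := one_le_pow₀ hX
  have hXX : X ≤ X^2 := by nlinarith
  have hθ0 : 0 < θ := by
    nlinarith
  have hθX2 : θ * X^2 = 1/300 := by linarith
  have hθX : θ * X ≤ 1/300 := by rw [← hθX2]; gcongr
  have hθ1 : θ ≤ 1/300 := by rw [← hθX2]; exact le_mul_of_one_le_right hθ0.le hX2
  have k1 : |d1 * x| ≤ δ / 300 := by
    rw [abs_mul]
    calc |d1| * |x| ≤ (θ * (Sg * t)) * (X * Sg) := by gcongr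
      _ = (θ * X) * (Sg^2 * t) := by ring
      _ ≤ 1/300 * (Sg^2 * t) := by gcongr
      _ = _ := by rw [hSt]; ring
  have k2 : |d2 * x^2| ≤ δ / 300 := by
    rw [abs_mul, abs_pow]
    calc |d2| * |x|^2 ≤ (θ * t) * (X * Sg)^2 := by gcongr
      _ = (θ * X^2) * (Sg^2 * t) := by ring
      _ = _ := by grind
  have k3 : |d2 * x| ≤ Sg * t / 300 := by
    rw [abs_mul]
    calc |d2| * |x| ≤ (θ * t) * (X * Sg) := by gcongr
      _ = (θ * X) * (Sg * t) := by ring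
      _ ≤ 1/300 * (Sg * t) := by gcongr
      _ = _ := by ring
  have k4 : θ * δ ≤ 1/300 * δ := by gcongr
  have k5 : θ * (Sg * t) ≤ 1/300 * (Sg * t) := by gcongr
  have k6 : θ * t ≤ 1/300 * t := by gcongr
  refine ⟨?_, ?_, ?_⟩
  · rw [abs_le] at *; constructor <;> linarith
  · have : d1 + 2 * d2 * x = d1 + 2 * (d2 * x) := by ring
    rw [this, abs_le]
    rw [abs_le] at h1 k3
    constructor <;> linarith
  · linarith
lemma box_aux {x y c Xc θ X : ℝ} (hc : 0 < c) (hθ : θ * (300 * X ^ 2) = 1) (h0 : 0 < θ)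
    (hX : |x| ≤ X * c) (hXc : Xc = θ * c) : |x / Xc| ≤ 300 * X^3 ∧ (|x / Xc - y / Xc| < 1 → |x - y| ≤ θ * c) := by
  have hp : 0 < Xc := by rw [hXc]; positivity
  constructor
  · rw [abs_div, abs_of_pos hp, div_le_iff₀ hp, hXc]
    refine hX.trans (le_of_eq ?_)
    grind
  · intro h
    rw [← sub_div, abs_div, abs_of_pos hp, div_lt_one hp, hXc] at h
    exact h.le
lemma boxR {δ Sg t σ X us : ℝ} (hσ : σ = 1 ∨ σ = -1) (R : Finset (Param × Plane)) (U : Param × Plane → ℝ) (fs : Quad)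
    (hR : ∀ r ∈ R, IsRectData r) (hC : ∀ r ∈ R, Ch σ (U r) r)
    (hinc : ∀ r ∈ R, ∀ r' ∈ R, r ≠ r' → ¬ Comp δ Sg 100 r r')
    (hS : 0 < Sg) (hS1 : Sg ≤ 1) (ht : 0 < t) (ht1 : t ≤ 1) (hSt : Sg ^ 2 * t = δ) (hX : 1 ≤ X)
    (h1 : ∀ r ∈ R, |U r - us| ≤ X * Sg)
    (h2 : ∀ r ∈ R, |(Qd σ r.1).ev us - fs.ev us| ≤ X * δ)
    (h3 : ∀ r ∈ R, |(Qd σ r.1).der us - fs.der us| ≤ X * (Sg * t))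
    (h4 : ∀ r ∈ R, |(Qd σ r.1).c2 - fs.c2| ≤ X * t) : (R.card : ℝ) ≤ (700 * X ^ 3) ^ 4 := by
  have hδ0 : 0 < δ := by rw [← hSt]; positivity
  set θ := 1 / (300 * X^2) with hθd
  have hθ : θ * (300 * X ^ 2) = 1 := by rw [hθd]; field_simp
  have hθ0 : 0 < θ := by positivity
  have hX3 : 1 ≤ X^3 := one_le_pow₀ hX
  have key := box4 R ![fun r => (U r - us) / (θ * Sg), fun r => ((Qd σ r.1).ev us - fs.ev us) / (θ * δ),
    fun r => ((Qd σ r.1).der us - fs.der us) / (θ * (Sg * t)), fun r => ((Qd σ r.1).c2 - fs.c2) / (θ * t)]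
    (300 * X^3) (by positivity) (by
      intro k r hr
      fin_cases k
      · exact (box_aux (y := 0) hS hθ hθ0 (h1 r hr) rfl).1
      · exact (box_aux (y := 0) hδ0 hθ hθ0 (h2 r hr) rfl).1
      · exact (box_aux (y := 0) (by positivity) hθ hθ0 (h3 r hr) rfl).1
      · exact (box_aux (y := 0) ht hθ hθ0 (h4 r hr) rfl).1) (by
      intro r hr r' hr' hk
      by_contra hne
      apply hinc r hr r' hr' hne
      have k0 := (box_aux hS hθ hθ0 (h1 r hr) rfl).2 (hk 0)
      have k1 := (box_aux hδ0 hθ hθ0 (h2 r hr) rfl).2 (hk 1)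
      have k2 := (box_aux (by positivity) hθ hθ0 (h3 r hr) rfl).2 (hk 2)
      have k3 := (box_aux ht hθ hθ0 (h4 r hr) rfl).2 (hk 3)
      rw [sub_sub_sub_cancel_right] at k0 k1 k2 k3
      have n := box_num (δ := δ) (x := U r - us) hX hS ht hSt hθ (h1 r hr)
        (by rw [abs_sub_comm]; exact k1) (by rw [abs_sub_comm]; exact k2) (by rw [abs_sub_comm]; exact k3)
      refine comp_rect hσ (hR r hr) (hR r' hr') (hC r hr) (hC r' hr') hS hS1 ht ht1 hSt ?_ ?_ ?_ n.2.2
      · refine k0.trans ?_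
        have hX2 : 1 ≤ X^2 := one_le_pow₀ hX
        have : θ ≤ 1/300 := by rw [hθd]; gcongr; linarith
        have : θ * Sg ≤ 1/300 * Sg := by gcongr
        linarith
      · refine le_trans (le_of_eq ?_) n.1
        congr 1; simp only [ev, der]; ring
      · refine le_trans (le_of_eq ?_) n.2.1
        congr 1; simp only [der]; ring)
  refine key.trans ?_
  gcongr
  linarith
structure Par (δ t Sg A V : ℝ) (I : ℕ) : Prop where
  hA : 10 ^ 60 ≤ A
  hδ : 0 < δ
  ht : 0 < t
  ht1 : t ≤ 1
  hS : 0 < Sg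
  hSt : Sg ^ 2 * t = δ
  hS10 : A ^ 10 * Sg ≤ 1
  hAδ : A * δ ≤ 1 / 4
  hI : 0 < I
  hI112 : 112 ^ I ≤ A
  hVδ : 1 ≤ V * δ
  hVA : V < 2 ^ ⌊A⌋₊
  hVI : V ^ 2 ≤ A ^ I
def sc (κ : ℝ) (f : Quad) : Quad := ⟨f.c0 / κ, f.c1 / κ, f.c2 / κ⟩
lemma sc_ev (κ : ℝ) (f : Quad) (x : ℝ) : (sc κ f).ev x = f.ev x / κ := by simp only [sc, ev]; ring
lemma sc_der (κ : ℝ) (f : Quad) (x : ℝ) : (sc κ f).der x = f.der x / κ := by simp only [sc, der]; ring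
lemma scQd_inj {κ σ : ℝ} (hκ : κ ≠ 0) (hσ : σ = 1 ∨ σ = -1) : Function.Injective (fun p => sc κ (Qd σ p)) := by
  intro p q h
  simp only [sc, Qd, Quad.mk.injEq, div_left_inj' hκ] at h
  obtain ⟨h1, h2, h3⟩ := h
  have hs : σ ≠ 0 := by rcases hσ with h | h <;> rw [h] <;> norm_num
  have e0 : p.1 0 = q.1 0 := by
    apply mul_left_cancel₀ hs; linarith
  have e1 : p.1 1 = q.1 1 := by linarith
  apply Prod.ext
  · ext i; fin_cases i
    · exact e0
    · exact e1
  · linarith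
lemma Par.A1 {δ t Sg A V : ℝ} {I : ℕ} (P : Par δ t Sg A V I) : 1 ≤ A := le_trans (by norm_num) P.hA
lemma Par.A0 {δ t Sg A V : ℝ} {I : ℕ} (P : Par δ t Sg A V I) : 0 < A := lt_of_lt_of_le one_pos P.A1
lemma Par.S1 {δ t Sg A V : ℝ} {I : ℕ} (P : Par δ t Sg A V I) : Sg ≤ 1 := by
  have h := P.hS10
  have : 1 ≤ A^10 := one_le_pow₀ P.A1
  nlinarith
lemma Par.δS {δ t Sg A V : ℝ} {I : ℕ} (P : Par δ t Sg A V I) : δ ≤ Sg := by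
  have h := P.S1
  have hS := P.hS
  rw [← P.hSt]
  calc Sg^2 * t ≤ Sg^2 * 1 := mul_le_mul_of_nonneg_left P.ht1 (by positivity)
    _ = Sg * Sg := by ring
    _ ≤ 1 * Sg := by gcongr
    _ = Sg := one_mul _
structure RD (δ Sg σ : ℝ) (R : Finset (Param × Plane)) (U : Param × Plane → ℝ) : Prop where
  hσ : σ = 1 ∨ σ = -1
  hR : ∀ r ∈ R, IsRectData r
  hC : ∀ r ∈ R, Ch σ (U r) r
  hinc : ∀ r ∈ R, ∀ r' ∈ R, r ≠ r' → ¬ Comp δ Sg 100 r r'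
lemma RD.mono {δ Sg σ : ℝ} {R R' : Finset (Param × Plane)} {U : Param × Plane → ℝ} (D : RD δ Sg σ R U)
    (h : R' ⊆ R) : RD δ Sg σ R' U :=
  ⟨D.hσ, fun r hr => D.hR r (h hr), fun r hr => D.hC r (h hr), fun r hr r' hr' => D.hinc r (h hr) r' (h hr')⟩
def Gd (δ Sg A : ℝ) (r : Param × Plane) (p : Param) : Prop := rect δ Sg r.1 r.2 ⊆ annulus (A * δ) p
lemma Par.close {δ t Sg A V σ : ℝ} {I : ℕ} {R : Finset (Param × Plane)} {U : Param × Plane → ℝ}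
    (P : Par δ t Sg A V I) (D : RD δ Sg σ R U) {r : Param × Plane} (hr : r ∈ R) {p : Param} (hp : p ∈ domD)
    (hg : Gd δ Sg A r p) : |(Qd σ p).ev (U r) - (Qd σ r.1).ev (U r)| ≤ 600 * (A^2 * δ) ∧
    |(Qd σ p).der (U r) - (Qd σ r.1).der (U r)| ≤ 600 * (A^2 * (Sg * t)) ∧
    |(Qd σ p).c2 - (Qd σ r.1).c2| ≤ 600 * (A^2 * t) :=
  closeA D.hσ (D.hR r hr) (D.hC r hr) hp P.hS P.S1 P.ht P.ht1 P.A1 P.hSt P.hAδ hg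
lemma cfl_num {A Sg t δ d0 d1 d2 h : ℝ} (hA : 10^60 ≤ A) (hS : 0 < Sg) (ht : 0 < t) (hSt : Sg ^ 2 * t = δ)
    (h0 : |d0| ≤ 2 * (A^11 * δ)) (h1 : |d1| ≤ 2 * (A^6 * (Sg * t))) (h2 : |d2| ≤ 602 * (A^2 * t))
    (hh : |h| ≤ 13 * (A^5 * Sg)) :
    |d0 + d1 * h + d2 * h^2| ≤ 102000 * (A^12 * δ) ∧ |d1 + 2 * (d2 * h)| ≤ 16000 * (A^7 * (Sg * t)) := by
  have hA1 : 1 ≤ A := le_trans (by norm_num) hA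
  have hδ0 : 0 < δ := by rw [← hSt]; positivity
  have k1 : |d1 * h| ≤ 26 * (A^11 * δ) := by
    rw [abs_mul, ← hSt]
    calc |d1| * |h| ≤ (2 * (A^6 * (Sg * t))) * (13 * (A^5 * Sg)) := by gcongr
      _ = _ := by ring
  have k2 : |d2 * h^2| ≤ 101738 * (A^12 * δ) := by
    rw [abs_mul, abs_pow, ← hSt]
    calc |d2| * |h|^2 ≤ (602 * (A^2 * t)) * (13 * (A^5 * Sg))^2 := by gcongr
      _ = _ := by ring
  have k3 : |d2 * h| ≤ 7826 * (A^7 * (Sg * t)) := by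
    rw [abs_mul]
    calc |d2| * |h| ≤ (602 * (A^2 * t)) * (13 * (A^5 * Sg)) := by gcongr
      _ = _ := by ring
  have e1 : A^11 * δ ≤ A^12 * δ := by gcongr <;> linarith
  have e2 : A^6 * (Sg * t) ≤ A^7 * (Sg * t) := by gcongr <;> linarith
  rw [abs_le] at *
  grind
def SS (w b m n : ℝ) : ℝ := (w * b / (m * n)) ^ ((3:ℝ)/4) + w / m + b / n
lemma piece_Q {δ t Sg A V σ κ : ℝ} {I : ℕ} {R : Finset (Param × Plane)} {U : Param × Plane → ℝ}
    (P : Par δ t Sg A V I) (D : RD δ Sg σ R U) (S : Finset Param) (hS : ∀ p ∈ S, p ∈ domD) (hκ0 : 0 < κ)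
    (hκ2 : κ ≤ 2 * (A * t)) (hl : ∀ p ∈ S, ∀ q ∈ S, |(Qd σ p).c2 - (Qd σ q).c2| ≤ 2 * (A * t))
    (hg : ∀ r ∈ R, ∃ p ∈ S, Gd δ Sg A r p) {ρ : ℝ} (hρ0 : 0 < ρ) (hρ : ρ ≤ A^5 * Sg) (i : Param × Plane) (hi : i ∈ R) :
    ∀ F ⊆ R, (∀ j ∈ F, (i = j ∨ Cfl U (fun r => (Qd σ r.1).ev (U r) / κ) (fun r => (Qd σ r.1).der (U r) / κ)
      (S.image (fun p => sc κ (Qd σ p))) ρ i j)) → F.card ≤ ⌊(700 * (A^13)^3)^4⌋₊ := by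
  intro F hF hm
  have hA1 := P.A1
  have hS0 := P.hS
  have ht0 := P.ht
  have hδ0 := P.hδ
  have hAA : A * t ≤ A^2 * t := by
    nlinarith
  have hB : 200000 ≤ A := le_trans (by norm_num) P.hA
  have big : ∀ k : ℕ, ∀ x : ℝ, 0 ≤ x → 200000 * (A^k * x) ≤ A^(k+1) * x := by
    intro k x hx
    calc 200000 * (A^k * x) ≤ A * (A^k * x) := by gcongr
      _ = _ := by ring
  have inE : ∀ r ∈ R, ∀ p ∈ S, In ρ (U r) ((Qd σ r.1).ev (U r) / κ) ((Qd σ r.1).der (U r) / κ) (sc κ (Qd σ p)) →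
      |(Qd σ r.1).ev (U r) - (Qd σ p).ev (U r)| ≤ 2 * (A^11 * δ) ∧
      |(Qd σ r.1).der (U r) - (Qd σ p).der (U r)| ≤ 2 * (A^6 * (Sg * t)) := by
    intro r _ p _ h
    obtain ⟨h1, h2⟩ := h
    rw [sc_ev, ← sub_div, abs_div, abs_of_pos hκ0, div_le_iff₀ hκ0, abs_sub_comm] at h1
    rw [sc_der, ← sub_div, abs_div, abs_of_pos hκ0, div_le_iff₀ hκ0, abs_sub_comm] at h2
    constructor
    · refine h1.trans ?_
      calc ρ^2 * κ ≤ (A^5 * Sg)^2 * (2 * (A * t)) := by gcongr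
        _ = _ := by rw [← P.hSt]; ring
    nlinarith
  have lead : ∀ r ∈ R, ∀ p ∈ S, |(Qd σ r.1).c2 - (Qd σ p).c2| ≤ 602 * (A^2 * t) := by
    intro r hr p hp
    obtain ⟨q, hq, hg⟩ := hg r hr
    have k1 := (P.close D hr (hS q hq) hg).2.2
    have k2 := hl q hq p hp
    rw [abs_le] at *
    constructor <;> linarith
  apply Nat.le_floor
  have key : ∀ j ∈ R, (i = j ∨ Cfl U (fun r => (Qd σ r.1).ev (U r) / κ) (fun r => (Qd σ r.1).der (U r) / κ)
      (S.image (fun p => sc κ (Qd σ p))) ρ i j) → |U j - U i| ≤ A^13 * Sg ∧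
      |(Qd σ j.1).ev (U i) - (Qd σ i.1).ev (U i)| ≤ A^13 * δ ∧
      |(Qd σ j.1).der (U i) - (Qd σ i.1).der (U i)| ≤ A^13 * (Sg * t) ∧ |(Qd σ j.1).c2 - (Qd σ i.1).c2| ≤ A^13 * t := by
    intro j hj h
    rcases h with h | ⟨f, hf, h1, h2, h3⟩
    · rw [← h]; simp only [sub_self, abs_zero]
      refine ⟨?_, ?_, ?_, ?_⟩ <;> positivity
    · obtain ⟨p, hp, rfl⟩ := Finset.mem_image.1 hf
      have a1 := inE i hi p hp h1
      have a2 := inE j hj p hp h2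
      have l1 := lead i hi p hp
      have l2 := lead j hj p hp
      have hU : |U i - U j| ≤ 13 * (A^5 * Sg) := by linarith
      have nn := cfl_num P.hA P.hS P.ht P.hSt a2.1 a2.2 l2 hU
      have e1 : (Qd σ j.1).ev (U j) - (Qd σ p).ev (U j) + ((Qd σ j.1).der (U j) - (Qd σ p).der (U j)) * (U i - U j)
        + ((Qd σ j.1).c2 - (Qd σ p).c2) * (U i - U j)^2 = (Qd σ j.1).ev (U i) - (Qd σ p).ev (U i) := by
        simp only [ev, der]; ring
      have e2 : ((Qd σ j.1).der (U j) - (Qd σ p).der (U j))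
        + 2 * (((Qd σ j.1).c2 - (Qd σ p).c2) * (U i - U j)) = (Qd σ j.1).der (U i) - (Qd σ p).der (U i) := by
        simp only [der]; ring
      rw [e1, e2] at nn
      obtain ⟨n1, n2⟩ := nn
      obtain ⟨a1, a3⟩ := a1
      rw [abs_sub_comm] at hU
      have p1 : 0 ≤ A^12 * δ := by positivity
      have p2 : 0 ≤ A^12 * (Sg * t) := by positivity
      have b1 : _ ≤ A^13 * _ := big 12 δ hδ0.le
      have b2 : _ ≤ A^13 * _ := big 12 (Sg * t) (by positivity)
      have b3 : _ ≤ A^13 * _ := big 12 t ht0.le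
      have b4 : _ ≤ A^13 * _ := big 12 Sg hS0.le
      have c1 : A^11 * δ ≤ A^12 * δ := mul_le_mul_of_nonneg_right (pow_le_pow_right₀ hA1 (by norm_num)) (by positivity)
      have c2 : A^6 * (Sg * t) ≤ A^12 * (Sg * t) := mul_le_mul_of_nonneg_right (pow_le_pow_right₀ hA1 (by norm_num)) (by positivity)
      have c22 : A^7 * (Sg * t) ≤ A^12 * (Sg * t) := mul_le_mul_of_nonneg_right (pow_le_pow_right₀ hA1 (by norm_num)) (by positivity)
      have c3 : A^2 * t ≤ A^12 * t := mul_le_mul_of_nonneg_right (pow_le_pow_right₀ hA1 (by norm_num)) (by positivity)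
      have c4 : A^5 * Sg ≤ A^12 * Sg := mul_le_mul_of_nonneg_right (pow_le_pow_right₀ hA1 (by norm_num)) (by positivity)
      rw [abs_sub_comm] at a1 a3 l1
      have t1 := abs_sub_le ((Qd σ j.1).ev (U i)) ((Qd σ p).ev (U i)) ((Qd σ i.1).ev (U i))
      have t2 := abs_sub_le ((Qd σ j.1).der (U i)) ((Qd σ p).der (U i)) ((Qd σ i.1).der (U i))
      have t3 := abs_sub_le (Qd σ j.1).c2 (Qd σ p).c2 (Qd σ i.1).c2
      exact ⟨by linarith, by linarith,
        by linarith, by linarith⟩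
  have D' := D.mono hF
  have k := fun r hr => key r (hF hr) (hm r hr)
  exact boxR D.hσ F U (Qd σ i.1) D'.hR D'.hC D'.hinc P.hS P.S1 P.ht P.ht1 P.hSt
    (us := U i) (X := A^13) (one_le_pow₀ hA1) (fun r hr => (k r hr).1) (fun r hr => (k r hr).2.1)
    (fun r hr => (k r hr).2.2.1) (fun r hr => (k r hr).2.2.2)
lemma Par.exp {δ t Sg A V : ℝ} {I : ℕ} (P : Par δ t Sg A V I) {x y z : ℝ} (hx : 0 ≤ x) (hy : 0 ≤ y) (hz : 0 ≤ z)
    (h1 : x ≤ V) (h2 : y ≤ V) (h3 : z ≤ V) : 8 * (x * y) * z ≤ Real.exp (A^2) := by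
  have hA0 := P.A0
  have hA4 : 8 ≤ A := le_trans (by norm_num) P.hA
  have hV : V ≤ Real.exp A := by
    refine P.hVA.le.trans ?_
    calc (2:ℝ)^⌊A⌋₊ ≤ (Real.exp 1)^⌊A⌋₊ := by
          gcongr; have := Real.add_one_le_exp 1; linarith
      _ = Real.exp ⌊A⌋₊ := by rw [← Real.exp_nat_mul, mul_one]
      _ ≤ _ := Real.exp_le_exp.2 (Nat.floor_le hA0.le)
  have h8 : 8 ≤ Real.exp A := by have := Real.add_one_le_exp A; linarith
  calc 8 * (x * y) * z ≤ Real.exp A * (Real.exp A * Real.exp A) * Real.exp A := by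
        gcongr <;> linarith
    _ = Real.exp (A + (A + A) + A) := by simp only [Real.exp_add]
    _ ≤ _ := by rw [Real.exp_le_exp]; nlinarith
lemma piece_pos {δ t Sg A V σ κ m n : ℝ} {I : ℕ} {R : Finset (Param × Plane)} {U : Param × Plane → ℝ}
    (P : Par δ t Sg A V I) (D : RD δ Sg σ R U) (W B : Finset Param) (hW : ∀ p ∈ W, p ∈ domD) (hB : ∀ p ∈ B, p ∈ domD)
    (hWV : (W.card : ℝ) ≤ V) (hBV : (B.card : ℝ) ≤ V) (hm : 0 < m) (hn : 0 < n)
    (hκ1 : t ≤ 4 * (A * κ)) (hκ2 : κ ≤ 2 * (A * t))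
    (lW : ∀ p ∈ W, ∀ q ∈ W, |(Qd σ p).c2 - (Qd σ q).c2| ≤ κ / 2)
    (lB : ∀ p ∈ B, ∀ q ∈ B, |(Qd σ p).c2 - (Qd σ q).c2| ≤ κ / 2)
    (lWB : ∀ p ∈ W, ∀ q ∈ B, κ ≤ (Qd σ q).c2 - (Qd σ p).c2 ∧ (Qd σ q).c2 - (Qd σ p).c2 ≤ 2 * κ)
    (hl : ∀ p ∈ W ∪ B, ∀ q ∈ W ∪ B, |(Qd σ p).c2 - (Qd σ q).c2| ≤ 2 * (A * t))
    (hgW : ∀ r ∈ R, m ≤ (W.filter (Gd δ Sg A r)).card) (hgB : ∀ r ∈ R, n ≤ (B.filter (Gd δ Sg A r)).card) :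
    (R.card : ℝ) ≤ A^176 * SS W.card B.card m n := by
  have hA1 := P.A1
  have hA0 := P.A0
  have hS0 := P.hS
  have ht0 := P.ht
  have hA9 : 10^9 ≤ A := le_trans (by norm_num) P.hA
  have hκ0 : 0 < κ := by
    nlinarith
  have hinj := scQd_inj hκ0.ne' D.hσ
  have cW : ∀ X : Finset Param, (X.image (fun p => sc κ (Qd σ p))).card = X.card := fun X =>
    Finset.card_image_of_injective _ hinj
  have hρ : 112^I * (A^4 * Sg) ≤ A^5 * Sg := by
    calc 112^I * (A^4 * Sg) ≤ A * (A^4 * Sg) := by have := P.hI112; gcongr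
      _ = _ := by ring
  have hIn : ∀ X : Finset Param, (∀ p ∈ X, p ∈ domD) → ∀ r ∈ R, (X.filter (Gd δ Sg A r)).card ≤
      ((X.image (fun p => sc κ (Qd σ p))).filter (In (A^4 * Sg) (U r) ((Qd σ r.1).ev (U r) / κ) ((Qd σ r.1).der (U r) / κ))).card := by
    intro X hX r hr
    rw [← cW]
    apply Finset.card_le_card
    intro f hf
    obtain ⟨p, hp, rfl⟩ := Finset.mem_image.1 hf
    rw [mem_filter] at hp
    obtain ⟨h1, h2, -⟩ := P.close D hr (hX p hp.1) hp.2
    refine mem_filter.2 ⟨Finset.mem_image_of_mem _ hp.1, ?_, ?_⟩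
    · rw [sc_ev, ← sub_div, abs_div, abs_of_pos hκ0, div_le_iff₀ hκ0]
      refine h1.trans ?_
      rw [← P.hSt]
      calc 600 * (A^2 * (Sg^2 * t)) ≤ 600 * (A^2 * (Sg^2 * (4 * (A * κ)))) := by gcongr
        _ = 2400 * (A^3 * Sg^2 * κ) := by ring
        _ ≤ A^5 * (A^3 * Sg^2 * κ) := by
          gcongr
          calc (2400:ℝ) ≤ A := by linarith
            _ ≤ A^5 := le_self_pow₀ hA1 (by norm_num)
        _ = _ := by ring
    · rw [sc_der, ← sub_div, abs_div, abs_of_pos hκ0, div_le_iff₀ hκ0]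
      refine h2.trans ?_
      calc 600 * (A^2 * (Sg * t)) ≤ 600 * (A^2 * (Sg * (4 * (A * κ)))) := by gcongr
        _ = 2400 * (A^3 * Sg * κ) := by ring
        _ ≤ A * (A^3 * Sg * κ) := by gcongr; linarith
        _ = _ := by ring
  have hVn : ∀ X : Finset Param, (X.card : ℝ) ≤ V → X.card < 2^⌊A⌋₊ := by
    intro X hX
    have := hX.trans_lt P.hVA
    exact_mod_cast this
  have hdiv : ∀ p q, (sc κ (Qd σ p)).c2 - (sc κ (Qd σ q)).c2 = ((Qd σ p).c2 - (Qd σ q).c2) / κ := by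
    intro p q; simp only [sc]; ring
  have hfl := Nat.floor_le hA0.le
  have key := QH R U (fun r => (Qd σ r.1).ev (U r) / κ) (fun r => (Qd σ r.1).der (U r) / κ)
    (W.image (fun p => sc κ (Qd σ p))) (B.image (fun p => sc κ (Qd σ p))) (A^4 * Sg) m n A (A^2)
    I ⌊A⌋₊ ⌊A⌋₊ ⌊(700 * (A^13)^3)^4⌋₊ P.hI (by positivity) (by
      refine hρ.trans (le_trans ?_ P.hS10)
      gcongr; norm_num) (fun i hi => (D.hC i hi).1) (by
      simp only [Finset.forall_mem_image]
      intro p hp q hq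
      rw [hdiv, abs_div, abs_of_pos hκ0, div_le_iff₀ hκ0]
      linarith [lW p hp q hq]) (by
      simp only [Finset.forall_mem_image]
      intro p hp q hq
      rw [hdiv, abs_div, abs_of_pos hκ0, div_le_iff₀ hκ0]
      linarith [lB p hp q hq]) (by
      simp only [Finset.forall_mem_image]
      intro p hp q hq
      rw [hdiv, le_div_iff₀ hκ0, div_le_iff₀ hκ0, one_mul]
      exact lWB p hp q hq) hm hn hA1 (by
      rw [cW, cW]
      calc (W.card : ℝ) * B.card ≤ V * V := by gcongr; linarith
        _ = V^2 := by ring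
        _ ≤ _ := P.hVI) (by rw [cW]; exact hVn W hWV) (by rw [cW]; exact hVn B hBV)
      (fun i hi => (hgW i hi).trans (by exact_mod_cast hIn W hW i hi))
      (fun i hi => (hgB i hi).trans (by exact_mod_cast hIn B hB i hi)) (by
      intro ρ' h1 h2 i hi
      rw [← Finset.image_union]
      refine piece_Q P D (W ∪ B) (fun p hp => (Finset.mem_union.1 hp).elim (hW p) (hB p)) hκ0 hκ2 hl ?_
        (lt_of_lt_of_le (by positivity) h1) (h2.trans hρ) i hi _ (filter_subset _ _)
        (fun j hj => (mem_filter.1 hj).2)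
      intro r hr
      have : 0 < (W.filter (Gd δ Sg A r)).card := by
        have := lt_of_lt_of_le hm (hgW r hr)
        exact_mod_cast this
      obtain ⟨p, hp⟩ := card_pos.1 this
      rw [mem_filter] at hp
      exact ⟨p, Finset.mem_union_left _ hp.1, hp.2⟩)
      (by nlinarith) (by nlinarith) (by nlinarith) (by
      have h1 := P.hVA
      have h2 := P.hVδ
      have h3 : δ ≤ A^4 * Sg := P.δS.trans (le_mul_of_one_le_left hS0.le (one_le_pow₀ hA1))
      have h4 : 1 ≤ 2^⌊A⌋₊ * (A^4 * Sg) := by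
        refine h2.trans ?_
        have := P.hδ
        gcongr
      linarith) (by
      rw [cW, cW]; exact P.exp (by positivity) (by positivity) (by positivity) hWV hBV hWV) (by
      rw [cW, cW]; exact P.exp (by positivity) (by positivity) (by positivity) hWV hBV hBV)
  rw [cW, cW] at key
  refine key.trans ?_
  unfold SS
  gcongr
  have hI : (I:ℝ) ≤ A := by
    refine le_trans ?_ P.hI112
    have : I < 112^I := Nat.lt_pow_self (by norm_num)
    exact_mod_cast this.le
  have hQ : (⌊(700 * (A^13)^3)^4⌋₊ : ℝ) ≤ 700^4 * A^156 := by
    refine (Nat.floor_le (by positivity)).trans (le_of_eq (by ring))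
  calc (I * ⌊A⌋₊ * ⌊A⌋₊ * ⌊(700 * (A^13)^3)^4⌋₊ : ℝ) * (144 * (A^2)^7) ≤ (A * A * A * (700^4 * A^156)) * (144 * (A^2)^7) := by gcongr
    _ = (700^4 * 144) * A^173 := by ring
    _ ≤ A^3 * A^173 := by
      gcongr
      calc (700^4 * 144 : ℝ) ≤ (10^9)^3 := by norm_num
        _ ≤ _ := by gcongr
    _ = A^176 := by ring
lemma pdist_sq (p q : Param) : pdist p q ^ 2 = (p.1 0 - q.1 0)^2 + (p.1 1 - q.1 1)^2 + (p.2 - q.2)^2 := by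
  unfold pdist; rw [Real.sq_sqrt (by positivity), dist_sq2]
lemma pdist_nn (p q : Param) : 0 ≤ pdist p q := Real.sqrt_nonneg _
lemma coord_le (p q : Param) : |p.1 0 - q.1 0| ≤ pdist p q ∧ |p.1 1 - q.1 1| ≤ pdist p q ∧ |p.2 - q.2| ≤ pdist p q := by
  have h := pdist_sq p q
  have h0 := pdist_nn p q
  refine ⟨?_, ?_, ?_⟩ <;> apply abs_le_of_sq_le_sq _ h0 <;> nlinarith [sq_nonneg (p.1 0 - q.1 0), sq_nonneg (p.1 1 - q.1 1), sq_nonneg (p.2 - q.2)]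
lemma lead_le {σ : ℝ} (hσ : σ = 1 ∨ σ = -1) (p q : Param) :
    |(Qd σ p).c2 - (Qd σ q).c2| ≤ |p.2 - q.2| + |p.1 0 - q.1 0| := by
  have : (Qd σ p).c2 - (Qd σ q).c2 = (p.2 - q.2) - σ * (p.1 0 - q.1 0) := by simp only [Qd]; ring
  rw [this]
  refine (abs_sub _ _).trans ?_
  grind
lemma pd_num {σ u μ A t : ℝ} (hσ : σ = 1 ∨ σ = -1) (hu : |u| ≤ 1) {p q : Param} (hA : 0 < A)
    (h1 : |(Qd σ p).ev u - (Qd σ q).ev u| ≤ μ) (h2 : |(Qd σ p).der u - (Qd σ q).der u| ≤ μ)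
    (hμ : 100 * (A * μ) ≤ t) (ht : t ≤ A * pdist p q) : t ≤ 2 * (A * |(Qd σ p).c2 - (Qd σ q).c2|) := by
  have hs : σ^2 = 1 := by grind
  have hμ0 : 0 ≤ μ := (abs_nonneg _).trans h1
  set κ := (Qd σ p).c2 - (Qd σ q).c2 with hκ
  set e := (Qd σ p).ev u - (Qd σ q).ev u with he
  set d := (Qd σ p).der u - (Qd σ q).der u with hd
  have c1 : (Qd σ p).c1 - (Qd σ q).c1 = d - 2 * (κ * u) := by rw [hd, hκ]; simp only [der]; ring
  have c0 : (Qd σ p).c0 - (Qd σ q).c0 = e - d * u + κ * u^2 := by rw [hd, hκ, he]; simp only [der, ev]; ring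
  have hκu : |κ * u| ≤ |κ| := by rw [abs_mul]; exact mul_le_of_le_one_right (abs_nonneg _) hu
  have hdu : |d * u| ≤ μ := by rw [abs_mul]; exact (mul_le_of_le_one_right (abs_nonneg _) hu).trans h2
  have hκu2 : |κ * u^2| ≤ |κ| := by
    rw [abs_mul, abs_pow]; exact mul_le_of_le_one_right (abs_nonneg _) (pow_le_one₀ (abs_nonneg _) hu)
  have b1 : |(Qd σ p).c1 - (Qd σ q).c1| ≤ 2 * (|κ| + 2 * μ) := by
    rw [c1]
    rw [abs_le] at h2 hκu ⊢; constructor <;> linarith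
  have b0 : |(Qd σ p).c0 - (Qd σ q).c0| ≤ |κ| + 2 * μ := by
    rw [c0]
    rw [abs_le] at h1 hdu hκu2 ⊢; constructor <;> linarith
  have b2 : |κ| ≤ |κ| + 2 * μ := by linarith
  have e2 : pdist p q ^ 2 = ((Qd σ p).c1 - (Qd σ q).c1)^2 / 4 + (((Qd σ p).c0 - (Qd σ q).c0)^2 + κ^2) / 2 := by
    rw [pdist_sq, hκ]; simp only [Qd]; linear_combination (-(p.1 0 - q.1 0)^2) * hs
  have hp : pdist p q ≤ 3/2 * (|κ| + 2 * μ) := by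
    apply le_of_sq_le_sq _ (by positivity)
    have s1 := sq_le_sq' (abs_le.1 b1).1 (abs_le.1 b1).2
    have s0 := sq_le_sq' (abs_le.1 b0).1 (abs_le.1 b0).2
    have s2 := sq_le_sq' (abs_le.1 b2).1 (abs_le.1 b2).2
    rw [e2]
    have : 0 ≤ (|κ| + 2 * μ)^2 := sq_nonneg _
    rw [mul_pow] at s1 ⊢
    linarith
  have := mul_le_mul_of_nonneg_left hp hA.le
  have : 0 ≤ A * |κ| := by positivity
  linarith
lemma SS_comm (w b m n : ℝ) : SS w b m n = SS b w n m := by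
  unfold SS; grind
lemma SS_nn {m n : ℝ} (w b : ℕ) (hm : 0 < m) (hn : 0 < n) : 0 ≤ SS w b m n := by unfold SS; positivity
structure Cell (A t : ℝ) (W : Finset Param) : Prop where
  h : ∀ p ∈ W, ∀ q ∈ W, 1000 * (A * |p.1 0 - q.1 0|) ≤ t ∧ 1000 * (A * |p.2 - q.2|) ≤ t
lemma Cell.lead {A t σ : ℝ} {W : Finset Param} (h : Cell A t W) (hA : 0 < A) (hσ : σ = 1 ∨ σ = -1) :
    ∀ p ∈ W, ∀ q ∈ W, 500 * (A * |(Qd σ p).c2 - (Qd σ q).c2|) ≤ t := by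
  intro p hp q hq
  have h1 := h.h p hp q hq
  have := mul_le_mul_of_nonneg_left (lead_le hσ p q) hA.le
  linarith
lemma piece_sgn {δ t Sg A V σ m n : ℝ} {I : ℕ} {R : Finset (Param × Plane)} {U : Param × Plane → ℝ}
    (P : Par δ t Sg A V I) (D : RD δ Sg σ R U) (W B : Finset Param) (hW : ∀ p ∈ W, p ∈ domD) (hB : ∀ p ∈ B, p ∈ domD)
    (hWV : (W.card : ℝ) ≤ V) (hBV : (B.card : ℝ) ≤ V) (hm : 0 < m) (hn : 0 < n)
    (hd : ∀ p ∈ W ∪ B, ∀ q ∈ W ∪ B, pdist p q ≤ A * t) (cW : Cell A t W) (cB : Cell A t B)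
    (hgW : ∀ r ∈ R, m ≤ (W.filter (Gd δ Sg A r)).card) (hgB : ∀ r ∈ R, n ≤ (B.filter (Gd δ Sg A r)).card)
    {p q : Param} (hp : p ∈ W) (hq : q ∈ B) (hκ0 : 0 < (Qd σ q).c2 - (Qd σ p).c2)
    (hκ : t ≤ 2 * (A * ((Qd σ q).c2 - (Qd σ p).c2))) :
    (R.card : ℝ) ≤ A^176 * SS W.card B.card m n := by
  have hA0 := P.A0
  have hl : ∀ p ∈ W ∪ B, ∀ q ∈ W ∪ B, |(Qd σ p).c2 - (Qd σ q).c2| ≤ 2 * (A * t) := by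
    intro p hp q hq
    have h1 := coord_le p q
    have h2 := hd p hp q hq
    have h3 := lead_le D.hσ p q
    linarith
  set κ := (Qd σ q).c2 - (Qd σ p).c2 with hκd
  have hAκ : 0 ≤ A * κ := by positivity
  have hx : ∀ x, 500 * (A * |x|) ≤ t → |x| ≤ κ / 250 := by
    intro x hx
    nlinarith
  refine piece_pos (κ := 3/4 * κ) P D W B hW hB hWV hBV hm hn (by linarith) ?_ ?_ ?_ ?_ hl hgW hgB
  · have := (le_abs_self _).trans (hl q (Finset.mem_union_right _ hq) p (Finset.mem_union_left _ hp))
    linarith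
  · exact fun p hp q hq => (hx _ (cW.lead hA0 D.hσ p hp q hq)).trans (by linarith)
  · exact fun p hp q hq => (hx _ (cB.lead hA0 D.hσ p hp q hq)).trans (by linarith)
  · intro p' hp' q' hq'
    have h1 := abs_le.1 (hx _ (cW.lead hA0 D.hσ p hp p' hp'))
    have h2 := abs_le.1 (hx _ (cB.lead hA0 D.hσ q hq q' hq'))
    constructor <;> linarith
lemma piece {δ t Sg A V σ m n : ℝ} {I : ℕ} {R : Finset (Param × Plane)} {U : Param × Plane → ℝ}
    (P : Par δ t Sg A V I) (D : RD δ Sg σ R U) (W B : Finset Param) (hW : ∀ p ∈ W, p ∈ domD) (hB : ∀ p ∈ B, p ∈ domD)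
    (hWV : (W.card : ℝ) ≤ V) (hBV : (B.card : ℝ) ≤ V) (hm : 0 < m) (hn : 0 < n)
    (hs : ∀ p ∈ W, ∀ q ∈ B, t ≤ A * pdist p q)
    (hd : ∀ p ∈ W ∪ B, ∀ q ∈ W ∪ B, pdist p q ≤ A * t) (cW : Cell A t W) (cB : Cell A t B)
    (hgW : ∀ r ∈ R, m ≤ (W.filter (Gd δ Sg A r)).card) (hgB : ∀ r ∈ R, n ≤ (B.filter (Gd δ Sg A r)).card) :
    (R.card : ℝ) ≤ A^176 * SS W.card B.card m n := by
  have hA0 := P.A0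
  have ht0 := P.ht
  have hS0 := P.hS
  rcases R.eq_empty_or_nonempty with hR | ⟨r, hr⟩
  · rw [hR, Finset.card_empty, Nat.cast_zero]; exact mul_nonneg (pow_nonneg hA0.le _) (SS_nn _ _ hm hn)
  have ex : ∀ (X : Finset Param) (x : ℝ), 0 < x → x ≤ (X.filter (Gd δ Sg A r)).card → ∃ p ∈ X, Gd δ Sg A r p := by
    intro X x h0 h1
    have : 0 < (X.filter (Gd δ Sg A r)).card := by exact_mod_cast lt_of_lt_of_le h0 h1
    obtain ⟨p, hp⟩ := card_pos.1 this
    exact ⟨p, mem_filter.1 hp⟩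
  obtain ⟨p, hp, gp⟩ := ex W m hm (hgW r hr)
  obtain ⟨q, hq, gq⟩ := ex B n hn (hgB r hr)
  obtain ⟨a1, a2, -⟩ := P.close D hr (hW p hp) gp
  obtain ⟨b1, b2, -⟩ := P.close D hr (hB q hq) gq
  rw [abs_sub_comm] at b1 b2
  have t1 := abs_sub_le ((Qd σ p).ev (U r)) ((Qd σ r.1).ev (U r)) ((Qd σ q).ev (U r))
  have t2 := abs_sub_le ((Qd σ p).der (U r)) ((Qd σ r.1).der (U r)) ((Qd σ q).der (U r))
  have hδ : δ ≤ Sg * t := by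
    rw [← P.hSt]
    have := P.S1
    calc Sg^2 * t = Sg * (Sg * t) := by ring
      _ ≤ 1 * (Sg * t) := by gcongr
      _ = _ := one_mul _
  have hδ2 : A^2 * δ ≤ A^2 * (Sg * t) := by gcongr
  have key := pd_num D.hσ (D.hC r hr).1 hA0 (t := t) (μ := 1200 * (A^2 * (Sg * t))) (by linarith) (by linarith)
    (by
      have h6 : 120000 ≤ A^7 := le_trans (le_trans (by norm_num) P.hA) (le_self_pow₀ P.A1 (by norm_num))
      calc 100 * (A * (1200 * (A^2 * (Sg * t)))) = 120000 * (A^3 * Sg * t) := by ring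
        _ ≤ A^7 * (A^3 * Sg * t) := by gcongr
        _ = (A^10 * Sg) * t := by ring
        _ ≤ 1 * t := by have := P.hS10; gcongr
        _ = t := one_mul _) (hs p hp q hq)
  have hpos : 0 < |(Qd σ p).c2 - (Qd σ q).c2| := by
    rw [abs_pos]; intro h; rw [h] at key; simp at key; linarith
  rcases le_total 0 ((Qd σ p).c2 - (Qd σ q).c2) with h | h
  · rw [abs_of_nonneg h] at key hpos
    rw [SS_comm]
    exact piece_sgn P D B W hB hW hBV hWV hn hm (by rw [Finset.union_comm]; exact hd) cB cW hgB hgW hq hp hpos key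
  · rw [abs_of_nonpos h, neg_sub] at key hpos
    exact piece_sgn P D W B hW hB hWV hBV hm hn hd cW cB hgW hgB hp hq hpos key
lemma SS_le {w b m n w1 b1 N : ℝ} (hw : w1 ≤ w) (hb : b1 ≤ b) (h1 : 0 ≤ w1) (h2 : 0 ≤ b1) (hm : 0 < m) (hn : 0 < n)
    (hN : 1 ≤ N) : SS w1 b1 (m / N) (n / N) ≤ N^2 * SS w b m n := by
  have hN2 : 1 ≤ N^2 := one_le_pow₀ hN
  have hNN : N ≤ N^2 := le_self_pow₀ hN (by norm_num)
  have hw0 := h1.trans hw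
  unfold SS
  have e1 : w1 * b1 / (m / N * (n / N)) = N^2 * (w1 * b1 / (m * n)) := by field_simp
  have e2 : w1 / (m / N) = N * (w1 / m) := by field_simp
  have e3 : b1 / (n / N) = N * (b1 / n) := by field_simp
  rw [e1, e2, e3, Real.mul_rpow (by positivity) (by positivity), mul_add, mul_add]
  have e4 : (N^2) ^ ((3:ℝ)/4) ≤ N^2 := by
    calc (N^2) ^ ((3:ℝ)/4) ≤ (N^2)^(1:ℝ) := Real.rpow_le_rpow_of_exponent_le hN2 (by norm_num)
      _ = _ := Real.rpow_one _
  gcongr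
lemma chart_main {δ t Sg A V σ m n : ℝ} {I : ℕ} {R : Finset (Param × Plane)} {U : Param × Plane → ℝ}
    (P : Par δ t Sg A V I) (D : RD δ Sg σ R U) (W B : Finset Param) (hW : ∀ p ∈ W, p ∈ domD) (hB : ∀ p ∈ B, p ∈ domD)
    (hWV : (W.card : ℝ) ≤ V) (hBV : (B.card : ℝ) ≤ V) (hm : 0 < m) (hn : 0 < n)
    (hs : ∀ p ∈ W, ∀ q ∈ B, t ≤ A * pdist p q)
    (hd : ∀ p ∈ W ∪ B, ∀ q ∈ W ∪ B, pdist p q ≤ A * t)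
    (hgW : ∀ r ∈ R, m ≤ (W.filter (Gd δ Sg A r)).card) (hgB : ∀ r ∈ R, n ≤ (B.filter (Gd δ Sg A r)).card) :
    (R.card : ℝ) ≤ A^212 * SS W.card B.card m n := by
  have hA0 := P.A0
  have ht0 := P.ht
  rcases R.eq_empty_or_nonempty with hR | hR
  · rw [hR, Finset.card_empty, Nat.cast_zero]; exact mul_nonneg (pow_nonneg hA0.le _) (SS_nn _ _ hm hn)
  have ex : ∀ (X : Finset Param) (x : ℝ), 0 < x → ∀ r, x ≤ (X.filter (Gd δ Sg A r)).card → (X.filter (Gd δ Sg A r)).Nonempty := by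
    intro X x h0 r h1
    exact card_pos.1 (by exact_mod_cast lt_of_lt_of_le h0 h1)
  obtain ⟨r0, hr0⟩ := hR
  obtain ⟨ps, hps⟩ := ex W m hm r0 (hgW r0 hr0)
  have hps' := Finset.mem_union_left B (mem_filter.1 hps).1
  have hst : 0 < 1000 * A / t := by positivity
  obtain ⟨T, F, hT, hF, hFF⟩ := cells (ι := Param) ![fun p => (p.1 0 - ps.1 0) * (1000 * A / t), fun _ => 0,
    fun p => (p.2 - ps.2) * (1000 * A / t), fun _ => 0] (1000 * A^2) (by positivity)
  have hab : ∀ p ∈ W ∪ B, ∀ k, |(![fun p => (p.1 0 - ps.1 0) * (1000 * A / t), fun _ => 0,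
      fun p => (p.2 - ps.2) * (1000 * A / t), fun _ => 0] : Fin 4 → Param → ℝ) k p| ≤ 1000 * A^2 := by
    intro p hp k
    have h1 := hd p hp ps hps'
    have h2 := coord_le p ps
    have h3 : ∀ x, |x| ≤ pdist p ps → |x * (1000 * A / t)| ≤ 1000 * A^2 := by
      intro x hx
      rw [abs_mul, abs_of_pos hst]
      calc |x| * (1000 * A / t) ≤ (A * t) * (1000 * A / t) := by gcongr; exact hx.trans h1
        _ = _ := by field_simp
    have h4 : |(0:ℝ)| ≤ 1000 * A^2 := by rw [abs_zero]; positivity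
    fin_cases k
    · exact h3 _ h2.1
    · exact h4
    · exact h3 _ h2.2.2
    · exact h4
  have hN : (T.card : ℝ) ≤ A^9 := by
    refine hT.trans ?_
    have h1 : 1 ≤ A^2 := one_le_pow₀ P.A1
    calc (2 * (1000 * A^2) + 1)^4 ≤ (2001 * A^2)^4 := by gcongr; linarith
      _ = 2001^4 * A^8 := by ring
      _ ≤ A * A^8 := by gcongr; exact le_trans (by norm_num) P.hA
      _ = _ := by ring
  have hN1 : 1 ≤ A^9 := one_le_pow₀ P.A1
  have pg : ∀ X ⊆ W ∪ B, ∀ x : ℝ, 0 < x → (∀ r ∈ R, x ≤ (X.filter (Gd δ Sg A r)).card) → ∀ r, ∃ c, r ∈ R → c ∈ T ∧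
      x / A^9 ≤ ((X.filter (fun p => F p = c)).filter (Gd δ Sg A r)).card := by
    intro X hX x hx h r
    by_cases hr : r ∈ R
    · obtain ⟨c, hc, h1⟩ := pigeon (X.filter (Gd δ Sg A r)) T F (fun p hp => hF p (hab p (hX (mem_filter.1 hp).1)))
        (ex X x hx r (h r hr))
      refine ⟨c, fun _ => ⟨hc, ?_⟩⟩
      rw [Finset.filter_comm, div_le_iff₀ (by positivity)]
      refine (h r hr).trans ((Nat.cast_le.2 h1).trans ?_)
      rw [Nat.cast_mul, mul_comm]
      exact mul_le_mul_of_nonneg_left hN (Nat.cast_nonneg _)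
    · exact ⟨0, fun h => absurd h hr⟩
  choose fW hfW using pg W Finset.subset_union_left m hm hgW
  choose fB hfB using pg B Finset.subset_union_right n hn hgB
  obtain ⟨⟨a, b⟩, -, hab2⟩ := pigeon R (T ×ˢ T) (fun r => (fW r, fB r))
    (fun r hr => mem_product.2 ⟨(hfW r hr).1, (hfB r hr).1⟩) ⟨r0, hr0⟩
  have hcell : ∀ X ⊆ W ∪ B, ∀ c, Cell A t (X.filter (fun p => F p = c)) := by
    intro X hX c
    refine ⟨fun p hp q hq => ?_⟩
    rw [mem_filter] at hp hq
    have h1 := hFF p q (hab p (hX hp.1)) (hab q (hX hq.1)) (hp.2.trans hq.2.symm)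
    have h3 : ∀ x y z : ℝ, |(x - z) * (1000 * A / t) - (y - z) * (1000 * A / t)| < 1 → 1000 * (A * |x - y|) ≤ t := by
      intro x y z h
      rw [← sub_mul, sub_sub_sub_cancel_right, abs_mul, abs_of_pos hst, ← mul_div_assoc, div_lt_one ht0] at h
      linarith
    exact ⟨h3 _ _ _ (h1 0), h3 _ _ _ (h1 2)⟩
  have hsW : W.filter (fun p => F p = a) ⊆ W := filter_subset _ _
  have hsB : B.filter (fun p => F p = b) ⊆ B := filter_subset _ _
  have hsu := Finset.union_subset_union hsW hsB
  have cl1 : ((W.filter (fun p => F p = a)).card : ℝ) ≤ W.card := by exact_mod_cast Finset.card_le_card hsW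
  have cl2 : ((B.filter (fun p => F p = b)).card : ℝ) ≤ B.card := by exact_mod_cast Finset.card_le_card hsB
  have key := piece (m := m / A^9) (n := n / A^9) P (D.mono (filter_subset (fun r => (fW r, fB r) = (a, b)) R)) _ _
    (fun p hp => hW p (hsW hp)) (fun p hp => hB p (hsB hp)) (cl1.trans hWV) (cl2.trans hBV) (by positivity) (by positivity)
    (fun p hp q hq => hs p (hsW hp) q (hsB hq)) (fun p hp q hq => hd p (hsu hp) q (hsu hq))
    (hcell W Finset.subset_union_left a) (hcell B Finset.subset_union_right b)
    (fun r hr => by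
      obtain ⟨h1, h2⟩ := mem_filter.1 hr
      rw [← (Prod.mk.inj h2).1]; exact (hfW r h1).2)
    (fun r hr => by
      obtain ⟨h1, h2⟩ := mem_filter.1 hr
      rw [← (Prod.mk.inj h2).2]; exact (hfB r h1).2)
  have hSS := SS_le cl1 cl2 (Nat.cast_nonneg _) (Nat.cast_nonneg _) hm hn hN1
  have h2 : (R.card : ℝ) ≤ ((T.card * T.card : ℕ) : ℝ) * (R.filter (fun r => (fW r, fB r) = (a, b))).card := by
    rw [card_product] at hab2
    exact_mod_cast hab2
  refine h2.trans ?_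
  push_cast
  calc ((T.card : ℝ) * T.card) * (R.filter (fun r => (fW r, fB r) = (a, b))).card
      ≤ (A^9 * A^9) * (A^176 * ((A^9)^2 * SS W.card B.card m n)) := by
        refine mul_le_mul (mul_le_mul hN hN (Nat.cast_nonneg _) (zero_le_one.trans hN1))
          (key.trans (mul_le_mul_of_nonneg_left hSS (pow_nonneg hA0.le _))) (Nat.cast_nonneg _) (by positivity)
    _ = _ := by ring
lemma domD_c {p : Param} (h : p ∈ domD) : |p.1 0| ≤ 1 ∧ |p.1 1| ≤ 1 := by
  have h2 := domD_x h
  rw [← sq_le_one_iff_abs_le_one, ← sq_le_one_iff_abs_le_one]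
  constructor
  · nlinarith
  nlinarith
lemma sepV {δ : ℝ} (W : Finset Param) (hW : ∀ p ∈ W, p ∈ domD) (hδ : 0 < δ) (hδ1 : δ ≤ 1 / 1000)
    (hs : ∀ p ∈ W, ∀ q ∈ W, p ≠ q → δ ≤ pdist p q) : (W.card : ℝ) ≤ (δ ^ 5)⁻¹ := by
  have hc : 0 < 2 / δ := by positivity
  have key := box4 W ![fun p => p.1 0 * (2 / δ), fun p => p.1 1 * (2 / δ), fun p => p.2 * (2 / δ), fun _ => 0] (2 / δ) hc.le
    (by
      intro k p hp
      have h1 := domD_r (hW p hp)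
      have h2 := domD_c (hW p hp)
      have h3 : ∀ x : ℝ, |x| ≤ 1 → |x * (2 / δ)| ≤ 2 / δ := by
        intro x hx
        rw [abs_mul, abs_of_pos hc]
        exact mul_le_of_le_one_left hc.le hx
      fin_cases k
      · exact h3 _ h2.1
      · exact h3 _ h2.2
      · exact h3 _ (abs_le.2 ⟨by linarith, h1.2⟩)
      · change |(0:ℝ)| ≤ _
        linarith)
    (by
      intro p hp q hq h
      by_contra hne
      have h1 := hs p hp q hq hne
      have h2 : ∀ x y : ℝ, |x * (2 / δ) - y * (2 / δ)| < 1 → (x - y)^2 ≤ δ^2 / 4 := by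
        intro x y h
        rw [← sub_mul, abs_mul, abs_of_pos hc, mul_div_assoc', div_lt_one hδ] at h
        have h : |x - y| ≤ |δ / 2| := by rw [abs_of_pos (half_pos hδ)]; linarith
        have := sq_le_sq.2 h
        linarith
      have e0 := h2 _ _ (h 0)
      have e1 := h2 _ _ (h 1)
      have e2 := h2 _ _ (h 2)
      have e3 := pdist_sq p q
      nlinarith)
  refine key.trans ?_
  have h1 : 2 * (2 / δ) + 1 ≤ 5 / δ := by
    have : 1 ≤ 1 / δ := by rw [le_div_iff₀ hδ]; linarith
    grind
  calc (2 * (2 / δ) + 1)^4 ≤ (5 / δ)^4 := pow_le_pow_left₀ (by positivity) h1 4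
    _ = 625 * (δ * (δ^5)⁻¹) := by field_simp; norm_num
    _ ≤ (δ^5)⁻¹ := by
      have : 0 < (δ^5)⁻¹ := by positivity
      nlinarith
lemma triv {δ Sg σ t X Y : ℝ} {R : Finset (Param × Plane)} {U : Param × Plane → ℝ} (D : RD δ Sg σ R U) (fs : Quad)
    (hS : 0 < Sg) (hS1 : Sg ≤ 1) (ht : 0 < t) (ht1 : t ≤ 1) (hSt : Sg ^ 2 * t = δ) (hX : 1 ≤ X) (h1 : 1 ≤ X * Sg)
    (h2 : Y ≤ X * δ)
    (h : ∀ r ∈ R, |(Qd σ r.1).c0 - fs.c0| ≤ Y ∧ |(Qd σ r.1).c1 - fs.c1| ≤ Y ∧ |(Qd σ r.1).c2 - fs.c2| ≤ Y) :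
    (R.card : ℝ) ≤ (700 * X ^ 3) ^ 4 := by
  have e1 : δ ≤ Sg * t := by
    rw [← hSt, sq, mul_assoc]; exact mul_le_of_le_one_left (by positivity) hS1
  have e2 : Sg * t ≤ t := mul_le_of_le_one_left ht.le hS1
  have hX0 : 0 < X := by linarith
  have e3 : Y ≤ X * (Sg * t) := h2.trans (mul_le_mul_of_nonneg_left e1 hX0.le)
  have e4 : Y ≤ X * t := e3.trans (mul_le_mul_of_nonneg_left e2 hX0.le)
  have z1 : ∀ f : Quad, f.ev 0 = f.c0 := by intro f; simp [ev]
  have z2 : ∀ f : Quad, f.der 0 = f.c1 := by intro f; simp [der]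
  refine boxR (us := 0) D.hσ R U fs D.hR D.hC D.hinc hS hS1 ht ht1 hSt hX ?_ ?_ ?_ ?_
  · intro r hr
    rw [sub_zero]; exact (D.hC r hr).1.trans h1
  · intro r hr; grind
  · intro r hr; grind
  · intro r hr; grind
lemma charts {δ Sg Bd : ℝ} {R : Finset (Param × Plane)} (hR : ∀ r ∈ R, IsRectData r)
    (hinc : ∀ r ∈ R, ∀ r' ∈ R, r ≠ r' → ¬ Comp δ Sg 100 r r')
    (h : ∀ σ R' U, R' ⊆ R → RD δ Sg σ R' U → (R'.card : ℝ) ≤ Bd) : (R.card : ℝ) ≤ 2 * Bd := by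
  have ex : ∀ r, ∃ σ u : ℝ, r ∈ R → (σ = 1 ∨ σ = -1) ∧ Ch σ u r := by
    intro r
    by_cases hr : r ∈ R
    · obtain ⟨σ, h1, u, h2⟩ := chart_ex (hR r hr)
      grind
    · exact ⟨0, 0, fun h => absurd h hr⟩
  choose s U hsU using ex
  have hb : ∀ σ, (σ = 1 ∨ σ = -1) → ((R.filter (fun r => s r = σ)).card : ℝ) ≤ Bd := by
    intro σ hσ
    refine h σ _ U (filter_subset _ _) ⟨hσ, ?_, ?_, ?_⟩
    · intro r hr; exact hR r (mem_filter.1 hr).1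
    · intro r hr
      have := mem_filter.1 hr
      grind
    · intro r hr r' hr'; exact hinc r (mem_filter.1 hr).1 r' (mem_filter.1 hr').1
  have hsub : R ⊆ R.filter (fun r => s r = 1) ∪ R.filter (fun r => s r = -1) := by
    intro r hr
    rw [Finset.mem_union, mem_filter, mem_filter]
    rcases (hsU r hr).1 with h | h
    · exact Or.inl ⟨hr, h⟩
    · exact Or.inr ⟨hr, h⟩
  have h1 := (Finset.card_le_card hsub).trans (Finset.card_union_le _ _)
  have h2 : (R.card : ℝ) ≤ (R.filter (fun r => s r = 1)).card + (R.filter (fun r => s r = -1)).card := by exact_mod_cast h1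
  have h3 := hb 1 (Or.inl rfl)
  have h4 := hb (-1) (Or.inr rfl)
  linarith
lemma t2_num {a0 a1 a2 u E : ℝ} (hu : |u| ≤ 1) (h0 : |a0 + a1 * u + a2 * u^2| ≤ E) (h1 : |a1 + 2 * a2 * u| ≤ E)
    (h2 : |a2| ≤ E) : |a0| ≤ 3 * E ∧ |a1| ≤ 3 * E := by
  have e1 : |a2 * u| ≤ E := by
    rw [abs_mul]; exact (mul_le_of_le_one_right (abs_nonneg _) hu).trans h2
  have e2 : |a2 * u * u| ≤ E := by
    rw [abs_mul]; exact (mul_le_of_le_one_right (abs_nonneg _) hu).trans e1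
  have e3 : |(a1 + 2 * a2 * u) * u| ≤ E := by
    rw [abs_mul]; exact (mul_le_of_le_one_right (abs_nonneg _) hu).trans h1
  rw [abs_le] at *
  grind
lemma core_main {δ t Sg A V : ℝ} {m n I : ℕ} {R : Finset (Param × Plane)} (W B : Finset Param)
    (hW : ∀ p ∈ W, p ∈ domD) (hB : ∀ p ∈ B, p ∈ domD)
    (hWV : (W.card : ℝ) ≤ V) (hBV : (B.card : ℝ) ≤ V) (hm : 1 ≤ m) (hmW : m ≤ W.card) (hn : 1 ≤ n)
    (hA : 10 ^ 60 ≤ A) (hδ : 0 < δ) (ht : 0 < t) (ht1 : t ≤ 1) (hS : 0 < Sg) (hS1 : Sg ≤ 1)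
    (hSt : Sg ^ 2 * t = δ) (hcase : 1 ≤ A^2 * δ ∨ A * δ ≤ 1 / 4)
    (hI : 0 < I) (hI112 : 112 ^ I ≤ A) (hVδ : 1 ≤ V * δ) (hVA : V < 2 ^ ⌊A⌋₊) (hVI : V ^ 2 ≤ A ^ I)
    (hs : ∀ p ∈ W, ∀ q ∈ B, t ≤ A * pdist p q)
    (hd : ∀ p ∈ W ∪ B, ∀ q ∈ W ∪ B, pdist p q ≤ A * t)
    (hR : ∀ r ∈ R, IsRectData r)
    (hinc : ∀ r ∈ R, ∀ r' ∈ R, r ≠ r' → ¬ Comp δ Sg 100 r r')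
    (hgW : ∀ r ∈ R, m ≤ (W.filter (Gd δ Sg A r)).card) (hgB : ∀ r ∈ R, n ≤ (B.filter (Gd δ Sg A r)).card) :
    (R.card : ℝ) ≤ A^300 * SS W.card B.card m n := by
  have hA1 : 1 ≤ A := le_trans (by norm_num) hA
  have hA0 : 0 < A := by linarith
  have hm' : (0:ℝ) < m := by exact_mod_cast hm
  have hn' : (0:ℝ) < n := by exact_mod_cast hn
  have hSS : 1 ≤ SS W.card B.card m n := by
    have h1 : 1 ≤ (W.card : ℝ) / m := by rw [le_div_iff₀ hm', one_mul]; exact_mod_cast hmW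
    have h2 : 0 ≤ ((W.card : ℝ) * B.card / (m * n)) ^ ((3:ℝ)/4) :=
      Real.rpow_nonneg (div_nonneg (mul_nonneg (Nat.cast_nonneg _) (Nat.cast_nonneg _)) (mul_pos hm' hn').le) _
    have h3 : 0 ≤ (B.card : ℝ) / n := div_nonneg (Nat.cast_nonneg _) hn'.le
    unfold SS; linarith
  have fin : ∀ k : ℕ, k ≤ 299 → (R.card : ℝ) ≤ 2 * (A^k * SS W.card B.card m n) → (R.card : ℝ) ≤ A^300 * SS W.card B.card m n := by
    intro k hk h
    refine h.trans ?_
    rw [← mul_assoc]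
    refine mul_le_mul_of_nonneg_right ?_ (by linarith)
    calc 2 * A^k ≤ A * A^299 := mul_le_mul (by linarith) (pow_le_pow_right₀ hA1 hk) (by positivity) hA0.le
      _ = A^300 := by ring
  have hp7 : ∀ X : ℝ, ∀ k : ℕ, 0 ≤ X → 5600 * X^3 ≤ A^k → (5600 * X^3)^4 ≤ A^(k*4) * SS W.card B.card m n := by
    intro X k h0 h
    have h1 := pow_le_pow_left₀ (by positivity) h 4
    rw [← pow_mul] at h1
    exact h1.trans (le_mul_of_one_le_right (by positivity) hSS)
  by_cases hc1 : 1 ≤ A^2 * δ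
  · refine fin (7*4) (by norm_num) (charts hR hinc ?_)
    intro σ R' U hR' D
    have hδS : δ ≤ Sg := by
      rw [← hSt]; nlinarith [mul_le_of_le_one_right (sq_nonneg Sg) ht1]
    have h1 := triv (X := 2 * A^2) (Y := 2) D ⟨0, 0, 0⟩ hS hS1 ht ht1 hSt (by nlinarith)
      (by nlinarith [mul_le_mul_of_nonneg_left hδS (sq_nonneg A)]) (by linarith) (by
      intro r hr
      have h1 := domD_r (D.hR r hr).1
      obtain ⟨h3, h4⟩ := domD_c (D.hR r hr).1
      rw [abs_le] at h3 h4
      simp only [Qd, sub_zero, abs_le]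
      rcases D.hσ with h | h <;> rw [h] <;> refine ⟨⟨?_, ?_⟩, ⟨?_, ?_⟩, ?_, ?_⟩ <;> linarith)
    have e : 700 * (2 * A^2)^3 = 5600 * (A^2)^3 := by ring
    rw [e] at h1
    refine h1.trans (hp7 _ 7 (by positivity) ?_)
    rw [← pow_mul, pow_succ' A 6]
    exact mul_le_mul_of_nonneg_right (by linarith) (by positivity)
  have hAδ := hcase.resolve_left hc1
  by_cases hS10 : A^10 * Sg ≤ 1
  · have P : Par δ t Sg A V I := ⟨hA, hδ, ht, ht1, hS, hSt, hS10, hAδ, hI, hI112, hVδ, hVA, hVI⟩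
    refine fin 212 (by norm_num) (charts hR hinc ?_)
    intro σ R' U hR' D
    exact chart_main P D W B hW hB hWV hBV hm' hn' hs hd (fun r hr => by exact_mod_cast hgW r (hR' hr))
      (fun r hr => by exact_mod_cast hgB r (hR' hr))
  · rw [not_le] at hS10
    refine fin (70*4) (by norm_num) (charts hR hinc ?_)
    intro σ R' U hR' D
    obtain ⟨ps, hps⟩ : W.Nonempty := card_pos.1 (by omega)
    have h23 : A^10 * Sg ≤ A^23 * Sg := mul_le_mul_of_nonneg_right (pow_le_pow_right₀ hA1 (by norm_num)) hS.le
    have hY : 2000 * (A^2 * t) ≤ A^23 * δ := by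
      have h1 : 1 ≤ (A^10 * Sg)^2 := one_le_pow₀ hS10.le
      have e : A^23 * δ = A * (A^2 * t) * (A^10 * Sg)^2 := by rw [← hSt]; ring
      rw [e]
      have h2 : 2000 * (A^2 * t) ≤ A * (A^2 * t) := mul_le_mul_of_nonneg_right (by linarith) (by positivity)
      exact h2.trans (le_mul_of_one_le_right (by positivity) h1)
    have h1 := triv (X := A^23) (Y := 2000 * (A^2 * t)) D (Qd σ ps) hS hS1 ht ht1 hSt (one_le_pow₀ hA1)
      (by linarith) hY (by
      intro r hr
      obtain ⟨p, hp⟩ := card_pos.1 (lt_of_lt_of_le hm (hgW r (hR' hr)))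
      obtain ⟨hp, hg⟩ := mem_filter.1 hp
      obtain ⟨c0, c1, c2⟩ := closeA D.hσ (D.hR r hr) (D.hC r hr) (hW p hp) hS hS1 ht ht1 hA1 hSt hAδ hg
      have hu := (D.hC r hr).1
      have x1 : Sg * t ≤ t := mul_le_of_le_one_left ht.le hS1
      have x2 : δ ≤ t := by rw [← hSt]; exact mul_le_of_le_one_left ht.le (pow_le_one₀ hS.le hS1)
      have x3 := mul_le_mul_of_nonneg_left x1 (sq_nonneg A)
      have x4 := mul_le_mul_of_nonneg_left x2 (sq_nonneg A)
      have c0 : |(Qd σ p).ev (U r) - (Qd σ r.1).ev (U r)| ≤ 600 * (A^2 * t) := c0.trans (by linarith)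
      have c1 : |(Qd σ p).der (U r) - (Qd σ r.1).der (U r)| ≤ 600 * (A^2 * t) := c1.trans (by linarith)
      have y := t2_num (a0 := (Qd σ p).c0 - (Qd σ r.1).c0) (a1 := (Qd σ p).c1 - (Qd σ r.1).c1) hu
        (by convert c0 using 2; simp only [ev]; ring) (by convert c1 using 2; simp only [der]; ring) c2
      have z := hd p (Finset.mem_union_left _ hp) ps (Finset.mem_union_left _ hps)
      obtain ⟨z0, z1, z2⟩ := coord_le p ps
      have w1 : A * t ≤ A^2 * t := mul_le_mul_of_nonneg_right (le_self_pow₀ hA1 (by norm_num)) ht.le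
      have w2 : 0 < A * t := by positivity
      simp only [Qd, abs_le] at y c2 z0 z1 z2 ⊢
      rcases D.hσ with h | h <;> rw [h] at y c2 ⊢ <;> refine ⟨⟨?_, ?_⟩, ⟨?_, ?_⟩, ?_, ?_⟩ <;> linarith)
    have h2 : (700 * (A^23)^3)^4 ≤ (5600 * (A^23)^3)^4 := by gcongr; norm_num
    refine (h1.trans h2).trans (hp7 _ 70 (by positivity) ?_)
    rw [← pow_mul, pow_succ' A 69]
    exact mul_le_mul_of_nonneg_right (by linarith) (by positivity)
lemma ev_small (ε : ℝ) (hε : 0 < ε) (I N : ℕ) : ∃ δ₀ > (0:ℝ), ∀ δ : ℝ, 0 < δ → δ ≤ δ₀ →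
    10^60 ≤ δ^(-ε) ∧ (112:ℝ)^I ≤ δ^(-ε) ∧ (δ^(-ε))^N < 2 ^ ⌊δ^(-ε)⌋₊ ∧ δ ≤ 1 / 1000 := by
  have h0 : Filter.Tendsto (fun δ : ℝ => δ^(-ε)) (nhdsWithin 0 (Ioi 0)) Filter.atTop := by
    have h1 := (tendsto_rpow_atTop hε).comp (tendsto_inv_nhdsGT_zero (𝕜 := ℝ))
    refine h1.congr' ?_
    filter_upwards [self_mem_nhdsWithin] with δ hδ
    have : (0:ℝ) < δ := hδ
    rw [Function.comp_apply, Real.inv_rpow this.le, Real.rpow_neg this.le]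
  have h1 : ∀ᶠ A : ℝ in Filter.atTop, A^N < 2 ^ ⌊A⌋₊ := by
    have h2 := tendsto_pow_const_div_const_pow_of_one_lt N (one_lt_two : (1:ℝ) < 2)
    have h3 := (h2.comp (Filter.tendsto_add_atTop_nat 1)).comp (tendsto_nat_floor_atTop (α := ℝ))
    filter_upwards [h3.eventually_lt_const (show (0:ℝ) < 1/2 by norm_num), Filter.eventually_ge_atTop 0] with A hA hA0
    simp only [Function.comp_apply] at hA
    rw [div_lt_iff₀ (by positivity), pow_succ] at hA
    refine lt_of_le_of_lt (pow_le_pow_left₀ hA0 ((Nat.lt_floor_add_one A).le) N) ?_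
    push_cast at hA
    linarith
  have h2 := (h0.eventually_ge_atTop (10^60)).and ((h0.eventually_ge_atTop (112^I)).and ((h0.eventually h1).and
    (nhdsWithin_le_nhds (Iic_mem_nhds (show (0:ℝ) < 1/1000 by norm_num)))))
  obtain ⟨u, hu, h⟩ := mem_nhdsGT_iff_exists_Ioc_subset.1 h2
  exact ⟨u, hu, fun δ h1 h2 => h ⟨h1, h2⟩⟩
lemma main_thm :
    ∃ K > (0 : ℝ),
    ∀ ε : ℝ, 0 < ε → ∃ δ₀ > (0 : ℝ), ∀ δ : ℝ, 0 < δ → δ ≤ δ₀ →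
    ∀ t : ℝ, δ ≤ t → t ≤ 1 →
    ∀ W B : Set Param, W ⊆ domD → B ⊆ domD → W.Finite → B.Finite →
      AlmostBipartite δ ε t W B →
    ∀ m n : ℕ, 1 ≤ m → m ≤ Nat.card W → 1 ≤ n → n ≤ Nat.card B →
    ∀ R : Finset (Param × Plane), (∀ r ∈ R, IsRectData r) →
      (∀ r ∈ R, ∀ r' ∈ R, r ≠ r' → ¬ Comp δ (Real.sqrt (δ / t)) 100 r r') →
      (∀ r ∈ R, m ≤ typeCount δ (Real.sqrt (δ / t)) (δ ^ (1 - ε)) W r ∧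
        n ≤ typeCount δ (Real.sqrt (δ / t)) (δ ^ (1 - ε)) B r) →
      (R.card : ℝ) ≤ δ ^ (-(K * ε)) *
        (((Nat.card W : ℝ) * (Nat.card B : ℝ) / ((m : ℝ) * (n : ℝ))) ^ ((3 : ℝ) / 4) +
          (Nat.card W : ℝ) / (m : ℝ) + (Nat.card B : ℝ) / (n : ℝ)) := by
  refine ⟨300, by norm_num, fun ε hε => ?_⟩
  obtain ⟨δ₀, hδ₀, H⟩ := ev_small ε hε (⌈10 / ε⌉₊) (⌈10 / ε⌉₊)
  refine ⟨δ₀, hδ₀, ?_⟩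
  intro δ hδ hδδ t hδt ht1 W B hW hB hWf hBf hbip m n hm hmW hn hnB R hR hinc hty
  obtain ⟨hA, hI112, hVA, hδ1⟩ := H δ hδ hδδ
  obtain ⟨W, rfl⟩ := hWf.exists_finset_coe
  obtain ⟨B, rfl⟩ := hBf.exists_finset_coe
  obtain ⟨hsW, hsB, hs, hd⟩ := hbip
  have cW : Nat.card (↑(W : Set Param)) = W.card := by rw [Nat.card_coe_set_eq, Set.ncard_coe_finset]
  have cB : Nat.card (↑(B : Set Param)) = B.card := by rw [Nat.card_coe_set_eq, Set.ncard_coe_finset]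
  rw [cW] at hmW ⊢
  rw [cB] at hnB ⊢
  have ht : 0 < t := lt_of_lt_of_le hδ hδt
  have hεI : 10 ≤ ε * (⌈10 / ε⌉₊ : ℝ) := by
    rw [mul_comm, ← div_le_iff₀ hε]; exact Nat.le_ceil _
  have hδ1' : δ ≤ 1 := by linarith
  have hρ : δ^(1-ε) = δ^(-ε) * δ := by
    rw [sub_eq_neg_add, Real.rpow_add hδ, Real.rpow_one]
  have hpow : ∀ k : ℕ, (δ^(-ε))^k = δ^(-(k * ε)) := by
    intro k
    rw [← Real.rpow_natCast, ← Real.rpow_mul hδ.le]; congr 1; ring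
  have hinvp : ∀ k : ℕ, (δ^k)⁻¹ = δ^(-(k:ℝ)) := by
    intro k; rw [Real.rpow_neg hδ.le, Real.rpow_natCast]
  have hVI : ((δ^5)⁻¹)^2 ≤ (δ^(-ε))^⌈10 / ε⌉₊ := by
    rw [hpow, ← inv_pow, ← pow_mul, inv_pow, hinvp]
    refine Real.rpow_le_rpow_of_exponent_ge hδ hδ1' ?_
    push_cast
    linarith
  have hV1 : 1 ≤ (δ^5)⁻¹ := (one_le_inv₀ (by positivity)).2 (pow_le_one₀ hδ.le hδ1')
  have hprod : δ^(-ε) * δ^ε = 1 := by rw [← Real.rpow_add hδ]; simp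
  have tc : ∀ (X : Finset Param) (r : Param × Plane), typeCount δ (Real.sqrt (δ / t)) (δ ^ (1 - ε)) X r =
      (X.filter (Gd δ (Real.sqrt (δ / t)) (δ^(-ε)) r)).card := by
    intro X r
    rw [typeCount, hρ, Nat.card_coe_set_eq, ← Set.ncard_coe_finset, Finset.coe_filter]
    rfl
  have hcd : 0 < δ / t := by positivity
  have key := core_main (δ := δ) (t := t) (Sg := Real.sqrt (δ / t)) (A := δ^(-ε)) (V := (δ^5)⁻¹) (m := m) (n := n)
    (I := ⌈10 / ε⌉₊) (R := R) W B (fun p hp => hW hp) (fun p hp => hB hp)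
    (sepV W (fun p hp => hW hp) hδ hδ1 hsW) (sepV B (fun p hp => hB hp) hδ hδ1 hsB) hm hmW hn hA hδ ht ht1
    (Real.sqrt_pos.2 hcd) (Real.sqrt_le_one.2 ((div_le_one ht).2 hδt))
    (by rw [Real.sq_sqrt hcd.le]; field_simp)
    (by
      rcases le_or_gt (1/2) ε with h | h
      · left
        have h1 : (δ^(-ε))^2 * δ = δ^(1 - 2 * ε) := by
          rw [hpow, sub_eq_neg_add, Real.rpow_add hδ, Real.rpow_one]; norm_num
        rw [h1]
        exact Real.one_le_rpow_of_pos_of_le_one_of_nonpos hδ hδ1' (by linarith)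
      · right
        rw [← hρ]
        have h1 : δ^(1-ε) ≤ δ^((1:ℝ)/2) := Real.rpow_le_rpow_of_exponent_ge hδ hδ1' (by linarith)
        refine h1.trans ?_
        rw [← Real.sqrt_eq_rpow]
        exact Real.sqrt_le_iff.2 ⟨by norm_num, by linarith⟩)
    (Nat.ceil_pos.2 (by positivity)) hI112
    (by
      have e : (δ^5)⁻¹ * δ = (δ^4)⁻¹ := by field_simp
      rw [e]
      exact (one_le_inv₀ (by positivity)).2 (pow_le_one₀ hδ.le hδ1'))
    (lt_of_le_of_lt ((le_self_pow₀ hV1 (by norm_num)).trans hVI) hVA) hVI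
    (by
      intro p hp q hq
      have h1 := mul_le_mul_of_nonneg_left (hs p hp q hq) (Real.rpow_nonneg hδ.le (-ε))
      rwa [← mul_assoc, hprod, one_mul] at h1)
    (by
      intro p hp q hq
      rw [← Finset.mem_coe, Finset.coe_union] at hp hq
      exact hd p hp q hq)
    hR hinc (fun r hr => by rw [← tc]; exact (hty r hr).1) (fun r hr => by rw [← tc]; exact (hty r hr).2)
  rw [hpow] at key
  unfold SS at key
  exact_mod_cast key
end Helpers

/-- a variant of Wolff's tangency bound: an upper bound for the number of
pairwise `100`-incomparable `(δ,√(δ/t))`-rectangles of type `(≥m,≥n)_ε` relative to a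
`(δ,ε)`-almost `t`-bipartite pair `(W,B)`. -/
theorem wolff_tangency_bound :
    ∃ K > (0 : ℝ),
    ∀ ε : ℝ, 0 < ε → ∃ δ₀ > (0 : ℝ), ∀ δ : ℝ, 0 < δ → δ ≤ δ₀ →
    ∀ t : ℝ, δ ≤ t → t ≤ 1 →
    ∀ W B : Set Param, W ⊆ domD → B ⊆ domD → W.Finite → B.Finite →
      AlmostBipartite δ ε t W B →
    ∀ m n : ℕ, 1 ≤ m → m ≤ Nat.card W → 1 ≤ n → n ≤ Nat.card B →
    ∀ R : Finset (Param × Plane), (∀ r ∈ R, IsRectData r) →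
      (∀ r ∈ R, ∀ r' ∈ R, r ≠ r' → ¬ Comp δ (Real.sqrt (δ / t)) 100 r r') →
      (∀ r ∈ R, m ≤ typeCount δ (Real.sqrt (δ / t)) (δ ^ (1 - ε)) W r ∧
        n ≤ typeCount δ (Real.sqrt (δ / t)) (δ ^ (1 - ε)) B r) →
      (R.card : ℝ) ≤ δ ^ (-(K * ε)) *
        (((Nat.card W : ℝ) * (Nat.card B : ℝ) / ((m : ℝ) * (n : ℝ))) ^ ((3 : ℝ) / 4) +
          (Nat.card W : ℝ) / (m : ℝ) + (Nat.card B : ℝ) / (n : ℝ)) :=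
  main_thm

end
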